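/- (Conditional Bonnesen-type inequality for H².) Let K be a compact geodesically convex subset of the hyperbolic plane H² (of constant curvature −1) with nonempty interior. If (2π + A_K)² − P_K² ≥ 0, then P_K² − A_K·(4π + A_K) ≥ (sinh R_K − sinh r_K)²·((2π + A_K)² − P_K²)² / (4·(2π + A_K)²). -/

import Mathlib

open MeasureTheory Metric Real UpperHalfPlane

open scoped UpperHalfPlane

noncomputable section

instance : MeasurableSpace ℍ := borel ℍ

instance : BorelSpace ℍ := ⟨rfl⟩

/-- The hyperbolic area measure on the upper half-plane: the measure with density
`y⁻²` with respect to the planar Lebesgue measure. -/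
def hypAreaMeasure : Measure ℍ :=
  (Measure.comap (fun z : ℍ => (z : ℂ)) volume).withDensity
    (fun z => ENNReal.ofReal ((z.im ^ 2)⁻¹))

/-- The hyperbolic area of a subset of the hyperbolic plane. -/
def hypArea (K : Set ℍ) : ℝ := (hypAreaMeasure K).toReal

/-- The hyperbolic perimeter: one-dimensional Hausdorff measure (with respect to the
hyperbolic metric) of the topological boundary. -/
def hypPerim (K : Set ℍ) : ℝ := (μH[1] (frontier K)).toReal

/-- Geodesic convexity in the hyperbolic plane. -/
def HypConvex (K : Set ℍ) : Prop :=
  ∀ x ∈ K, ∀ y ∈ K, ∀ z : ℍ, dist x z + dist z y = dist x y → z ∈ K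

/-- The hyperbolic circumradius of `K`. -/
def hypCircumradius (K : Set ℍ) : ℝ :=
  sInf {R : ℝ | ∃ c : ℍ, K ⊆ Metric.closedBall c R}

/-- The hyperbolic inradius of `K`. -/
def hypInradius (K : Set ℍ) : ℝ :=
  sSup {r : ℝ | ∃ c : ℍ, Metric.closedBall c r ⊆ K}

/-- `K` is a closed hyperbolic disc of positive radius. -/
def IsHypDisc (K : Set ℍ) : Prop :=
  ∃ (c : ℍ) (r : ℝ), 0 < r ∧ K = Metric.closedBall c r

end

noncomputable section

/-- Real linear map of `ℂ` with given matrix. -/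
def linC (a b c d : ℝ) : ℂ →L[ℝ] ℂ :=
  (Complex.equivRealProdCLM.symm : ℝ × ℝ →L[ℝ] ℂ).comp
    ((a • Complex.reCLM + b • Complex.imCLM).prod (c • Complex.reCLM + d • Complex.imCLM))

lemma linC_det (a b c d : ℝ) : (linC a b c d).det = a * d - b * c := by
  have : (linC a b c d).det = LinearMap.det ((linC a b c d : ℂ →L[ℝ] ℂ) : ℂ →ₗ[ℝ] ℂ) := rfl
  rw [this, ← LinearMap.det_toMatrix Complex.basisOneI, Matrix.det_fin_two]
  simp [LinearMap.toMatrix_apply, linC, Complex.coe_basisOneI]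

lemma hasFDerivAt_mk {g h : ℂ → ℝ} {a b c d : ℝ} {z : ℂ}
    (hg : HasFDerivAt g (a • Complex.reCLM + b • Complex.imCLM) z)
    (hh : HasFDerivAt h (c • Complex.reCLM + d • Complex.imCLM) z) :
    HasFDerivAt (fun z => (⟨g z, h z⟩ : ℂ)) (linC a b c d) z :=
  (Complex.equivRealProdCLM.symm : ℝ × ℝ →L[ℝ] ℂ).hasFDerivAt.comp z (hg.prodMk hh)

lemma map_eq_of_jac {s : Set ℂ} (hs : MeasurableSet s) {f : ℂ → ℂ} (hfm : Measurable f)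
    {f' : ℂ → ℂ →L[ℝ] ℂ}
    (hf' : ∀ x ∈ s, HasFDerivAt f (f' x) x) (hinj : Set.InjOn f s) (hsurj : f '' s = Set.univ)
    {u v : ℂ → ℝ}
    (hdet : ∀ x ∈ s, |(f' x).det| * v (f x) = u x) :
    Measure.map f ((volume.restrict s).withDensity (fun x => ENNReal.ofReal (u x))) =
      volume.withDensity (fun x => ENNReal.ofReal (v x)) := by
  ext S hS
  rw [Measure.map_apply hfm hS, withDensity_apply _ hS, withDensity_apply _ (hfm hS)]
  rw [← lintegral_indicator hS, ← lintegral_indicator (hfm hS)]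
  have := lintegral_image_eq_lintegral_abs_det_fderiv_mul volume hs
    (fun x hx => (hf' x hx).hasFDerivWithinAt) hinj
    (S.indicator fun x => ENNReal.ofReal (v x))
  rw [hsurj, Measure.restrict_univ] at this
  rw [this]
  refine setLIntegral_congr_fun hs fun x hx => ?_
  by_cases h : f x ∈ S
  · have h' : x ∈ f ⁻¹' S := h
    simp only [Set.indicator_of_mem h, Set.indicator_of_mem h']
    rw [← ENNReal.ofReal_mul (abs_nonneg _), hdet x hx]
  · have h' : x ∉ f ⁻¹' S := h
    simp only [Set.indicator_of_notMem h, Set.indicator_of_notMem h', mul_zero]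

/-- The time coordinate of the hyperboloid. -/
def TT (w : ℂ) : ℝ := √(1 + w.re ^ 2 + w.im ^ 2)

lemma TT_sq (w : ℂ) : TT w ^ 2 = 1 + w.re ^ 2 + w.im ^ 2 := Real.sq_sqrt (by positivity)
lemma TT_pos (w : ℂ) : 0 < TT w := Real.sqrt_pos.2 (by positivity)
lemma TT_ge_one (w : ℂ) : 1 ≤ TT w := Real.one_le_sqrt.2 (by nlinarith [sq_nonneg w.re, sq_nonneg w.im])
lemma TT_eq_of_sq {w : ℂ} {x : ℝ} (hx : 0 ≤ x) (h : x ^ 2 = 1 + w.re ^ 2 + w.im ^ 2) : TT w = x := by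
  rw [TT, ← h, Real.sqrt_sq hx]
@[fun_prop] lemma TT_cont : Continuous TT := by unfold TT; fun_prop
@[fun_prop] lemma TT_meas : Measurable TT := TT_cont.measurable

/-- Minus the Minkowski product. -/
def mink (v w : ℂ) : ℝ := TT v * TT w - (v.re * w.re + v.im * w.im)

/-- The invariant measure in hyperboloid coordinates. -/
def nu : Measure ℂ := volume.withDensity (fun w => ENNReal.ofReal (1 / TT w))

/-- A hyperboloid coordinate system. -/
structure IsFrame (W : ℍ → ℂ) : Prop where
  dist_eq : ∀ z w, Real.cosh (dist z w) = mink (W z) (W w)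
  surj : Function.Surjective W
  cont : Continuous W
  meas : Measure.map W hypAreaMeasure = nu

lemma TT_hasFDerivAt (w : ℂ) : HasFDerivAt TT ((w.re / TT w) • Complex.reCLM + (w.im / TT w) • Complex.imCLM) w := by
  have h1 : HasFDerivAt (fun w : ℂ => w.re) Complex.reCLM w := Complex.reCLM.hasFDerivAt
  have h2 : HasFDerivAt (fun w : ℂ => w.im) Complex.imCLM w := Complex.imCLM.hasFDerivAt
  have h3 := ((((hasFDerivAt_const (1:ℝ) w).add (h1.pow 2)).add (h2.pow 2))).sqrt
    (by simp only [Pi.add_apply]; positivity)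
  refine h3.congr_fderiv ?_
  ext x
  simp [TT]
  field_simp

lemma mink_self (v : ℂ) : mink v v = 1 := by
  have := TT_sq v; unfold mink; nlinarith

lemma IsFrame.inj {W : ℍ → ℂ} (hW : IsFrame W) : Function.Injective W := by
  intro x y h
  have h1 := hW.dist_eq x y
  rw [h, mink_self] at h1
  by_contra hne
  exact (Real.one_lt_cosh.2 (dist_ne_zero.2 hne)).ne' h1

lemma hyp_map_coe : Measure.map (fun z : ℍ => (z : ℂ)) hypAreaMeasure =
    (volume.restrict {z : ℂ | 0 < z.im}).withDensity (fun z => ENNReal.ofReal (1 / z.im ^ 2)) := by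
  have hemb : MeasurableEmbedding (fun z : ℍ => (z : ℂ)) :=
    UpperHalfPlane.isOpenEmbedding_coe.measurableEmbedding
  have hr : Set.range (fun z : ℍ => (z : ℂ)) = {z : ℂ | 0 < z.im} := UpperHalfPlane.range_coe
  ext S hS
  rw [Measure.map_apply hemb.measurable hS, hypAreaMeasure, withDensity_apply _ (hemb.measurable hS),
    withDensity_apply _ hS]
  rw [← hr, ← hemb.map_comap volume]
  rw [Measure.restrict_map hemb.measurable hS, hemb.lintegral_map]
  simp

/-- The base frame at `(x0, y0)` as a map of `ℂ`. -/
def baseMap (x0 y0 : ℝ) (z : ℂ) : ℂ :=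
  ⟨((z.re - x0) ^ 2 + z.im ^ 2 - y0 ^ 2) / (2 * y0 * z.im), (z.re - x0) / z.im⟩

lemma TT_baseMap (x0 : ℝ) {y0 : ℝ} (hy0 : 0 < y0) {z : ℂ} (hz : 0 < z.im) :
    TT (baseMap x0 y0 z) = ((z.re - x0) ^ 2 + z.im ^ 2 + y0 ^ 2) / (2 * y0 * z.im) := by
  refine TT_eq_of_sq (by positivity) ?_
  simp only [baseMap]
  field_simp
  ring

lemma TT_sub_re_pos (w : ℂ) : 0 < TT w - w.re := by
  have h := TT_sq w
  have h1 := TT_pos w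
  by_contra hc
  push Not at hc
  nlinarith [sq_nonneg w.im]

lemma baseMap_map (x0 : ℝ) {y0 : ℝ} (hy0 : 0 < y0) :
    Measure.map (baseMap x0 y0) ((volume.restrict {z : ℂ | 0 < z.im}).withDensity
      (fun z => ENNReal.ofReal (1 / z.im ^ 2))) = nu := by
  have hm : Measurable (baseMap x0 y0) := by
    have : baseMap x0 y0 = fun z => Complex.equivRealProdCLM.symm
      (((z.re - x0) ^ 2 + z.im ^ 2 - y0 ^ 2) / (2 * y0 * z.im), (z.re - x0) / z.im) := rfl
    rw [this]
    refine (Complex.equivRealProdCLM.symm.continuous.measurable).comp ?_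
    refine Measurable.prodMk ?_ ?_ <;> fun_prop
  have hk : ∀ z : ℂ, 0 < z.im → TT (baseMap x0 y0 z) - (baseMap x0 y0 z).re = y0 / z.im := by
    intro z hz
    rw [TT_baseMap x0 hy0 hz]
    simp only [baseMap]
    field_simp
    ring
  refine map_eq_of_jac (measurableSet_lt measurable_const Complex.measurable_im) hm
    (f' := fun z => linC ((z.re - x0) / (y0 * z.im))
      ((z.im ^ 2 - (z.re - x0) ^ 2 + y0 ^ 2) / (2 * y0 * z.im ^ 2))
      (1 / z.im) (-(z.re - x0) / z.im ^ 2)) ?_ ?_ ?_ ?_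
  · intro z hz
    have hz' : z.im ≠ 0 := ne_of_gt hz
    have h1 : HasFDerivAt (fun w : ℂ => w.re) Complex.reCLM z := Complex.reCLM.hasFDerivAt
    have h2 : HasFDerivAt (fun w : ℂ => w.im) Complex.imCLM z := Complex.imCLM.hasFDerivAt
    have hinv := (hasDerivAt_inv hz').comp_hasFDerivAt z h2
    refine hasFDerivAt_mk (g := fun z : ℂ => ((z.re - x0) ^ 2 + z.im ^ 2 - y0 ^ 2) / (2 * y0 * z.im))
      (h := fun z : ℂ => (z.re - x0) / z.im) ?_ ?_
    · have e : (fun z : ℂ => ((z.re - x0) ^ 2 + z.im ^ 2 - y0 ^ 2) / (2 * y0 * z.im)) =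
        fun z : ℂ => ((z.re - x0) ^ 2 + z.im ^ 2 - y0 ^ 2) * (((2 * y0)⁻¹) * z.im⁻¹) := by
        funext z; rw [div_eq_mul_inv, mul_inv]
      rw [e]
      refine (((((h1.sub_const x0).pow 2).add (h2.pow 2)).sub_const (y0 ^ 2)).mul
        (hinv.const_mul ((2 * y0)⁻¹))).congr_fderiv ?_
      ext
      simp; field_simp; ring
    · simp only [div_eq_mul_inv]
      refine ((h1.sub_const x0).mul hinv).congr_fderiv ?_
      ext
      simp; ring
  · intro z hz w hw h
    have e := hk z hz
    rw [h, hk w hw] at e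
    have hz' : 0 < z.im := hz
    have hw' : 0 < w.im := hw
    have e1 : z.im = w.im := by
      field_simp at e
      exact e
    have e2 : (z.re - x0) / z.im = (w.re - x0) / w.im := congrArg Complex.im h
    rw [e1] at e2
    field_simp at e2
    exact Complex.ext (by linarith) e1
  · refine Set.eq_univ_of_forall fun w => ?_
    have h1 := TT_sub_re_pos w
    have h2 := TT_sq w
    refine ⟨⟨x0 + w.im * (y0 / (TT w - w.re)), y0 / (TT w - w.re)⟩, ?_, ?_⟩
    · show 0 < y0 / (TT w - w.re)
      positivity
    · have : TT w ^ 2 - w.re ^ 2 = 1 + w.im ^ 2 := by linarith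
      apply Complex.ext
      · simp only [baseMap]
        field_simp
        nlinarith
      · simp only [baseMap]
        field_simp
        ring
  · intro z hz
    have hz' : 0 < z.im := hz
    rw [linC_det, TT_baseMap x0 hy0 hz]
    have : (z.re - x0) / (y0 * z.im) * (-(z.re - x0) / z.im ^ 2) -
      (z.im ^ 2 - (z.re - x0) ^ 2 + y0 ^ 2) / (2 * y0 * z.im ^ 2) * (1 / z.im) =
      - (((z.re - x0) ^ 2 + z.im ^ 2 + y0 ^ 2) / (2 * y0 * z.im ^ 3)) := by
      field_simp
      ring
    rw [this, abs_neg, abs_of_pos (by positivity)]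
    have : 0 < (z.re - x0) ^ 2 + z.im ^ 2 + y0 ^ 2 := by positivity
    field_simp

/-- Every point is the origin of some frame. -/
lemma exists_frame (o : ℍ) : ∃ W, IsFrame W ∧ W o = 0 := by
  have hy0 := o.im_pos
  refine ⟨fun z => baseMap o.re o.im z, ⟨?_, ?_, ?_, ?_⟩, ?_⟩
  · intro z w
    rw [UpperHalfPlane.cosh_dist, mink, TT_baseMap _ hy0 z.im_pos, TT_baseMap _ hy0 w.im_pos]
    have := z.im_pos
    have := w.im_pos
    rw [Complex.dist_eq, Complex.sq_norm, Complex.normSq_apply]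
    simp only [baseMap, UpperHalfPlane.coe_re, UpperHalfPlane.coe_im, Complex.sub_re, Complex.sub_im]
    field_simp
    ring
  · intro w
    have h1 := TT_sub_re_pos w
    have h2 := TT_sq w
    refine ⟨⟨⟨o.re + w.im * (o.im / (TT w - w.re)), o.im / (TT w - w.re)⟩, ?_⟩, ?_⟩
    · show 0 < o.im / (TT w - w.re)
      positivity
    · have : TT w ^ 2 - w.re ^ 2 = 1 + w.im ^ 2 := by linarith
      apply Complex.ext
      · simp only [baseMap]
        field_simp
        nlinarith
      · simp only [baseMap]
        field_simp
        ring
  · have : (fun z : ℍ => baseMap o.re o.im z) = fun z : ℍ => Complex.equivRealProdCLM.symm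
      (((z.re - o.re) ^ 2 + z.im ^ 2 - o.im ^ 2) / (2 * o.im * z.im), (z.re - o.re) / z.im) := rfl
    rw [this]
    refine (Complex.equivRealProdCLM.symm.continuous).comp ?_
    refine Continuous.prodMk ?_ ?_
    · refine Continuous.div (by fun_prop) (by fun_prop) (fun z => ?_)
      have := z.im_pos
      positivity
    · exact Continuous.div (by fun_prop) (by fun_prop) (fun z => z.im_pos.ne')
  · have hm : Measurable (baseMap o.re o.im) := by
      have : baseMap o.re o.im = fun z => Complex.equivRealProdCLM.symm
        (((z.re - o.re) ^ 2 + z.im ^ 2 - o.im ^ 2) / (2 * o.im * z.im), (z.re - o.re) / z.im) := rfl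
      rw [this]
      refine (Complex.equivRealProdCLM.symm.continuous.measurable).comp ?_
      refine Measurable.prodMk ?_ ?_ <;> fun_prop
    rw [← baseMap_map o.re hy0, ← hyp_map_coe, Measure.map_map hm]
    · rfl
    · exact UpperHalfPlane.isOpenEmbedding_coe.continuous.measurable
  · apply Complex.ext <;> simp [baseMap]


lemma measurable_mk {g h : ℂ → ℝ} (hg : Measurable g) (hh : Measurable h) :
    Measurable (fun z => (⟨g z, h z⟩ : ℂ)) :=
  (Complex.equivRealProdCLM.symm.continuous.measurable).comp (hg.prodMk hh)

lemma continuous_mk {X : Type*} [TopologicalSpace X] {g h : X → ℝ} (hg : Continuous g)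
    (hh : Continuous h) : Continuous (fun z => (⟨g z, h z⟩ : ℂ)) :=
  (Complex.equivRealProdCLM.symm.continuous).comp (hg.prodMk hh)

/-- Post-composition of a frame with an isometry. -/
lemma IsFrame.comp {W : ℍ → ℂ} (hW : IsFrame W) {f : ℂ → ℂ} (hc : Continuous f)
    (hm : ∀ v w, mink (f v) (f w) = mink v w) (hs : Function.Surjective f)
    (hmap : Measure.map f nu = nu) : IsFrame (fun z => f (W z)) where
  dist_eq z w := by rw [hm, hW.dist_eq]
  surj := hs.comp hW.surj
  cont := hc.comp hW.cont
  meas := by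
    rw [← hmap, ← hW.meas, Measure.map_map hc.measurable hW.cont.measurable]; rfl

lemma mink_inj {v w : ℂ} (h : mink v w = 1) : v = w := by
  obtain ⟨W, hW, -⟩ := exists_frame UpperHalfPlane.I
  obtain ⟨z, rfl⟩ := hW.surj v
  obtain ⟨y, rfl⟩ := hW.surj w
  rw [← hW.dist_eq] at h
  by_contra hne
  exact (Real.one_lt_cosh.2 (dist_ne_zero.2 (fun e => hne (congrArg W e)))).ne' h

/-- General criterion for invariance of `nu`. -/
lemma nu_map_of_jac {f : ℂ → ℂ} (hfm : Measurable f) {f' : ℂ → ℂ →L[ℝ] ℂ}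
    (hf' : ∀ x, HasFDerivAt f (f' x) x) (hinj : Function.Injective f)
    (hsurj : Function.Surjective f)
    (hdet : ∀ x, |(f' x).det| * (1 / TT (f x)) = 1 / TT x) :
    Measure.map f nu = nu := by
  have := map_eq_of_jac MeasurableSet.univ hfm (fun x _ => hf' x) hinj.injOn
    (by rw [Set.image_univ, hsurj.range_eq]) (u := fun x => 1 / TT x) (v := fun x => 1 / TT x) (fun x _ => hdet x)
  rw [Measure.restrict_univ] at this
  exact this

lemma injective_of_mink {f : ℂ → ℂ} (hm : ∀ v w, mink (f v) (f w) = mink v w) :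
    Function.Injective f := by
  intro v w h
  apply mink_inj
  rw [← hm, h, mink_self]

/-- Boost along the real axis with rapidity parameters `c = cosh ρ`, `s = sinh ρ`. -/
def boost (c s : ℝ) (w : ℂ) : ℂ := ⟨w.re * c - TT w * s, w.im⟩

lemma abs_re_lt_TT (w : ℂ) : |w.re| < TT w := by
  refine abs_lt_of_sq_lt_sq ?_ (TT_pos w).le
  rw [TT_sq]; nlinarith [sq_nonneg w.im]

lemma boost_aux {c s : ℝ} (hc : 0 < c) (h : c ^ 2 = 1 + s ^ 2) (w : ℂ) :
    0 < TT w * c - w.re * s := by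
  have h1 := abs_re_lt_TT w
  have h2 : |s| < c := abs_lt_of_sq_lt_sq (by linarith) hc.le
  have h3 : w.re * s ≤ |w.re| * |s| := by rw [← abs_mul]; exact le_abs_self _
  nlinarith [abs_nonneg w.re, abs_nonneg s]

lemma TT_boost {c s : ℝ} (hc : 0 < c) (h : c ^ 2 = 1 + s ^ 2) (w : ℂ) :
    TT (boost c s w) = TT w * c - w.re * s := by
  refine TT_eq_of_sq (boost_aux hc h w).le ?_
  have := TT_sq w
  simp only [boost]
  nlinarith

lemma mink_boost {c s : ℝ} (hc : 0 < c) (h : c ^ 2 = 1 + s ^ 2) (v w : ℂ) :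
    mink (boost c s v) (boost c s w) = mink v w := by
  rw [mink, TT_boost hc h, TT_boost hc h, mink]
  simp only [boost]
  linear_combination (TT v * TT w - v.re * w.re) * h

lemma boost_surj {c s : ℝ} (hc : 0 < c) (h : c ^ 2 = 1 + s ^ 2) :
    Function.Surjective (boost c s) := by
  intro w
  have h' : c ^ 2 = 1 + (-s) ^ 2 := by rw [h]; ring
  refine ⟨boost c (-s) w, ?_⟩
  apply Complex.ext
  · show (boost c (-s) w).re * c - TT (boost c (-s) w) * s = w.re
    rw [TT_boost hc h']
    simp only [boost]
    linear_combination w.re * h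
  · rfl

@[fun_prop] lemma boost_cont (c s : ℝ) : Continuous (boost c s) := by
  unfold boost
  exact continuous_mk (by fun_prop) (by fun_prop)

lemma boost_map {c s : ℝ} (hc : 0 < c) (h : c ^ 2 = 1 + s ^ 2) :
    Measure.map (boost c s) nu = nu := by
  refine nu_map_of_jac (boost_cont c s).measurable
    (f' := fun w => linC (c - w.re / TT w * s) (- (w.im / TT w * s)) 0 1) ?_
    (injective_of_mink (mink_boost hc h)) (boost_surj hc h) ?_
  · intro w
    have h1 : HasFDerivAt (fun w : ℂ => w.re) Complex.reCLM w := Complex.reCLM.hasFDerivAt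
    have h2 : HasFDerivAt (fun w : ℂ => w.im) Complex.imCLM w := Complex.imCLM.hasFDerivAt
    refine hasFDerivAt_mk (g := fun w : ℂ => w.re * c - TT w * s) (h := fun w : ℂ => w.im) ?_ ?_
    · refine ((h1.mul_const c).sub ((TT_hasFDerivAt w).mul_const s)).congr_fderiv ?_
      ext
      simp; ring
    · refine h2.congr_fderiv ?_
      ext
      simp
  · intro w
    have h1 := boost_aux hc h w
    have h2 := TT_pos w
    rw [linC_det, TT_boost hc h]
    have : (c - w.re / TT w * s) * 1 - (- (w.im / TT w * s)) * 0 = (TT w * c - w.re * s) / TT w := by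
      field_simp; ring
    rw [this, abs_of_pos (by positivity)]
    field_simp

lemma IsFrame.boost {W : ℍ → ℂ} (hW : IsFrame W) {c s : ℝ} (hc : 0 < c) (h : c ^ 2 = 1 + s ^ 2) :
    IsFrame (fun z => boost c s (W z)) :=
  hW.comp (boost_cont c s) (mink_boost hc h) (boost_surj hc h) (boost_map hc h)

lemma TT_mul {e : ℂ} (he : ‖e‖ = 1) (w : ℂ) : TT (e * w) = TT w := by
  refine TT_eq_of_sq (TT_pos w).le ?_
  have h : e.re ^ 2 + e.im ^ 2 = 1 := by
    have := Complex.sq_norm e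
    rw [he, Complex.normSq_apply] at this; linarith
  rw [TT_sq]
  simp only [Complex.mul_re, Complex.mul_im]
  linear_combination (-(w.re ^ 2 + w.im ^ 2)) * h

lemma mink_rot {e : ℂ} (he : ‖e‖ = 1) (v w : ℂ) : mink (e * v) (e * w) = mink v w := by
  have h : e.re ^ 2 + e.im ^ 2 = 1 := by
    have := Complex.sq_norm e
    rw [he, Complex.normSq_apply] at this; linarith
  rw [mink, TT_mul he, TT_mul he, mink]
  simp only [Complex.mul_re, Complex.mul_im]
  linear_combination (-(v.re * w.re + v.im * w.im)) * h

lemma rot_surj {e : ℂ} (he : ‖e‖ = 1) : Function.Surjective (fun w => e * w) := by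
  have he0 : e ≠ 0 := by rintro rfl; simp at he
  exact fun w => ⟨e⁻¹ * w, by field_simp⟩

lemma rot_map {e : ℂ} (he : ‖e‖ = 1) : Measure.map (fun w => e * w) nu = nu := by
  refine nu_map_of_jac (by fun_prop)
    (f' := fun w => linC e.re (-e.im) e.im e.re) ?_
    (injective_of_mink (mink_rot he)) (rot_surj he) ?_
  · intro w
    have h1 : HasFDerivAt (fun w : ℂ => w.re) Complex.reCLM w := Complex.reCLM.hasFDerivAt
    have h2 : HasFDerivAt (fun w : ℂ => w.im) Complex.imCLM w := Complex.imCLM.hasFDerivAt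
    refine hasFDerivAt_mk (g := fun w : ℂ => e.re * w.re - e.im * w.im)
      (h := fun w : ℂ => e.re * w.im + e.im * w.re) ?_ ?_
    · refine ((h1.const_mul e.re).sub (h2.const_mul e.im)).congr_fderiv ?_
      ext
      simp; ring
    · refine ((h2.const_mul e.re).add (h1.const_mul e.im)).congr_fderiv ?_
      ext
      simp; ring
  · intro w
    have h : e.re ^ 2 + e.im ^ 2 = 1 := by
      have := Complex.sq_norm e
      rw [he, Complex.normSq_apply] at this; linarith
    rw [linC_det, TT_mul he]
    have : e.re * e.re - -e.im * e.im = 1 := by linarith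
    rw [this]; simp

lemma IsFrame.rot {W : ℍ → ℂ} (hW : IsFrame W) {e : ℂ} (he : ‖e‖ = 1) :
    IsFrame (fun z => e * W z) :=
  hW.comp (by fun_prop) (mink_rot he) (rot_surj he) (rot_map he)

/-- Fermi coordinates. -/
def fermi (a : ℂ) : ℂ := ⟨√(1 + a.im ^ 2) * Real.sinh a.re, a.im⟩

lemma TT_fermi (a : ℂ) : TT (fermi a) = √(1 + a.im ^ 2) * Real.cosh a.re := by
  have h := Real.cosh_pos a.re
  refine TT_eq_of_sq (by positivity) ?_
  have h1 : √(1 + a.im ^ 2) ^ 2 = 1 + a.im ^ 2 := Real.sq_sqrt (by positivity)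
  have h2 := Real.cosh_sq a.re
  simp only [fermi]
  rw [mul_pow, mul_pow, h1, h2]
  ring

lemma fermi_inj : Function.Injective fermi := by
  intro a b h
  have h2 : a.im = b.im := by simpa [fermi] using congrArg Complex.im h
  have h1 : √(1 + a.im ^ 2) * Real.sinh a.re = √(1 + b.im ^ 2) * Real.sinh b.re :=
    congrArg Complex.re h
  rw [h2] at h1
  have h3 : 0 < √(1 + b.im ^ 2) := Real.sqrt_pos.2 (by positivity)
  exact Complex.ext (Real.sinh_injective (mul_left_cancel₀ h3.ne' h1)) h2

lemma fermi_surj : Function.Surjective fermi := by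
  intro w
  have h3 : 0 < √(1 + w.im ^ 2) := Real.sqrt_pos.2 (by positivity)
  refine ⟨⟨Real.arsinh (w.re / √(1 + w.im ^ 2)), w.im⟩, ?_⟩
  apply Complex.ext
  · simp only [fermi, Real.sinh_arsinh]
    field_simp
  · rfl

@[fun_prop] lemma fermi_cont : Continuous fermi := by
  unfold fermi
  exact continuous_mk (by fun_prop) (by fun_prop)

lemma fermi_map : Measure.map fermi volume = nu := by
  have := map_eq_of_jac MeasurableSet.univ fermi_cont.measurable
    (f' := fun w => linC (√(1 + w.im ^ 2) * Real.cosh w.re)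
      (w.im / √(1 + w.im ^ 2) * Real.sinh w.re) 0 1) (u := fun _ => 1) (v := fun w => 1 / TT w) ?_
    fermi_inj.injOn (by rw [Set.image_univ, fermi_surj.range_eq]) ?_
  · simpa [nu, withDensity_one] using this
  · intro w _
    have h1 : HasFDerivAt (fun w : ℂ => w.re) Complex.reCLM w := Complex.reCLM.hasFDerivAt
    have h2 : HasFDerivAt (fun w : ℂ => w.im) Complex.imCLM w := Complex.imCLM.hasFDerivAt
    refine hasFDerivAt_mk (g := fun w : ℂ => √(1 + w.im ^ 2) * Real.sinh w.re)
      (h := fun w : ℂ => w.im) ?_ ?_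
    · refine ((((hasFDerivAt_const (1:ℝ) w).add (h2.pow 2)).sqrt
        (by simp only [Pi.add_apply]; positivity)).mul h1.sinh).congr_fderiv ?_
      ext
      simp
      field_simp
    · refine h2.congr_fderiv ?_
      ext
      simp
  · intro w _
    have h3 : 0 < √(1 + w.im ^ 2) := Real.sqrt_pos.2 (by positivity)
    have h := Real.cosh_pos w.re
    rw [linC_det, TT_fermi, mul_one, mul_zero, sub_zero, abs_of_pos (by positivity)]
    field_simp

end

noncomputable section

/-- Inverse Fermi coordinates. -/
def fermiInv (w : ℂ) : ℝ × ℝ := (Real.arsinh (w.re / √(1 + w.im ^ 2)), w.im)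

lemma fermiInv_cont : Continuous fermiInv := by
  unfold fermiInv
  refine Continuous.prodMk ?_ (by fun_prop)
  refine Real.continuous_arsinh.comp (Continuous.div (by fun_prop) (by fun_prop) fun w => ?_)
  exact (Real.sqrt_pos.2 (by positivity)).ne'

lemma fermiInv_fermi (a : ℂ) : fermiInv (fermi a) = (a.re, a.im) := by
  have h3 : 0 < √(1 + a.im ^ 2) := Real.sqrt_pos.2 (by positivity)
  simp only [fermiInv, fermi]
  rw [mul_div_cancel_left₀ _ h3.ne', Real.arsinh_sinh]

lemma fermiInv_spec (w : ℂ) :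
    w.re = √(1 + w.im ^ 2) * Real.sinh (fermiInv w).1 ∧
    TT w = √(1 + w.im ^ 2) * Real.cosh (fermiInv w).1 := by
  obtain ⟨a, rfl⟩ := fermi_surj w
  rw [fermiInv_fermi, TT_fermi]
  exact ⟨rfl, rfl⟩

lemma fermiInv_map : Measure.map fermiInv nu = volume := by
  rw [← fermi_map, Measure.map_map fermiInv_cont.measurable fermi_cont.measurable]
  have : fermiInv ∘ fermi = Complex.measurableEquivRealProd := by
    funext a
    exact fermiInv_fermi a
  rw [this]
  exact Complex.volume_preserving_equiv_real_prod.map_eq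

lemma IsFrame.fermi_map {W : ℍ → ℂ} (hW : IsFrame W) :
    Measure.map (fun z => fermiInv (W z)) hypAreaMeasure = volume := by
  rw [← fermiInv_map, ← hW.meas, Measure.map_map fermiInv_cont.measurable hW.cont.measurable]
  rfl

lemma IsFrame.fermi_apply {W : ℍ → ℂ} (hW : IsFrame W) {S : Set (ℝ × ℝ)} (hS : MeasurableSet S) :
    hypAreaMeasure {z | fermiInv (W z) ∈ S} = volume S := by
  rw [← hW.fermi_map]
  exact (Measure.map_apply (fermiInv_cont.comp hW.cont).measurable hS).symm

lemma IsFrame.nu_apply {W : ℍ → ℂ} (hW : IsFrame W) {S : Set ℂ} (hS : MeasurableSet S) :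
    hypAreaMeasure {z | W z ∈ S} = nu S := by
  rw [← hW.meas, Measure.map_apply hW.cont.measurable hS]
  rfl

/-- Area of a rectangle in Fermi coordinates. -/
lemma IsFrame.rect_area {W : ℍ → ℂ} (hW : IsFrame W) (a0 a1 s : ℝ) :
    hypAreaMeasure {z | (fermiInv (W z)).1 ∈ Set.Ioo a0 a1 ∧ (fermiInv (W z)).2 ∈ Set.Ioo (-s) 0} =
      ENNReal.ofReal (a1 - a0) * ENNReal.ofReal s := by
  have := hW.fermi_apply (S := Set.Ioo a0 a1 ×ˢ Set.Ioo (-s) 0)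
    (measurableSet_Ioo.prod measurableSet_Ioo)
  simp only [Set.mem_prod] at this
  rw [this, Measure.volume_eq_prod, Measure.prod_prod, Real.volume_Ioo, Real.volume_Ioo]
  simp

/-- Distance to a point on the axis in Fermi coordinates. -/
lemma IsFrame.cosh_axis {W : ℍ → ℂ} (hW : IsFrame W) {z x : ℍ} (hx : (W x).im = 0) :
    Real.cosh (dist z x) = √(1 + (W z).im ^ 2) *
      Real.cosh ((fermiInv (W z)).1 - (fermiInv (W x)).1) := by
  rw [hW.dist_eq, mink]
  obtain ⟨h1, h2⟩ := fermiInv_spec (W z)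
  obtain ⟨h3, h4⟩ := fermiInv_spec (W x)
  rw [h1, h2, h3, h4, hx, Real.cosh_sub]
  simp
  ring

lemma arcosh_exists {x : ℝ} (hx : 1 ≤ x) : Real.cosh (Real.arsinh √(x ^ 2 - 1)) = x := by
  rw [Real.cosh_arsinh, Real.sq_sqrt (by nlinarith)]
  rw [show 1 + (x ^ 2 - 1) = x ^ 2 by ring, Real.sqrt_sq (by linarith)]

/-- The neighbourhood lemma: the area of the `t`-neighbourhood of a segment minus the `t`-ball
about its starting point is at most `2 ℓ sinh t`. -/
lemma IsFrame.nbhd_area {W : ℍ → ℂ} (hW : IsFrame W) {p : ℍ} {a0 a1 t : ℝ} (h01 : a0 ≤ a1)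
    (ht : 0 ≤ t) (hp : (W p).im = 0) (hp' : (fermiInv (W p)).1 = a0) (s : Set ℍ)
    (hs : ∀ x ∈ s, (W x).im = 0 ∧ (fermiInv (W x)).1 ∈ Set.Icc a0 a1) :
    hypAreaMeasure {c | (∃ x ∈ s, dist c x ≤ t) ∧ ¬ dist c p ≤ t} ≤
      ENNReal.ofReal (2 * (a1 - a0) * Real.sinh t) := by
  set τ : ℝ → ℝ := fun b => Real.arsinh √((Real.cosh t / √(1 + b ^ 2)) ^ 2 - 1) with hτ
  have hτm : Measurable τ := by
    have : Measurable Real.arsinh := Real.continuous_arsinh.measurable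
    fun_prop
  set S : Set (ℝ × ℝ) := {q | -Real.sinh t ≤ q.2 ∧ q.2 ≤ Real.sinh t ∧ a0 + τ q.2 ≤ q.1 ∧ q.1 ≤ a1 + τ q.2} with hSdef
  have hS : MeasurableSet S := by
    simp only [hSdef, Set.ofPred_and]
    exact (measurableSet_le (by fun_prop) (by fun_prop)).inter
      ((measurableSet_le (by fun_prop) (by fun_prop)).inter
      ((measurableSet_le (by fun_prop) (by fun_prop)).inter
      (measurableSet_le (by fun_prop) (by fun_prop))))
  have hsub : {c | (∃ x ∈ s, dist c x ≤ t) ∧ ¬ dist c p ≤ t} ⊆ {z | fermiInv (W z) ∈ S} := by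
    rintro c ⟨⟨x, hxs, hx⟩, hcp⟩
    obtain ⟨hx1, hx2, hx3⟩ := hs x hxs
    have e1 := hW.cosh_axis (z := c) hx1
    have e2 := hW.cosh_axis (z := c) hp
    have l1 : Real.cosh (dist c x) ≤ Real.cosh t := by
      rw [Real.cosh_le_cosh, abs_of_nonneg dist_nonneg, abs_of_nonneg ht]; exact hx
    have l2 : Real.cosh t < Real.cosh (dist c p) := by
      rw [Real.cosh_lt_cosh, abs_of_nonneg dist_nonneg, abs_of_nonneg ht]; exact not_le.1 hcp
    set b := (W c).im with hb
    have hbb : (fermiInv (W c)).2 = b := rfl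
    set α := (fermiInv (W c)).1
    set u := (fermiInv (W x)).1
    have hq : 0 < √(1 + b ^ 2) := Real.sqrt_pos.2 (by positivity)
    have hqs : √(1 + b ^ 2) ^ 2 = 1 + b ^ 2 := Real.sq_sqrt (by positivity)
    have hqt : √(1 + b ^ 2) ≤ Real.cosh t := by
      have := Real.one_le_cosh (α - u)
      nlinarith
    have hτc : Real.cosh (τ b) = Real.cosh t / √(1 + b ^ 2) :=
      arcosh_exists (by rw [le_div_iff₀ hq]; linarith)
    have hτ0 : 0 ≤ τ b := Real.arsinh_nonneg_iff.2 (Real.sqrt_nonneg _)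
    have k1 : |α - u| ≤ τ b := by
      rw [← abs_of_nonneg hτ0, ← Real.cosh_le_cosh, hτc, le_div_iff₀ hq]; linarith
    have k2 : τ b < |α - a0| := by
      rw [← abs_of_nonneg hτ0, ← Real.cosh_lt_cosh, hτc, div_lt_iff₀ hq, ← hp']; linarith
    have k3 : b ^ 2 ≤ Real.sinh t ^ 2 := by
      have := Real.cosh_sq t
      nlinarith [Real.cosh_pos t]
    have k4 := abs_le_of_sq_le_sq' k3 (Real.sinh_nonneg_iff.2 ht)
    rw [abs_le] at k1
    refine ⟨k4.1, k4.2, ?_, ?_⟩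
    · show a0 + τ b ≤ α
      rcases lt_abs.1 k2 with h | h
      · linarith
      · linarith
    · show α ≤ a1 + τ b
      linarith
  refine (measure_mono hsub).trans ?_
  rw [hW.fermi_apply hS, Measure.volume_eq_prod, Measure.prod_apply_symm hS]
  have : ∀ b : ℝ, volume ((fun x => (x, b)) ⁻¹' S) ≤
      (Set.Icc (-Real.sinh t) (Real.sinh t)).indicator (fun _ => ENNReal.ofReal (a1 - a0)) b := by
    intro b
    by_cases hb : b ∈ Set.Icc (-Real.sinh t) (Real.sinh t)
    · rw [Set.indicator_of_mem hb]
      refine (measure_mono (t := Set.Icc (a0 + τ b) (a1 + τ b)) ?_).trans ?_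
      · rintro x ⟨-, -, h1, h2⟩
        exact ⟨h1, h2⟩
      · rw [Real.volume_Icc]; apply le_of_eq; congr 1; ring
    · rw [Set.indicator_of_notMem hb]
      refine (measure_mono (t := ∅) ?_).trans (by simp)
      rintro x ⟨h1, h2, -, -⟩
      exact hb ⟨h1, h2⟩
  refine (lintegral_mono this).trans ?_
  rw [lintegral_indicator measurableSet_Icc, setLIntegral_const, Real.volume_Icc,
    ← ENNReal.ofReal_mul (by linarith)]
  apply le_of_eq; congr 1; ring

/-- Crude bound for the area of a ball. -/
lemma ball_area_le (c : ℍ) {t : ℝ} (ht : 0 ≤ t) :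
    hypAreaMeasure (closedBall c t) ≤ ENNReal.ofReal (2 * t) * ENNReal.ofReal (2 * Real.sinh t) := by
  obtain ⟨W, hW, hc⟩ := exists_frame c
  have hsub : closedBall c t ⊆ {z | fermiInv (W z) ∈ Set.Icc (-t) t ×ˢ Set.Icc (-Real.sinh t) (Real.sinh t)} := by
    intro z hz
    have e := hW.cosh_axis (z := z) (x := c) (by rw [hc]; rfl)
    have l1 : Real.cosh (dist z c) ≤ Real.cosh t := by
      rw [Real.cosh_le_cosh, abs_of_nonneg dist_nonneg, abs_of_nonneg ht]; exact hz
    have e0 : (fermiInv (W c)).1 = 0 := by rw [hc]; simp [fermiInv]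
    rw [e0, sub_zero] at e
    have hq : 1 ≤ √(1 + (W z).im ^ 2) := Real.one_le_sqrt.2 (by nlinarith [sq_nonneg (W z).im])
    have hqs : √(1 + (W z).im ^ 2) ^ 2 = 1 + (W z).im ^ 2 := Real.sq_sqrt (by positivity)
    have hco := Real.one_le_cosh (fermiInv (W z)).1
    constructor
    · have : |(fermiInv (W z)).1| ≤ |t| := by
        rw [← Real.cosh_le_cosh]; nlinarith
      rw [abs_of_nonneg ht] at this
      exact abs_le.1 this
    · have h1 : √(1 + (W z).im ^ 2) ≤ Real.cosh t := by nlinarith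
      have k3 : (W z).im ^ 2 ≤ Real.sinh t ^ 2 := by
        have := Real.cosh_sq t
        nlinarith [Real.cosh_pos t]
      exact abs_le_of_sq_le_sq' k3 (Real.sinh_nonneg_iff.2 ht)
  refine (measure_mono hsub).trans ?_
  rw [hW.fermi_apply (measurableSet_Icc.prod measurableSet_Icc), Measure.volume_eq_prod,
    Measure.prod_prod, Real.volume_Icc, Real.volume_Icc]
  apply le_of_eq; congr 2 <;> ring

lemma polar_inner {ρ : ℝ} (hρ : 0 ≤ ρ) :
    ∫⁻ r in Set.Ioc 0 ρ, ENNReal.ofReal (r * (1 / √(1 + r ^ 2))) = ENNReal.ofReal (√(1 + ρ ^ 2) - 1) := by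
  have hpos : ∀ r : ℝ, 0 < √(1 + r ^ 2) := fun r => Real.sqrt_pos.2 (by positivity)
  have hcont : Continuous (fun r : ℝ => r * (1 / √(1 + r ^ 2))) :=
    continuous_id.mul (Continuous.div continuous_const (by fun_prop) fun r => (hpos r).ne')
  have hI : IntervalIntegrable (fun r : ℝ => r * (1 / √(1 + r ^ 2))) volume 0 ρ :=
    hcont.intervalIntegrable _ _
  have h1 := intervalIntegral.integral_eq_sub_of_hasDerivAt (f := fun r : ℝ => √(1 + r ^ 2))
    (f' := fun r : ℝ => r * (1 / √(1 + r ^ 2))) (a := 0) (b := ρ) (fun x _ => by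
      have := (((hasDerivAt_id x).pow 2).const_add 1).sqrt (by simp only [Pi.pow_apply, id]; positivity)
      refine this.congr_deriv ?_
      simp
      have := hpos x
      field_simp) hI
  rw [intervalIntegral.integral_of_le hρ] at h1
  rw [← ofReal_integral_eq_lintegral_ofReal, h1]
  · simp
  · exact (intervalIntegrable_iff_integrableOn_Ioc_of_le hρ).1 hI
  · filter_upwards [ae_restrict_mem measurableSet_Ioc] with r hr
    have := hpos r
    have := hr.1
    show 0 ≤ r * (1 / √(1 + r ^ 2))
    positivity

lemma nu_polar {S : Set ℂ} (hS : MeasurableSet S) :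
    nu S = ∫⁻ φ in Set.Ioo (-π) π, ∫⁻ r in Set.Ioi (0:ℝ),
      {r : ℝ | Complex.polarCoord.symm (r, φ) ∈ S}.indicator
        (fun r => ENNReal.ofReal (r * (1 / √(1 + r ^ 2)))) r := by
  have hTT : ∀ p : ℝ × ℝ, TT (Complex.polarCoord.symm p) = √(1 + p.1 ^ 2) := by
    intro p
    rw [TT]
    congr 1
    rw [Complex.polarCoord_symm_apply]
    simp only [Complex.mul_re, Complex.mul_im, Complex.add_re, Complex.add_im, Complex.ofReal_re,
      Complex.ofReal_im, Complex.I_re, Complex.I_im]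
    nlinarith [Real.sin_sq_add_cos_sq p.2]
  have hmeas : Measurable (fun p : ℝ × ℝ => Complex.polarCoord.symm p) := by
    have : (fun p : ℝ × ℝ => Complex.polarCoord.symm p) =
        fun p : ℝ × ℝ => (p.1 : ℂ) * (Real.cos p.2 + Real.sin p.2 * Complex.I) := by
      funext p; rw [Complex.polarCoord_symm_apply]
    rw [this]
    exact Continuous.measurable (by fun_prop)
  rw [nu, withDensity_apply _ hS, ← lintegral_indicator hS, ← Complex.lintegral_comp_polarCoord_symm]
  have htgt : polarCoord.target = Set.Ioi (0:ℝ) ×ˢ Set.Ioo (-π) π := rfl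
  have hm2 : Measurable (fun p : ℝ × ℝ => ENNReal.ofReal p.1 •
      S.indicator (fun x => ENNReal.ofReal (1 / TT x)) (Complex.polarCoord.symm p)) := by
    refine (ENNReal.measurable_ofReal.comp measurable_fst).mul ?_
    refine Measurable.comp (Measurable.indicator ?_ hS) hmeas
    exact ENNReal.measurable_ofReal.comp (measurable_const.div TT_meas)
  rw [htgt, Measure.volume_eq_prod, ← Measure.prod_restrict, lintegral_prod_symm _ hm2.aemeasurable]
  refine lintegral_congr fun φ => setLIntegral_congr_fun measurableSet_Ioi fun r hr => ?_
  simp only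
  by_cases h : Complex.polarCoord.symm (r, φ) ∈ S
  · rw [Set.indicator_of_mem h, Set.indicator_of_mem (by exact h), hTT, smul_eq_mul,
      ← ENNReal.ofReal_mul (le_of_lt hr)]
  · rw [Set.indicator_of_notMem h, Set.indicator_of_notMem (by exact h), smul_zero]


lemma polar_arg {r φ : ℝ} (hr : 0 < r) (hφ : φ ∈ Set.Ioo (-π) π) :
    Complex.arg (Complex.polarCoord.symm (r, φ)) = φ := by
  rw [Complex.polarCoord_symm_apply]
  have := Complex.arg_mul_cos_add_sin_mul_I hr ⟨hφ.1, hφ.2.le⟩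
  simpa using this

lemma polar_norm {r φ : ℝ} (hr : 0 < r) : ‖Complex.polarCoord.symm (r, φ)‖ = r := by
  rw [Complex.norm_polarCoord_symm]
  exact abs_of_pos hr

/-- Area of a sector (lower bound). -/
lemma IsFrame.sector_area {W : ℍ → ℂ} (hW : IsFrame W) {χ1 χ2 t : ℝ} (ht : 0 ≤ t)
    (h1 : -π ≤ χ1) (h2 : χ2 ≤ π) :
    ENNReal.ofReal ((χ2 - χ1) * (Real.cosh t - 1)) ≤
    hypAreaMeasure {z | 0 < ‖W z‖ ∧ ‖W z‖ ≤ Real.sinh t ∧ Complex.arg (W z) ∈ Set.Ioo χ1 χ2} := by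
  have hS : MeasurableSet {w : ℂ | 0 < ‖w‖ ∧ ‖w‖ ≤ Real.sinh t ∧ Complex.arg w ∈ Set.Ioo χ1 χ2} := by
    simp only [Set.ofPred_and]
    exact (measurableSet_lt (by fun_prop) (by fun_prop)).inter
      ((measurableSet_le (by fun_prop) (by fun_prop)).inter
      (Complex.measurable_arg measurableSet_Ioo))
  have h0 := hW.nu_apply hS
  simp only [Set.mem_ofPred_eq] at h0
  rw [h0, nu_polar hS]
  have hsub : Set.Ioo χ1 χ2 ⊆ Set.Ioo (-π) π := Set.Ioo_subset_Ioo h1 h2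
  refine le_trans ?_ (lintegral_mono_set hsub)
  have : ∀ φ ∈ Set.Ioo χ1 χ2, ENNReal.ofReal (Real.cosh t - 1) ≤ ∫⁻ r in Set.Ioi (0:ℝ),
      {r : ℝ | Complex.polarCoord.symm (r, φ) ∈
        {w : ℂ | 0 < ‖w‖ ∧ ‖w‖ ≤ Real.sinh t ∧ Complex.arg w ∈ Set.Ioo χ1 χ2}}.indicator
        (fun r => ENNReal.ofReal (r * (1 / √(1 + r ^ 2)))) r := by
    intro φ hφ
    have hi := polar_inner (Real.sinh_nonneg_iff.2 ht)
    have hc : √(1 + Real.sinh t ^ 2) = Real.cosh t := by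
      rw [add_comm, ← Real.cosh_sq, Real.sqrt_sq (Real.cosh_pos t).le]
    rw [hc] at hi
    rw [← hi]
    have hss : Set.Ioc 0 (Real.sinh t) ⊆ Set.Ioi (0:ℝ) := fun r hr => hr.1
    refine le_trans ?_ (lintegral_mono_set hss)
    refine setLIntegral_mono' measurableSet_Ioc fun r hr => ?_
    rw [Set.indicator_of_mem]
    show _ ∧ _ ∧ _
    rw [polar_norm hr.1, polar_arg hr.1 (hsub hφ)]
    exact ⟨hr.1, hr.2, hφ⟩
  refine le_trans ?_ (setLIntegral_mono' measurableSet_Ioo this)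
  rw [setLIntegral_const, Real.volume_Ioo, ← ENNReal.ofReal_mul (by linarith [Real.one_le_cosh t])]
  rw [mul_comm]

lemma cos_mem_of_mem {φ1 φ2 φ m : ℝ} (h1 : -(π / 2) < φ1) (h2 : φ2 < π / 2) (hφ : φ ∈ Set.Icc φ1 φ2)
    (hc1 : 1 < m * Real.cos φ1) (hc2 : 1 < m * Real.cos φ2) (hm : 0 < m) : 1 < m * Real.cos φ := by
  rcases le_total 0 φ with h | h
  · have := Real.cos_le_cos_of_nonneg_of_le_pi h (by linarith [Real.pi_pos]) hφ.2
    nlinarith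
  · have := Real.cos_le_cos_of_nonneg_of_le_pi (x := -φ) (y := -φ1) (by linarith)
      (by linarith [Real.pi_pos]) (by linarith [hφ.1])
    rw [Real.cos_neg, Real.cos_neg] at this
    nlinarith

/-- Area of a triangle with a vertex at the origin (upper bound). -/
lemma IsFrame.wedge_area {W : ℍ → ℂ} (hW : IsFrame W) {φ1 φ2 m : ℝ} (hm : 1 < m)
    (h1 : -(π / 2) < φ1) (h12 : φ1 ≤ φ2) (h2 : φ2 < π / 2)
    (hc1 : 1 < m * Real.cos φ1) (hc2 : 1 < m * Real.cos φ2) :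
    0 ≤ (Real.arcsin (m * Real.sin φ2 / √(m ^ 2 - 1)) -
        Real.arcsin (m * Real.sin φ1 / √(m ^ 2 - 1)) - (φ2 - φ1)) ∧
    hypAreaMeasure {z | m * (W z).re ≤ TT (W z) ∧ Complex.arg (W z) ∈ Set.Icc φ1 φ2} ≤
      ENNReal.ofReal (Real.arcsin (m * Real.sin φ2 / √(m ^ 2 - 1)) -
        Real.arcsin (m * Real.sin φ1 / √(m ^ 2 - 1)) - (φ2 - φ1)) := by
  have hS : MeasurableSet {w : ℂ | m * w.re ≤ TT w ∧ Complex.arg w ∈ Set.Icc φ1 φ2} := by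
    simp only [Set.ofPred_and]
    exact (measurableSet_le (by fun_prop) (by fun_prop)).inter
      (Complex.measurable_arg measurableSet_Icc)
  have h0 := hW.nu_apply hS
  simp only [Set.mem_ofPred_eq] at h0
  rw [h0, nu_polar hS]
  have hm1 : 0 < m ^ 2 - 1 := by nlinarith
  have hsq1 : √(m ^ 2 - 1) ^ 2 = m ^ 2 - 1 := Real.sq_sqrt hm1.le
  have hsq1p : 0 < √(m ^ 2 - 1) := Real.sqrt_pos.2 hm1
  have hD : ∀ φ ∈ Set.Icc φ1 φ2, 0 < m ^ 2 * Real.cos φ ^ 2 - 1 := by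
    intro φ hφ
    have := cos_mem_of_mem h1 h2 hφ hc1 hc2 (by linarith)
    nlinarith
  set c : ℝ → ℝ := fun φ => m * Real.cos φ / √(m ^ 2 * Real.cos φ ^ 2 - 1) - 1 with hcdef
  have hbound : ∀ φ ∈ Set.Ioo (-π) π, ∫⁻ r in Set.Ioi (0:ℝ),
      {r : ℝ | Complex.polarCoord.symm (r, φ) ∈
        {w : ℂ | m * w.re ≤ TT w ∧ Complex.arg w ∈ Set.Icc φ1 φ2}}.indicator
        (fun r => ENNReal.ofReal (r * (1 / √(1 + r ^ 2)))) r ≤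
      (Set.Icc φ1 φ2).indicator (fun φ => ENNReal.ofReal (c φ)) φ := by
    intro φ hφ
    by_cases hφ' : φ ∈ Set.Icc φ1 φ2
    · rw [Set.indicator_of_mem hφ']
      have hd := hD φ hφ'
      have hdp : 0 < √(m ^ 2 * Real.cos φ ^ 2 - 1) := Real.sqrt_pos.2 hd
      have hds : √(m ^ 2 * Real.cos φ ^ 2 - 1) ^ 2 = m ^ 2 * Real.cos φ ^ 2 - 1 := Real.sq_sqrt hd.le
      have hcos := cos_mem_of_mem h1 h2 hφ' hc1 hc2 (by linarith)
      have hi := polar_inner (ρ := 1 / √(m ^ 2 * Real.cos φ ^ 2 - 1)) (by positivity)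
      have e : √(1 + (1 / √(m ^ 2 * Real.cos φ ^ 2 - 1)) ^ 2) =
          m * Real.cos φ / √(m ^ 2 * Real.cos φ ^ 2 - 1) := by
        rw [Real.sqrt_eq_iff_mul_self_eq (by positivity) (by positivity)]
        field_simp
        rw [hds]
        ring
      rw [e] at hi
      rw [hcdef]
      simp only
      rw [← hi, ← lintegral_indicator measurableSet_Ioi, ← lintegral_indicator measurableSet_Ioc]
      refine lintegral_mono fun r => ?_
      by_cases hr : r ∈ Set.Ioi (0:ℝ)
      · rw [Set.indicator_of_mem hr]
        by_cases hr' : r ∈ {r : ℝ | Complex.polarCoord.symm (r, φ) ∈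
            {w : ℂ | m * w.re ≤ TT w ∧ Complex.arg w ∈ Set.Icc φ1 φ2}}
        · rw [Set.indicator_of_mem hr', Set.indicator_of_mem]
          have hr0 : 0 < r := hr
          have hr1 := hr'.1
          have hs := TT_sq (Complex.polarCoord.symm (r, φ))
          have hp := TT_pos (Complex.polarCoord.symm (r, φ))
          rw [Complex.polarCoord_symm_apply] at hr1 hs hp
          simp only [Complex.mul_re, Complex.mul_im, Complex.add_re, Complex.add_im, Complex.ofReal_re,
            Complex.ofReal_im, Complex.I_re, Complex.I_im] at hr1 hs hp
          refine ⟨hr0, ?_⟩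
          rw [le_div_iff₀ hdp]
          refine abs_le_of_sq_le_sq' ?_ zero_le_one |>.2
          rw [mul_pow, hds]
          have h3 : (m * (r * Real.cos φ)) ^ 2 ≤ 1 + r ^ 2 := by
            have h4 : (0:ℝ) ≤ m * (r * Real.cos φ) := by nlinarith
            nlinarith [Real.sin_sq_add_cos_sq φ]
          nlinarith
        · rw [Set.indicator_of_notMem hr']; exact zero_le
      · rw [Set.indicator_of_notMem hr]; exact zero_le
    · rw [Set.indicator_of_notMem hφ']
      refine (setLIntegral_mono' (g := fun _ => 0) measurableSet_Ioi fun r hr => ?_).trans (by simp)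
      rw [Set.indicator_of_notMem]
      rintro ⟨-, h⟩
      rw [polar_arg hr hφ] at h
      exact hφ' h
  have hcc : ContinuousOn c (Set.Icc φ1 φ2) := by
    refine ContinuousOn.sub (ContinuousOn.div (by fun_prop) (by fun_prop) ?_) continuousOn_const
    intro φ hφ
    exact (Real.sqrt_pos.2 (hD φ hφ)).ne'
  have hI : IntervalIntegrable c volume φ1 φ2 := by
    apply ContinuousOn.intervalIntegrable
    rwa [Set.uIcc_of_le h12]
  have hF := intervalIntegral.integral_eq_sub_of_hasDerivAt
    (f := fun φ => Real.arcsin (m * Real.sin φ / √(m ^ 2 - 1)) - φ) (f' := c) (a := φ1) (b := φ2)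
    (fun φ hφ => by
      rw [Set.uIcc_of_le h12] at hφ
      have hd := hD φ hφ
      have hdp : 0 < √(m ^ 2 * Real.cos φ ^ 2 - 1) := Real.sqrt_pos.2 hd
      have hx : 1 - (m * Real.sin φ / √(m ^ 2 - 1)) ^ 2 =
          (m ^ 2 * Real.cos φ ^ 2 - 1) / (m ^ 2 - 1) := by
        rw [div_pow, hsq1, mul_pow, Real.sin_sq]
        field_simp
        ring
      have hx' : 0 < 1 - (m * Real.sin φ / √(m ^ 2 - 1)) ^ 2 := by rw [hx]; positivity
      have hxm : m * Real.sin φ / √(m ^ 2 - 1) ≠ -1 := by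
        intro h; rw [h] at hx'; norm_num at hx'
      have hxp : m * Real.sin φ / √(m ^ 2 - 1) ≠ 1 := by
        intro h; rw [h] at hx'; norm_num at hx'
      have hd1 := (Real.hasDerivAt_arcsin hxm hxp).comp φ
        (((Real.hasDerivAt_sin φ).const_mul m).div_const (√(m ^ 2 - 1)))
      refine (hd1.sub (hasDerivAt_id φ)).congr_deriv ?_
      rw [hx, Real.sqrt_div hd.le, hcdef]
      simp only
      field_simp) hI
  rw [intervalIntegral.integral_of_le h12] at hF
  have hc0 : ∀ φ ∈ Set.Icc φ1 φ2, 0 ≤ c φ := by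
    intro φ hφ
    have hd := hD φ hφ
    have hdp : 0 < √(m ^ 2 * Real.cos φ ^ 2 - 1) := Real.sqrt_pos.2 hd
    have hcos := cos_mem_of_mem h1 h2 hφ hc1 hc2 (by linarith)
    show 0 ≤ m * Real.cos φ / √(m ^ 2 * Real.cos φ ^ 2 - 1) - 1
    rw [sub_nonneg, le_div_iff₀ hdp, one_mul]
    rw [Real.sqrt_le_left (by linarith)]
    nlinarith
  refine ⟨?_, ?_⟩
  · have := setIntegral_nonneg (μ := volume) (measurableSet_Ioc (a := φ1) (b := φ2))
      (fun φ hφ => hc0 φ ⟨hφ.1.le, hφ.2⟩)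
    rw [hF] at this
    linarith
  refine (setLIntegral_mono' measurableSet_Ioo hbound).trans ?_
  refine (setLIntegral_le_lintegral _ _).trans ?_
  rw [lintegral_indicator measurableSet_Icc]
  have e1 : ∫⁻ φ in Set.Icc φ1 φ2, ENNReal.ofReal (c φ) = ∫⁻ φ in Set.Ioc φ1 φ2, ENNReal.ofReal (c φ) :=
    setLIntegral_congr Ioc_ae_eq_Icc.symm
  rw [e1, ← ofReal_integral_eq_lintegral_ofReal, hF]
  · apply le_of_eq; congr 1; ring
  · exact (intervalIntegrable_iff_integrableOn_Ioc_of_le h12).1 hI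
  · filter_upwards [ae_restrict_mem measurableSet_Ioc] with r hr
    exact hc0 r ⟨hr.1.le, hr.2⟩

end

noncomputable section

/-- Coordinates adapted to the geodesic `Re (g w) = TT w`. -/
def sideMap (g w : ℂ) : ℂ := ⟨(g * w).im / ‖g‖, (TT w - (g * w).re) / √(‖g‖ ^ 2 - 1)⟩

lemma sideMap_eq {g : ℂ} (hg : 1 < ‖g‖) (w : ℂ) :
    sideMap g w = (-Complex.I) * boost (‖g‖ / √(‖g‖ ^ 2 - 1)) (1 / √(‖g‖ ^ 2 - 1))
      ((g / ‖g‖) * w) := by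
  have hm : 0 < ‖g‖ := by linarith
  have he : ‖g / (‖g‖ : ℂ)‖ = 1 := by
    rw [norm_div, Complex.norm_real, norm_norm, div_self hm.ne']
  have hd : 0 < √(‖g‖ ^ 2 - 1) := Real.sqrt_pos.2 (by nlinarith)
  have e : (g / (‖g‖ : ℂ)) * w = ((1 / ‖g‖ : ℝ) : ℂ) * (g * w) := by
    push_cast; ring
  have hre : ((g / (‖g‖ : ℂ)) * w).re = (g * w).re / ‖g‖ := by
    rw [e, Complex.re_ofReal_mul]; ring
  have him : ((g / (‖g‖ : ℂ)) * w).im = (g * w).im / ‖g‖ := by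
    rw [e, Complex.im_ofReal_mul]; ring
  apply Complex.ext
  · simp only [sideMap, boost, TT_mul he, hre, him]
    simp
  · simp only [sideMap, boost, TT_mul he, hre, him]
    simp
    field_simp

lemma side_cs {g : ℂ} (hg : 1 < ‖g‖) :
    (‖g‖ / √(‖g‖ ^ 2 - 1)) ^ 2 = 1 + (1 / √(‖g‖ ^ 2 - 1)) ^ 2 := by
  have h1 : 0 < ‖g‖ ^ 2 - 1 := by nlinarith
  rw [div_pow, div_pow, Real.sq_sqrt h1.le]
  field_simp
  ring

lemma IsFrame.side {W : ℍ → ℂ} (hW : IsFrame W) {g : ℂ} (hg : 1 < ‖g‖) :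
    IsFrame (fun z => sideMap g (W z)) := by
  have hm : 0 < ‖g‖ := by linarith
  have hd : 0 < √(‖g‖ ^ 2 - 1) := Real.sqrt_pos.2 (by nlinarith)
  have he : ‖g / (‖g‖ : ℂ)‖ = 1 := by
    rw [norm_div, Complex.norm_real, norm_norm, div_self hm.ne']
  simp only [sideMap_eq hg]
  exact ((hW.rot he).boost (by positivity) (side_cs hg)).rot (by simp)

lemma TT_side {g : ℂ} (hg : 1 < ‖g‖) (w : ℂ) :
    TT (sideMap g w) = (‖g‖ ^ 2 * TT w - (g * w).re) / (‖g‖ * √(‖g‖ ^ 2 - 1)) := by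
  have hm : 0 < ‖g‖ := by linarith
  have hd : 0 < √(‖g‖ ^ 2 - 1) := Real.sqrt_pos.2 (by nlinarith)
  have he : ‖g / (‖g‖ : ℂ)‖ = 1 := by
    rw [norm_div, Complex.norm_real, norm_norm, div_self hm.ne']
  have e : (g / (‖g‖ : ℂ)) * w = ((1 / ‖g‖ : ℝ) : ℂ) * (g * w) := by
    push_cast; ring
  have hre : ((g / (‖g‖ : ℂ)) * w).re = (g * w).re / ‖g‖ := by
    rw [e, Complex.re_ofReal_mul]; ring
  rw [sideMap_eq hg, TT_mul (by simp), TT_boost (by positivity) (side_cs hg), TT_mul he, hre]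
  field_simp

/-- Data of a convex geodesic polygon containing the origin of the frame `W`;
`u j` is the reciprocal of the Klein radius of the `j`-th vertex. -/
structure GPoly where
  W : ℍ → ℂ
  hW : IsFrame W
  N : ℕ
  hN : 3 ≤ N
  u : ℤ → ℝ
  per : ∀ j, u (j + N) = u j
  one_lt : ∀ j, 1 < u j
  conv : ∀ j k : ℤ, u j * Real.cos (2 * π / N * (k - j)) -
    ((Real.cos (2 * π / N) * u j - u (j + 1)) / Real.sin (2 * π / N)) *
      Real.sin (2 * π / N * (k - j)) ≤ u k

namespace GPoly

variable (P : GPoly)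

/-- angle step -/
def δ : ℝ := 2 * π / P.N
/-- directions of the vertices -/
def ee (j : ℤ) : ℂ := Complex.exp (((P.δ * j : ℝ) : ℂ) * Complex.I)
/-- slope coefficient at the start of the side -/
def β (j : ℤ) : ℝ := (Real.cos P.δ * P.u j - P.u (j + 1)) / Real.sin P.δ
/-- slope coefficient at the end of the side -/
def β' (j : ℤ) : ℝ := (P.u j - Real.cos P.δ * P.u (j + 1)) / Real.sin P.δ
/-- conjugate pole of the side -/
def g (j : ℤ) : ℂ := ⟨P.u j, P.β j⟩ * (starRingEnd ℂ) (P.ee j)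
/-- sinh of the radial coordinate of the vertex -/
def sh (j : ℤ) : ℝ := 1 / √(P.u j ^ 2 - 1)
/-- cosh of the radial coordinate of the vertex -/
def ch (j : ℤ) : ℝ := P.u j / √(P.u j ^ 2 - 1)
/-- vertices -/
def p (j : ℤ) : ℍ := Function.surjInv P.hW.surj (P.sh j * P.ee j)

lemma N_pos : (0:ℝ) < P.N := by
  have := P.hN
  have : 0 < P.N := by omega
  exact_mod_cast this

lemma δ_pos : 0 < P.δ := by
  have := P.N_pos
  have := Real.pi_pos
  unfold δ; positivity

lemma δ_lt : P.δ < π := by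
  have h : (3:ℝ) ≤ P.N := by exact_mod_cast P.hN
  have := Real.pi_pos
  unfold δ
  rw [div_lt_iff₀ P.N_pos]
  nlinarith

lemma sin_pos : 0 < Real.sin P.δ := Real.sin_pos_of_pos_of_lt_pi P.δ_pos P.δ_lt

lemma cos_lt : Real.cos P.δ < 1 := by
  have := P.sin_pos
  nlinarith [Real.sin_sq_add_cos_sq P.δ]

lemma N_δ : P.N * P.δ = 2 * π := by
  have := P.N_pos
  unfold δ; field_simp

lemma norm_ee (j : ℤ) : ‖P.ee j‖ = 1 := Complex.norm_exp_ofReal_mul_I _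

lemma ee_conj (j : ℤ) : (starRingEnd ℂ) (P.ee j) * P.ee j = 1 := by
  rw [mul_comm, Complex.mul_conj, Complex.normSq_eq_norm_sq, norm_ee]; simp

lemma ee_re (j : ℤ) : (P.ee j).re = Real.cos (P.δ * j) := Complex.exp_ofReal_mul_I_re _
lemma ee_im (j : ℤ) : (P.ee j).im = Real.sin (P.δ * j) := Complex.exp_ofReal_mul_I_im _

lemma ee_succ (j : ℤ) : P.ee (j + 1) = ⟨Real.cos P.δ, Real.sin P.δ⟩ * P.ee j := by
  apply Complex.ext
  · rw [Complex.mul_re, ee_re, ee_re, ee_im]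
    push_cast
    rw [mul_add, mul_one, Real.cos_add]; ring
  · rw [Complex.mul_im, ee_im, ee_re, ee_im]
    push_cast
    rw [mul_add, mul_one, Real.sin_add]; ring

lemma ee_per (j : ℤ) : P.ee (j + P.N) = P.ee j := by
  have : P.δ * ((j + P.N : ℤ) : ℝ) = P.δ * j + 2 * π := by
    push_cast
    rw [← P.N_δ]; ring
  apply Complex.ext
  · rw [ee_re, ee_re, this, Real.cos_add_two_pi]
  · rw [ee_im, ee_im, this, Real.sin_add_two_pi]

lemma β_per (j : ℤ) : P.β (j + P.N) = P.β j := by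
  unfold β
  rw [P.per, show j + (P.N : ℤ) + 1 = (j + 1) + P.N by ring, P.per]

lemma g_per (j : ℤ) : P.g (j + P.N) = P.g j := by
  unfold g
  rw [P.per, P.β_per, P.ee_per]

lemma p_per (j : ℤ) : P.p (j + P.N) = P.p j := by
  unfold p sh
  rw [P.per, P.ee_per]

lemma g_ee (j : ℤ) : P.g j * P.ee j = ⟨P.u j, P.β j⟩ := by
  rw [g, mul_assoc, ee_conj, mul_one]

lemma g_ee_succ (j : ℤ) : P.g j * P.ee (j + 1) = ⟨P.u (j + 1), P.β' j⟩ := by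
  have hs := P.sin_pos
  rw [ee_succ, mul_left_comm, g_ee]
  apply Complex.ext
  · simp only [Complex.mul_re, β]
    field_simp
    ring
  · simp only [Complex.mul_im, β, β']
    field_simp
    linear_combination (P.u j) * (Real.sin_sq_add_cos_sq P.δ)

lemma norm_g_sq (j : ℤ) : ‖P.g j‖ ^ 2 = P.u j ^ 2 + P.β j ^ 2 := by
  rw [g, norm_mul, RCLike.norm_conj, norm_ee, mul_one, Complex.sq_norm, Complex.normSq_apply]
  ring

lemma norm_g_sq' (j : ℤ) : ‖P.g j‖ ^ 2 = P.u (j + 1) ^ 2 + P.β' j ^ 2 := by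
  have h := congrArg (fun z : ℂ => ‖z‖ ^ 2) (P.g_ee_succ j)
  simp only [norm_mul, norm_ee, mul_one] at h
  rw [h, Complex.sq_norm, Complex.normSq_apply]
  ring

lemma one_lt_norm_g (j : ℤ) : 1 < ‖P.g j‖ := by
  have h1 := P.one_lt j
  have h2 := P.norm_g_sq j
  nlinarith [norm_nonneg (P.g j), sq_nonneg (P.β j)]

lemma D_pos (j : ℤ) : 0 < √(‖P.g j‖ ^ 2 - 1) :=
  Real.sqrt_pos.2 (by have := P.one_lt_norm_g j; nlinarith)

lemma D_sq (j : ℤ) : √(‖P.g j‖ ^ 2 - 1) ^ 2 = ‖P.g j‖ ^ 2 - 1 :=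
  Real.sq_sqrt (by have := P.one_lt_norm_g j; nlinarith)

lemma u_sq_pos (j : ℤ) : 0 < P.u j ^ 2 - 1 := by
  have := P.one_lt j; nlinarith

lemma sh_pos (j : ℤ) : 0 < P.sh j := by
  have : 0 < √(P.u j ^ 2 - 1) := Real.sqrt_pos.2 (P.u_sq_pos j)
  unfold sh; positivity

lemma ch_eq (j : ℤ) : P.ch j = P.u j * P.sh j := by unfold sh ch; ring

lemma ch_sq (j : ℤ) : P.ch j ^ 2 = 1 + P.sh j ^ 2 := by
  have h := P.u_sq_pos j
  unfold sh ch
  rw [div_pow, div_pow, Real.sq_sqrt h.le]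
  field_simp
  ring

lemma ch_pos (j : ℤ) : 0 < P.ch j := by
  rw [ch_eq]; have := P.one_lt j; have := P.sh_pos j; positivity

lemma W_p (j : ℤ) : P.W (P.p j) = P.sh j * P.ee j := Function.surjInv_eq _ _

lemma TT_p (j : ℤ) : TT (P.W (P.p j)) = P.ch j := by
  refine TT_eq_of_sq (P.ch_pos j).le ?_
  rw [W_p, Complex.re_ofReal_mul, Complex.im_ofReal_mul, ch_sq, ee_re, ee_im]
  linear_combination (-P.sh j ^ 2) * Real.sin_sq_add_cos_sq (P.δ * j)

/-- The half-plane function. -/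
def L (j : ℤ) (w : ℂ) : ℝ := (P.g j * w).re - TT w

/-- The polygon. -/
def KN : Set ℍ := {z | ∀ j, P.L j (P.W z) ≤ 0}

lemma L_per (j : ℤ) (w : ℂ) : P.L (j + P.N) w = P.L j w := by unfold L; rw [g_per]

lemma g_ee_re (j k : ℤ) : (P.g j * P.ee k).re ≤ P.u k := by
  refine le_trans (le_of_eq ?_) (P.conv j k)
  have h1 : (2 * π / P.N * ((k : ℝ) - j)) = P.δ * k - P.δ * j := by unfold δ; ring
  rw [h1, Real.cos_sub, Real.sin_sub, g, mul_assoc]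
  simp only [Complex.mul_re, Complex.mul_im, Complex.conj_re, Complex.conj_im, ee_re, ee_im, β, δ]
  ring

lemma L_p_le (j k : ℤ) : P.L j (P.W (P.p k)) ≤ 0 := by
  rw [L, TT_p, W_p, mul_left_comm, Complex.re_ofReal_mul, ch_eq]
  have := P.g_ee_re j k
  have := P.sh_pos k
  nlinarith

lemma p_mem (k : ℤ) : P.p k ∈ P.KN := fun j => P.L_p_le j k

lemma L_p_self (j : ℤ) : P.L j (P.W (P.p j)) = 0 := by
  rw [L, TT_p, W_p, mul_left_comm, Complex.re_ofReal_mul, ch_eq, g_ee]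
  ring

lemma L_p_succ (j : ℤ) : P.L j (P.W (P.p (j + 1))) = 0 := by
  rw [L, TT_p, W_p, mul_left_comm, Complex.re_ofReal_mul, ch_eq, g_ee_succ]
  ring

/-- Frame adapted to the side `j`. -/
def SW (j : ℤ) (z : ℍ) : ℂ := sideMap (P.g j) (P.W z)

lemma SW_frame (j : ℤ) : IsFrame (P.SW j) := P.hW.side (P.one_lt_norm_g j)

lemma SW_im (j : ℤ) (z : ℍ) : (P.SW j z).im = - P.L j (P.W z) / √(‖P.g j‖ ^ 2 - 1) := by
  simp only [SW, sideMap, L]; ring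

/-- position along the side `j` -/
def pos (j : ℤ) (z : ℍ) : ℝ := (fermiInv (P.SW j z)).1

lemma SW_p_im (j : ℤ) : (P.SW j (P.p j)).im = 0 := by rw [SW_im, L_p_self]; simp
lemma SW_p_succ_im (j : ℤ) : (P.SW j (P.p (j + 1))).im = 0 := by rw [SW_im, L_p_succ]; simp

lemma axis_spec {j : ℤ} {z : ℍ} (h : (P.SW j z).im = 0) :
    Real.sinh (P.pos j z) = (P.g j * P.W z).im / ‖P.g j‖ ∧
    Real.cosh (P.pos j z) = TT (P.W z) * √(‖P.g j‖ ^ 2 - 1) / ‖P.g j‖ ∧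
    (P.g j * P.W z).re = TT (P.W z) := by
  have hD := P.D_pos j
  have hg := P.one_lt_norm_g j
  obtain ⟨h1, h2⟩ := fermiInv_spec (P.SW j z)
  rw [h] at h1 h2
  have e3 : (P.g j * P.W z).re = TT (P.W z) := by
    rw [SW_im, div_eq_zero_iff] at h
    rcases h with h | h
    · unfold L at h; linarith
    · exact absurd h hD.ne'
  refine ⟨?_, ?_, e3⟩
  · rw [pos]
    simp at h1
    rw [← h1]; rfl
  · rw [pos]
    simp at h2
    rw [← h2]
    show TT (sideMap (P.g j) (P.W z)) = _
    rw [TT_side hg, e3]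
    have : ‖P.g j‖ ^ 2 * TT (P.W z) - TT (P.W z) = TT (P.W z) * √(‖P.g j‖ ^ 2 - 1) ^ 2 := by
      rw [D_sq]; ring
    rw [this]
    field_simp

lemma pos_lt (j : ℤ) : P.pos j (P.p j) < P.pos j (P.p (j + 1)) := by
  obtain ⟨a1, a2, -⟩ := P.axis_spec (P.SW_p_im j)
  obtain ⟨b1, b2, -⟩ := P.axis_spec (P.SW_p_succ_im j)
  have hD := P.D_pos j
  have hg : 0 < ‖P.g j‖ := by have := P.one_lt_norm_g j; linarith
  rw [TT_p] at a2 b2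
  rw [W_p, mul_left_comm, Complex.im_ofReal_mul, g_ee] at a1
  rw [W_p, mul_left_comm, Complex.im_ofReal_mul, g_ee_succ] at b1
  simp only at a1 b1
  rw [← sub_pos, ← Real.sinh_pos_iff, Real.sinh_sub, a1, a2, b1, b2, ch_eq, ch_eq]
  have h1 := P.sh_pos j
  have h2 := P.sh_pos (j + 1)
  have hs := P.sin_pos
  have hc := P.cos_lt
  have hu1 := P.one_lt j
  have hu2 := P.one_lt (j + 1)
  have key : 0 < P.β' j * P.u j - P.u (j + 1) * P.β j := by
    unfold β β'
    have : (P.u j - Real.cos P.δ * P.u (j + 1)) / Real.sin P.δ * P.u j -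
      P.u (j + 1) * ((Real.cos P.δ * P.u j - P.u (j + 1)) / Real.sin P.δ) =
      ((P.u j - P.u (j + 1)) ^ 2 + 2 * (1 - Real.cos P.δ) * (P.u j * P.u (j + 1))) / Real.sin P.δ := by
      field_simp; ring
    rw [this]
    have : 0 < 1 - Real.cos P.δ := by linarith
    positivity
  have : P.sh (j + 1) * P.β' j / ‖P.g j‖ * (P.u j * P.sh j * √(‖P.g j‖ ^ 2 - 1) / ‖P.g j‖) -
      P.u (j + 1) * P.sh (j + 1) * √(‖P.g j‖ ^ 2 - 1) / ‖P.g j‖ * (P.sh j * P.β j / ‖P.g j‖) =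
      (P.β' j * P.u j - P.u (j + 1) * P.β j) * P.sh j * P.sh (j + 1) * √(‖P.g j‖ ^ 2 - 1) / ‖P.g j‖ ^ 2 := by
    field_simp
  rw [this]
  positivity

lemma pos_sub (j : ℤ) : P.pos j (P.p (j + 1)) - P.pos j (P.p j) = dist (P.p j) (P.p (j + 1)) := by
  have h := (P.SW_frame j).cosh_axis (z := P.p (j + 1)) (P.SW_p_im j)
  rw [P.SW_p_succ_im j] at h
  simp only [ne_eq, OfNat.ofNat_ne_zero, not_false_eq_true, zero_pow, add_zero, Real.sqrt_one, one_mul] at h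
  have h2 := P.pos_lt j
  have h3 : |dist (P.p (j + 1)) (P.p j)| = |P.pos j (P.p (j + 1)) - P.pos j (P.p j)| :=
    le_antisymm (Real.cosh_le_cosh.1 h.le) (Real.cosh_le_cosh.1 h.ge)
  rw [abs_of_nonneg dist_nonneg, abs_of_pos (by linarith)] at h3
  rw [← h3, dist_comm]

/-- The sides of the polygon. -/
def side (j : ℤ) : Set ℍ :=
  {z | (P.SW j z).im = 0 ∧ P.pos j z ∈ Set.Icc (P.pos j (P.p j)) (P.pos j (P.p (j + 1)))}

lemma p_mem_side (j : ℤ) : P.p j ∈ P.side j := ⟨P.SW_p_im j, le_rfl, (P.pos_lt j).le⟩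
lemma p_succ_mem_side (j : ℤ) : P.p (j + 1) ∈ P.side j :=
  ⟨P.SW_p_succ_im j, (P.pos_lt j).le, le_rfl⟩

/-- Points of a side as combinations of the endpoints. -/
lemma side_comb {j : ℤ} {z : ℍ} (hz : (P.SW j z).im = 0) :
    ∃ a b : ℝ, P.W z = a * P.W (P.p j) + b * P.W (P.p (j + 1)) ∧
      TT (P.W z) = a * TT (P.W (P.p j)) + b * TT (P.W (P.p (j + 1))) ∧
      (P.pos j z ≤ P.pos j (P.p (j + 1)) → 0 ≤ a) ∧ (P.pos j z < P.pos j (P.p (j + 1)) → 0 < a) ∧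
      (P.pos j (P.p j) ≤ P.pos j z → 0 ≤ b) ∧ (P.pos j (P.p j) < P.pos j z → 0 < b) := by
  obtain ⟨a1, a2, a3⟩ := P.axis_spec (P.SW_p_im j)
  obtain ⟨b1, b2, b3⟩ := P.axis_spec (P.SW_p_succ_im j)
  obtain ⟨c1, c2, c3⟩ := P.axis_spec hz
  have hlt := P.pos_lt j
  set x := P.pos j (P.p j)
  set y := P.pos j (P.p (j + 1))
  set s := P.pos j z
  have hS : 0 < Real.sinh (y - x) := Real.sinh_pos_iff.2 (by linarith)
  have hD := P.D_pos j
  have hg : 0 < ‖P.g j‖ := by have := P.one_lt_norm_g j; linarith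
  have hg0 : P.g j ≠ 0 := norm_pos_iff.1 hg
  have i1 : Real.sinh s = Real.sinh (y - s) / Real.sinh (y - x) * Real.sinh x +
      Real.sinh (s - x) / Real.sinh (y - x) * Real.sinh y := by
    field_simp
    rw [Real.sinh_sub, Real.sinh_sub, Real.sinh_sub]; ring
  have i2 : Real.cosh s = Real.sinh (y - s) / Real.sinh (y - x) * Real.cosh x +
      Real.sinh (s - x) / Real.sinh (y - x) * Real.cosh y := by
    field_simp
    rw [Real.sinh_sub, Real.sinh_sub, Real.sinh_sub]; ring
  set a := Real.sinh (y - s) / Real.sinh (y - x)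
  set b := Real.sinh (s - x) / Real.sinh (y - x)
  have k1 : (P.g j * P.W z).im = a * (P.g j * P.W (P.p j)).im + b * (P.g j * P.W (P.p (j + 1))).im := by
    rw [c1, a1, b1] at i1
    field_simp at i1
    linarith
  have k2 : TT (P.W z) = a * TT (P.W (P.p j)) + b * TT (P.W (P.p (j + 1))) := by
    rw [c2, a2, b2] at i2
    field_simp at i2
    linarith
  refine ⟨a, b, ?_, k2, ?_, ?_, ?_, ?_⟩
  · apply mul_left_cancel₀ hg0
    have e : P.g j * (a * P.W (P.p j) + b * P.W (P.p (j + 1))) =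
      a * (P.g j * P.W (P.p j)) + b * (P.g j * P.W (P.p (j + 1))) := by ring
    rw [e]
    apply Complex.ext
    · rw [Complex.add_re, Complex.re_ofReal_mul, Complex.re_ofReal_mul, a3, b3, c3, k2]
    · rw [Complex.add_im, Complex.im_ofReal_mul, Complex.im_ofReal_mul, k1]
  · intro h
    exact div_nonneg (Real.sinh_nonneg_iff.2 (by linarith)) hS.le
  · intro h
    exact div_pos (Real.sinh_pos_iff.2 (by linarith)) hS
  · intro h
    exact div_nonneg (Real.sinh_nonneg_iff.2 (by linarith)) hS.le
  · intro h
    exact div_pos (Real.sinh_pos_iff.2 (by linarith)) hS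

lemma L_comb (k : ℤ) {x y z : ℂ} {a b : ℝ} (h1 : z = a * x + b * y) (h2 : TT z = a * TT x + b * TT y) :
    P.L k z = a * P.L k x + b * P.L k y := by
  unfold L
  rw [h2, h1, mul_add, Complex.add_re, mul_left_comm, mul_left_comm (P.g k), Complex.re_ofReal_mul,
    Complex.re_ofReal_mul]
  ring

lemma side_subset (j : ℤ) : P.side j ⊆ P.KN := by
  rintro z ⟨hz, h1, h2⟩ k
  obtain ⟨a, b, e1, e2, ha, -, hb, -⟩ := P.side_comb hz
  rw [P.L_comb k e1 e2]
  have := P.L_p_le k j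
  have := P.L_p_le k (j + 1)
  have := ha h2
  have := hb h1
  nlinarith

end GPoly

end

noncomputable section

lemma cexp_eq (φ : ℝ) : Complex.exp ((φ : ℂ) * Complex.I) = ⟨Real.cos φ, Real.sin φ⟩ :=
  Complex.ext (Complex.exp_ofReal_mul_I_re _) (Complex.exp_ofReal_mul_I_im _)

lemma polar_form (w : ℂ) : w = ‖w‖ * Complex.exp ((Complex.arg w : ℂ) * Complex.I) :=
  (Complex.norm_mul_exp_arg_mul_I w).symm

lemma wedge_angle {δ A B : ℝ} (h0 : 0 < δ) (h1 : δ < π) (hA : 0 < A) (hB : 0 < B) :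
    ∃ r : ℝ, 0 < r ∧ ∃ φ ∈ Set.Ioo 0 δ,
      (A : ℂ) + B * (⟨Real.cos δ, Real.sin δ⟩ : ℂ) = r * Complex.exp ((φ : ℂ) * Complex.I) := by
  have hs := Real.sin_pos_of_pos_of_lt_pi h0 h1
  set w : ℂ := (A : ℂ) + B * (⟨Real.cos δ, Real.sin δ⟩ : ℂ) with hw
  have hre : w.re = A + B * Real.cos δ := by
    rw [hw, Complex.add_re, Complex.re_ofReal_mul, Complex.ofReal_re]
  have him : w.im = B * Real.sin δ := by
    rw [hw, Complex.add_im, Complex.im_ofReal_mul, Complex.ofReal_im]; ring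
  have himp : 0 < w.im := by rw [him]; positivity
  have hw0 : w ≠ 0 := by intro h; rw [h] at himp; simp at himp
  have hn : 0 < ‖w‖ := norm_pos_iff.2 hw0
  have hp := polar_form w
  rw [cexp_eq] at hp
  have e1 : w.re = ‖w‖ * Real.cos w.arg := by
    conv_lhs => rw [hp]
    rw [Complex.re_ofReal_mul]
  have e2 : w.im = ‖w‖ * Real.sin w.arg := by
    conv_lhs => rw [hp]
    rw [Complex.im_ofReal_mul]
  have hsa : 0 < Real.sin w.arg := by
    by_contra h
    push Not at h
    nlinarith
  have hpos : 0 ≤ w.arg := Complex.arg_nonneg_iff.2 himp.le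
  have hpos' : 0 < w.arg := lt_of_le_of_ne hpos (by intro h; rw [← h] at hsa; simp at hsa)
  refine ⟨‖w‖, hn, w.arg, ⟨hpos', ?_⟩, polar_form w⟩
  by_contra h
  push Not at h
  have h3 : 0 ≤ Real.sin (w.arg - δ) := Real.sin_nonneg_of_nonneg_of_le_pi (by linarith)
    (by linarith [Complex.arg_le_pi w])
  have h4 : ‖w‖ * Real.sin (w.arg - δ) = - A * Real.sin δ := by
    rw [Real.sin_sub]
    linear_combination (-Real.cos δ) * e2 + (Real.sin δ) * e1 + Real.cos δ * him - Real.sin δ * hre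
  nlinarith [mul_pos hA hs, mul_nonneg hn.le h3]

lemma exp_unique {r r' φ φ' : ℝ} (hr : 0 < r) (hr' : 0 < r') (h : φ ∈ Set.Ico 0 (2 * π))
    (h' : φ' ∈ Set.Ico 0 (2 * π))
    (he : (r : ℂ) * Complex.exp ((φ : ℂ) * Complex.I) = r' * Complex.exp ((φ' : ℂ) * Complex.I)) :
    φ = φ' := by
  have hn := congrArg norm he
  rw [norm_mul, norm_mul, Complex.norm_exp_ofReal_mul_I, Complex.norm_exp_ofReal_mul_I,
    Complex.norm_real, Complex.norm_real, mul_one, mul_one, Real.norm_of_nonneg hr.le,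
    Real.norm_of_nonneg hr'.le] at hn
  rw [hn] at he
  have he2 := mul_left_cancel₀ (Complex.ofReal_ne_zero.2 hr'.ne') he
  obtain ⟨n, hn⟩ := Complex.exp_eq_exp_iff_exists_int.1 he2
  have hn2 : φ = φ' + n * (2 * π) := by
    have := congrArg Complex.im hn
    simpa using this
  have hpi := Real.pi_pos
  have h1 : (n : ℝ) < 1 := by
    by_contra hc
    push Not at hc
    nlinarith [h.2, h'.1]
  have h2 : (-1 : ℝ) < n := by
    by_contra hc
    push Not at hc
    nlinarith [h.1, h'.2]
  have h1' : n < 1 := by exact_mod_cast h1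
  have h2' : -1 < n := by exact_mod_cast h2
  have : n = 0 := by omega
  rw [this] at hn2
  simpa using hn2

lemma sin_cos_arcsin {b s D : ℝ} (hs : 0 < s) (hD : 0 < D) (h : D ^ 2 = (1 / s) ^ 2 + b ^ 2) :
    Real.sin (Real.arcsin (b / D)) = b / D ∧ Real.cos (Real.arcsin (b / D)) = 1 / (s * D) := by
  have h1 : (b / D) ^ 2 = 1 - (1 / (s * D)) ^ 2 := by
    field_simp
    field_simp at h
    linarith
  have h2 : (b / D) ^ 2 ≤ 1 := by rw [h1]; nlinarith [sq_nonneg (1 / (s * D))]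
  have h3 := abs_le_of_sq_le_sq' (by rw [one_pow]; exact h2 : (b / D) ^ 2 ≤ 1 ^ 2) zero_le_one
  refine ⟨Real.sin_arcsin h3.1 h3.2, ?_⟩
  rw [Real.cos_arcsin, h1, sub_sub_cancel, Real.sqrt_sq (by positivity)]

lemma sum_range_shift (N : ℕ) (F : ℤ → ℝ) (hF : ∀ j, F (j + N) = F j) :
    ∑ j ∈ Finset.range N, F ((j : ℤ) - 1) = ∑ j ∈ Finset.range N, F j := by
  have h1 := Finset.sum_range_succ (fun j : ℕ => F ((j : ℤ) - 1)) N
  have h2 := Finset.sum_range_succ' (fun j : ℕ => F ((j : ℤ) - 1)) N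
  have h3 := hF (-1)
  rw [h1] at h2
  have e : (-1 + (N : ℤ)) = (N : ℤ) - 1 := by ring
  rw [e] at h3
  push_cast at h2
  simp only [add_sub_cancel_right, zero_sub, h3] at h2
  linarith

namespace GPoly

variable (P : GPoly)

/-- Frame adapted to the vertex `j`. -/
def VW (j : ℤ) (z : ℍ) : ℂ := boost (P.ch j) (P.sh j) ((starRingEnd ℂ) (P.ee j) * P.W z)

lemma norm_conj_ee (j : ℤ) : ‖(starRingEnd ℂ) (P.ee j)‖ = 1 := by
  rw [RCLike.norm_conj, norm_ee]

lemma VW_frame (j : ℤ) : IsFrame (P.VW j) :=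
  (P.hW.rot (P.norm_conj_ee j)).boost (P.ch_pos j) (P.ch_sq j)

lemma VW_p (j : ℤ) : P.VW j (P.p j) = 0 := by
  have e : (starRingEnd ℂ) (P.ee j) * P.W (P.p j) = (P.sh j : ℂ) := by
    rw [W_p, mul_left_comm, ee_conj, mul_one]
  have e2 : TT (P.sh j : ℂ) = P.ch j := by
    rw [← e, TT_mul (P.norm_conj_ee j), TT_p]
  apply Complex.ext
  · simp only [VW, boost, e, e2, Complex.ofReal_re, Complex.zero_re]; ring
  · simp only [VW, boost, e, Complex.ofReal_im, Complex.zero_im]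

lemma L_vertex {j k : ℤ} {b : ℝ} (h : P.g k * P.ee j = ⟨P.u j, b⟩) (z : ℍ) :
    P.L k (P.W z) = 1 / P.sh j * (P.VW j z).re - b * (P.VW j z).im := by
  have hs := P.sh_pos j
  have e : P.g k * P.W z = ⟨P.u j, b⟩ * ((starRingEnd ℂ) (P.ee j) * P.W z) := by
    rw [← h]
    linear_combination (-(P.g k * P.W z)) * P.ee_conj j
  rw [L, e]
  simp only [VW, boost]
  rw [TT_mul (P.norm_conj_ee j), Complex.mul_re, ch_eq]
  field_simp
  ring

/-- outward direction angles -/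
def ψ0 (j : ℤ) : ℝ := Real.arcsin (P.β j / √(‖P.g j‖ ^ 2 - 1))
/-- outward direction angles -/
def ψ1 (j : ℤ) : ℝ := Real.arcsin (P.β' j / √(‖P.g j‖ ^ 2 - 1))

lemma inv_sh_sq (j : ℤ) : (1 / P.sh j) ^ 2 = P.u j ^ 2 - 1 := by
  unfold sh
  rw [one_div_one_div, Real.sq_sqrt (P.u_sq_pos j).le]

lemma L_ψ0 (j : ℤ) (z : ℍ) : P.L j (P.W z) = √(‖P.g j‖ ^ 2 - 1) *
    (Real.cos (P.ψ0 j) * (P.VW j z).re - Real.sin (P.ψ0 j) * (P.VW j z).im) := by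
  have hD := P.D_pos j
  have hs := P.sh_pos j
  obtain ⟨h1, h2⟩ := sin_cos_arcsin hs hD (b := P.β j) (by
    rw [D_sq, inv_sh_sq, norm_g_sq]; ring)
  rw [ψ0, h1, h2, P.L_vertex (P.g_ee j)]
  field_simp

lemma L_ψ1 (j : ℤ) (z : ℍ) : P.L (j - 1) (P.W z) = √(‖P.g (j - 1)‖ ^ 2 - 1) *
    (Real.cos (P.ψ1 (j - 1)) * (P.VW j z).re - Real.sin (P.ψ1 (j - 1)) * (P.VW j z).im) := by
  have hD := P.D_pos (j - 1)
  have hs := P.sh_pos j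
  obtain ⟨h1, h2⟩ := sin_cos_arcsin hs hD (b := P.β' (j - 1)) (by
    rw [D_sq, inv_sh_sq, norm_g_sq', sub_add_cancel]; ring)
  have hg := P.g_ee_succ (j - 1)
  rw [sub_add_cancel] at hg
  rw [ψ1, h1, h2, P.L_vertex hg]
  field_simp

lemma β'_per (j : ℤ) : P.β' (j + P.N) = P.β' j := by
  unfold β'
  rw [P.per, show j + (P.N : ℤ) + 1 = (j + 1) + P.N by ring, P.per]

lemma ψ1_per (j : ℤ) : P.ψ1 (j + P.N) = P.ψ1 j := by
  unfold ψ1; rw [g_per, β'_per]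

/-- outer sector at a vertex -/
def S (t : ℝ) (j : ℤ) : Set ℍ := {z | 0 < ‖P.VW j z‖ ∧ ‖P.VW j z‖ ≤ Real.sinh t ∧
  Complex.arg (P.VW j z) ∈ Set.Ioo (-P.ψ1 (j - 1)) (-P.ψ0 j)}

/-- outer rectangle on a side -/
def R (t : ℝ) (j : ℤ) : Set ℍ := {z | (fermiInv (P.SW j z)).1 ∈
    Set.Ioo (P.pos j (P.p j)) (P.pos j (P.p (j + 1))) ∧
  (fermiInv (P.SW j z)).2 ∈ Set.Ioo (-Real.sinh t) 0}

lemma S_inner {t : ℝ} {j : ℤ} {z y : ℍ} (hz : z ∈ P.S t j) (hy : y ∈ P.KN) :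
    (P.VW j z).re * (P.VW j y).re + (P.VW j z).im * (P.VW j y).im ≤ 0 := by
  obtain ⟨h0, -, h1, h2⟩ := hz
  have hp := polar_form (P.VW j z)
  rw [cexp_eq] at hp
  set Z := P.VW j z
  set Y := P.VW j y
  have e1 : Z.re = ‖Z‖ * Real.cos Z.arg := by
    conv_lhs => rw [hp]
    rw [Complex.re_ofReal_mul]
  have e2 : Z.im = ‖Z‖ * Real.sin Z.arg := by
    conv_lhs => rw [hp]
    rw [Complex.im_ofReal_mul]
  set x := -Z.arg with hx
  have hxx : Z.arg = -x := by rw [hx]; ring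
  rw [hxx, Real.cos_neg] at e1
  rw [hxx, Real.sin_neg] at e2
  have l0 := hy j
  have l1 := hy (j - 1)
  rw [L_ψ0] at l0
  rw [L_ψ1] at l1
  have l0' := nonpos_of_mul_nonpos_right l0 (P.D_pos j)
  have l1' := nonpos_of_mul_nonpos_right l1 (P.D_pos (j - 1))
  set a := P.ψ0 j
  set b := P.ψ1 (j - 1)
  have hax : a < x := by linarith
  have hxb : x < b := by linarith
  have ha : -(π / 2) ≤ a := Real.neg_pi_div_two_le_arcsin _
  have hb : b ≤ π / 2 := Real.arcsin_le_pi_div_two _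
  have s1 : 0 < Real.sin (b - x) := Real.sin_pos_of_pos_of_lt_pi (by linarith) (by linarith)
  have s2 : 0 < Real.sin (x - a) := Real.sin_pos_of_pos_of_lt_pi (by linarith) (by linarith)
  have s3 : 0 ≤ Real.sin (b - a) := Real.sin_nonneg_of_nonneg_of_le_pi (by linarith) (by linarith)
  have key : (Real.cos x * Y.re - Real.sin x * Y.im) * Real.sin (b - a) =
      (Real.cos a * Y.re - Real.sin a * Y.im) * Real.sin (b - x) +
      (Real.cos b * Y.re - Real.sin b * Y.im) * Real.sin (x - a) := by
    rw [Real.sin_sub, Real.sin_sub, Real.sin_sub]; ring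
  have goal : Real.cos x * Y.re - Real.sin x * Y.im ≤ 0 := by
    rcases eq_or_lt_of_le s3 with h | h
    · exfalso
      have hba : b - a < π ∨ b - a = π := lt_or_eq_of_le (by linarith)
      rcases hba with h3 | h3
      · have := Real.sin_pos_of_pos_of_lt_pi (show 0 < b - a by linarith) h3
        linarith
      · have hb' : b = π / 2 := by linarith
        have hD := P.D_pos (j - 1)
        have hs := P.sh_pos j
        obtain ⟨-, h2⟩ := sin_cos_arcsin hs hD (b := P.β' (j - 1)) (by
          rw [D_sq, inv_sh_sq, norm_g_sq', sub_add_cancel]; ring)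
        have h4 : Real.cos b = 1 / (P.sh j * √(‖P.g (j - 1)‖ ^ 2 - 1)) := h2
        rw [hb', Real.cos_pi_div_two] at h4
        have : 0 < 1 / (P.sh j * √(‖P.g (j - 1)‖ ^ 2 - 1)) := by positivity
        linarith
    · nlinarith
  rw [e1, e2]
  nlinarith

/-- `φ` is the direction of the unique nearest point of the polygon to `z`. -/
def Foot (z : ℍ) (φ : ℝ) : Prop := ∃ q ∈ P.KN, (∀ y ∈ P.KN, y ≠ q → dist z q < dist z y) ∧
  ∃ r : ℝ, 0 < r ∧ P.W q = r * Complex.exp ((φ : ℂ) * Complex.I)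

lemma Foot.unique {P : GPoly} {z : ℍ} {φ φ' : ℝ} (h : P.Foot z φ) (h' : P.Foot z φ')
    (hφ : φ ∈ Set.Ico 0 (2 * π)) (hφ' : φ' ∈ Set.Ico 0 (2 * π)) : φ = φ' := by
  obtain ⟨q, hq, hq1, r, hr, hqr⟩ := h
  obtain ⟨q', hq', hq1', r', hr', hqr'⟩ := h'
  have : q = q' := by
    by_contra hne
    have h1 := hq1 q' hq' (Ne.symm hne)
    have h2 := hq1' q hq hne
    linarith
  subst this
  exact exp_unique hr hr' hφ hφ' (hqr.symm.trans hqr')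

lemma dist_lt_of_cosh {z q y : ℍ} (h : Real.cosh (dist z q) < Real.cosh (dist z y)) :
    dist z q < dist z y := by
  rw [Real.cosh_lt_cosh, abs_of_nonneg dist_nonneg, abs_of_nonneg dist_nonneg] at h
  exact h

lemma S_foot {t : ℝ} {j : ℤ} {z : ℍ} (hz : z ∈ P.S t j) : P.Foot z (P.δ * j) := by
  refine ⟨P.p j, P.p_mem j, fun y hy hne => ?_, P.sh j, P.sh_pos j, P.W_p j⟩
  apply dist_lt_of_cosh
  rw [(P.VW_frame j).dist_eq, (P.VW_frame j).dist_eq, VW_p, mink, mink]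
  have h1 := P.S_inner hz hy
  have h2 := TT_pos (P.VW j z)
  have h3 : 1 < TT (P.VW j y) := by
    refine lt_of_le_of_ne (TT_ge_one _) fun h => hne ?_
    have hs := TT_sq (P.VW j y)
    rw [← h] at hs
    apply (P.VW_frame j).inj
    rw [VW_p]
    apply Complex.ext
    · show (P.VW j y).re = 0
      nlinarith [sq_nonneg (P.VW j y).re, sq_nonneg (P.VW j y).im]
    · show (P.VW j y).im = 0
      nlinarith [sq_nonneg (P.VW j y).re, sq_nonneg (P.VW j y).im]
  have h4 : TT 0 = 1 := by simp [TT]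
  rw [h4]
  simp only [Complex.zero_re, Complex.zero_im, mul_zero, add_zero]
  nlinarith

lemma S_disj_KN {t : ℝ} {j : ℤ} {z : ℍ} (hz : z ∈ P.S t j) : z ∉ P.KN := by
  intro h
  have h1 := P.S_inner hz h
  have h2 := hz.1
  have : ‖P.VW j z‖ ^ 2 ≤ 0 := by
    rw [Complex.sq_norm, Complex.normSq_apply]; exact h1
  nlinarith

lemma R_disj_KN {t : ℝ} {j : ℤ} {z : ℍ} (hz : z ∈ P.R t j) : z ∉ P.KN := by
  intro h
  have h1 := hz.2.2
  have h2 : (fermiInv (P.SW j z)).2 = (P.SW j z).im := rfl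
  rw [h2, SW_im] at h1
  have h3 := h j
  have := div_nonneg (neg_nonneg.2 h3) (P.D_pos j).le
  linarith

lemma R_foot_pt {t : ℝ} {j : ℤ} {z : ℍ} (hz : z ∈ P.R t j) :
    ∃ q, (P.SW j q).im = 0 ∧ P.pos j q = P.pos j z := by
  obtain ⟨q, hq⟩ := (P.SW_frame j).surj (Real.sinh (P.pos j z) : ℂ)
  refine ⟨q, by rw [hq]; exact Complex.ofReal_im _, ?_⟩
  rw [pos, hq]
  simp only [fermiInv, Complex.ofReal_re, Complex.ofReal_im]
  norm_num [Real.arsinh_sinh]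

lemma R_foot {t : ℝ} {j : ℤ} {z : ℍ} (hz : z ∈ P.R t j) :
    ∃ φ ∈ Set.Ioo (P.δ * j) (P.δ * (j + 1)), P.Foot z φ := by
  obtain ⟨q, hq0, hq1⟩ := P.R_foot_pt hz
  have hzp : P.pos j z ∈ Set.Ioo (P.pos j (P.p j)) (P.pos j (P.p (j + 1))) := hz.1
  rw [← hq1] at hzp
  have hqK : q ∈ P.KN := P.side_subset j ⟨hq0, hzp.1.le, hzp.2.le⟩
  obtain ⟨a, b, e1, -, -, ha, -, hb⟩ := P.side_comb hq0
  have ha := ha hzp.2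
  have hb := hb hzp.1
  obtain ⟨r, hr, φ, hφ, e⟩ := wedge_angle P.δ_pos P.δ_lt (mul_pos ha (P.sh_pos j))
    (mul_pos hb (P.sh_pos (j + 1)))
  refine ⟨P.δ * j + φ, ⟨by linarith [hφ.1], by nlinarith [hφ.2]⟩, q, hqK, ?_, r, hr, ?_⟩
  · intro y hy hne
    apply dist_lt_of_cosh
    have hb0 : (P.SW j z).im < 0 := hz.2.2
    have hy0 : 0 ≤ (P.SW j y).im := by
      rw [SW_im]; exact div_nonneg (neg_nonneg.2 (hy j)) (P.D_pos j).le
    have c1 := (P.SW_frame j).cosh_axis (z := z) hq0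
    have c2 := (P.SW_frame j).dist_eq z y
    have c3 := (P.SW_frame j).dist_eq q y
    obtain ⟨z1, z2⟩ := fermiInv_spec (P.SW j z)
    obtain ⟨q1, q2⟩ := fermiInv_spec (P.SW j q)
    have hq1' : (fermiInv (P.SW j q)).1 = (fermiInv (P.SW j z)).1 := hq1
    rw [hq1', sub_self, Real.cosh_zero, mul_one] at c1
    rw [hq1', hq0] at q1 q2
    rw [mink, q1, q2, hq0] at c3
    rw [mink, z1, z2] at c2
    set s := √(1 + (P.SW j z).im ^ 2)
    have hs : 0 < s := Real.sqrt_pos.2 (by positivity)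
    have hlt : 1 < Real.cosh (dist q y) := Real.one_lt_cosh.2 (dist_ne_zero.2 (Ne.symm hne))
    simp only [ne_eq, OfNat.ofNat_ne_zero, not_false_eq_true, zero_pow, add_zero, Real.sqrt_one,
      one_mul, zero_mul] at c3
    rw [c1, c2]
    nlinarith
  · have e' : P.W q = P.ee j * (((a * P.sh j : ℝ) : ℂ) + ((b * P.sh (j + 1) : ℝ) : ℂ) *
        (⟨Real.cos P.δ, Real.sin P.δ⟩ : ℂ)) := by
      rw [e1, W_p, W_p, ee_succ]
      push_cast
      ring
    rw [e', e, ee, mul_left_comm, ← Complex.exp_add]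
    congr 2
    push_cast
    ring

end GPoly

end

noncomputable section

namespace GPoly

variable (P : GPoly)

lemma per_mul {α : Type*} {f : ℤ → α} (h : ∀ j, f (j + P.N) = f j) (j n : ℤ) :
    f (j + n * P.N) = f j := by
  have h' : Function.Periodic f (P.N : ℤ) := h
  exact h'.int_mul n j

lemma N_pos' : 0 < P.N := by have := P.hN; omega

lemma exists_wedge (w : ℂ) (hw : w ≠ 0) : ∃ k : ℕ, k < P.N ∧ ∃ φ ∈ Set.Ico 0 P.δ,
    w = ‖w‖ * (Complex.exp ((φ : ℂ) * Complex.I) * P.ee k) := by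
  have hδ := P.δ_pos
  set x := Complex.arg w / P.δ with hx
  set n := ⌊x⌋ with hn
  have hN : (0:ℤ) < P.N := by exact_mod_cast P.N_pos'
  obtain ⟨k, hk⟩ := Int.eq_ofNat_of_zero_le (Int.emod_nonneg n hN.ne')
  have hk2 := Int.emod_lt_of_pos n hN
  have hk3 := Int.emod_add_mul_ediv n P.N
  refine ⟨k, by omega, Int.fract x * P.δ, ⟨mul_nonneg (Int.fract_nonneg x) hδ.le, ?_⟩, ?_⟩
  · nlinarith [Int.fract_lt_one x]
  · have e1 : P.ee k = P.ee n := by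
      rw [← hk3, hk, mul_comm, P.per_mul P.ee_per]
    rw [e1, ee, ← Complex.exp_add, ← add_mul]
    have e2 : Complex.arg w = Int.fract x * P.δ + P.δ * n := by
      have : x * P.δ = Complex.arg w := by rw [hx]; field_simp
      have h2 := Int.fract_add_floor x
      rw [← this]
      conv_lhs => rw [← h2]
      rw [hn]; ring
    conv_lhs => rw [polar_form w, e2]
    push_cast
    rfl

/-- angle of the start of side `j` seen from the pole direction. -/
def φ1 (j : ℤ) : ℝ := Complex.arg ⟨P.u j, P.β j⟩

lemma φ1_spec (j : ℤ) : -(π / 2) < P.φ1 j ∧ P.φ1 j < π / 2 ∧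
    P.g j * P.ee j = ‖P.g j‖ * Complex.exp ((P.φ1 j : ℂ) * Complex.I) := by
  have h := P.one_lt j
  have h2 : |P.φ1 j| < π / 2 := Complex.abs_arg_lt_pi_div_two_iff.2 (Or.inl (by simp; linarith))
  rw [abs_lt] at h2
  refine ⟨h2.1, h2.2, ?_⟩
  have e : ‖P.g j‖ = ‖P.g j * P.ee j‖ := by rw [norm_mul, norm_ee, mul_one]
  rw [e, φ1, ← g_ee]
  exact polar_form _

lemma φ1_cs (j : ℤ) : ‖P.g j‖ * Real.cos (P.φ1 j) = P.u j ∧ ‖P.g j‖ * Real.sin (P.φ1 j) = P.β j := by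
  have h := (P.φ1_spec j).2.2
  rw [g_ee, cexp_eq] at h
  constructor
  · have := congrArg Complex.re h
    rw [Complex.re_ofReal_mul] at this
    exact this.symm
  · have := congrArg Complex.im h
    rw [Complex.im_ofReal_mul] at this
    exact this.symm

lemma φ2_cs (j : ℤ) : ‖P.g j‖ * Real.cos (P.φ1 j + P.δ) = P.u (j + 1) ∧
    ‖P.g j‖ * Real.sin (P.φ1 j + P.δ) = P.β' j := by
  have h := (P.φ1_spec j).2.2
  have h3 := P.g_ee_succ j
  rw [ee_succ, mul_left_comm, h, cexp_eq, mul_left_comm] at h3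
  constructor
  · have := congrArg Complex.re h3
    rw [Complex.re_ofReal_mul, Complex.mul_re] at this
    simp only at this
    rw [← this, Real.cos_add]; ring
  · have := congrArg Complex.im h3
    rw [Complex.im_ofReal_mul, Complex.mul_im] at this
    simp only at this
    rw [← this, Real.sin_add]; ring

lemma φ2_lt (j : ℤ) : P.φ1 j + P.δ < π / 2 := by
  by_contra hc
  push Not at hc
  have h1 := P.φ1_spec j
  have h2 := P.δ_lt
  have h3 := Real.cos_nonpos_of_pi_div_two_le_of_le hc (by linarith)
  have h4 := (P.φ2_cs j).1
  have h5 := P.one_lt (j + 1)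
  have h6 := P.one_lt_norm_g j
  nlinarith

lemma wedge_bound (j : ℤ) : 0 ≤ P.ψ1 j - P.ψ0 j - P.δ ∧
    hypAreaMeasure {z | P.L j (P.W z) ≤ 0 ∧ Complex.arg (P.g j * P.W z) ∈ Set.Icc (P.φ1 j) (P.φ1 j + P.δ)} ≤
      ENNReal.ofReal (P.ψ1 j - P.ψ0 j - P.δ) := by
  have hg := P.one_lt_norm_g j
  have hg0 : P.g j ≠ 0 := by intro h; rw [h] at hg; simp at hg; linarith
  have he : ‖P.g j / (‖P.g j‖ : ℂ)‖ = 1 := by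
    rw [norm_div, Complex.norm_real, norm_norm]; field_simp
  have h := (P.hW.rot he).wedge_area hg (P.φ1_spec j).1 (φ2 := P.φ1 j + P.δ) (by linarith [P.δ_pos])
    (P.φ2_lt j) (by rw [(P.φ1_cs j).1]; exact P.one_lt j) (by rw [(P.φ2_cs j).1]; exact P.one_lt _)
  rw [(P.φ1_cs j).2, (P.φ2_cs j).2] at h
  have e : P.φ1 j + P.δ - P.φ1 j = P.δ := by ring
  rw [e] at h
  refine ⟨h.1, le_trans (measure_mono ?_) h.2⟩
  rintro z ⟨h1, h2⟩
  have hgr : (0:ℝ) < ‖P.g j‖ := by linarith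
  have hgc : (‖P.g j‖ : ℂ) ≠ 0 := Complex.ofReal_ne_zero.2 hgr.ne'
  have e1 : (‖P.g j‖ : ℂ) * (P.g j / (‖P.g j‖ : ℂ) * P.W z) = P.g j * P.W z := by
    field_simp
  constructor
  · rw [TT_mul he, ← Complex.re_ofReal_mul, e1]
    unfold L at h1; linarith
  · rw [← Complex.arg_real_mul _ hgr, e1]
    exact h2

lemma arg_wedge (j : ℤ) {r φ : ℝ} (hr : 0 < r) (hφ : φ ∈ Set.Ico 0 P.δ) :
    Complex.arg (P.g j * (r * (Complex.exp ((φ : ℂ) * Complex.I) * P.ee j))) = P.φ1 j + φ := by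
  have h := P.φ1_spec j
  have hg := P.one_lt_norm_g j
  have h2 := P.φ2_lt j
  have hp := Real.pi_pos
  have e : P.g j * (r * (Complex.exp ((φ : ℂ) * Complex.I) * P.ee j)) =
      ((r * ‖P.g j‖ : ℝ) : ℂ) * Complex.exp (((P.φ1 j + φ : ℝ) : ℂ) * Complex.I) := by
    have e1 : P.g j * (r * (Complex.exp ((φ : ℂ) * Complex.I) * P.ee j)) =
      r * Complex.exp ((φ : ℂ) * Complex.I) * (P.g j * P.ee j) := by ring
    rw [e1, h.2.2]
    push_cast
    rw [add_mul, Complex.exp_add]; ring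
  rw [e, Complex.arg_real_mul _ (by positivity), Complex.arg_exp_mul_I,
    toIocMod_eq_self]
  exact ⟨by linarith [hφ.1], by linarith [hφ.2]⟩

lemma nu_zero : nu {0} = 0 := by
  unfold nu
  exact withDensity_absolutelyContinuous _ _ (by simp)

lemma ofReal_sum_le {ι : Type*} (s : Finset ι) (f : ι → ℝ) :
    ENNReal.ofReal (∑ i ∈ s, f i) ≤ ∑ i ∈ s, ENNReal.ofReal (f i) := by
  classical
  induction s using Finset.induction_on with
  | empty => simp
  | insert a s ha ih =>
    rw [Finset.sum_insert ha, Finset.sum_insert ha]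
    exact ENNReal.ofReal_add_le.trans (add_le_add le_rfl ih)

lemma KN_area : hypAreaMeasure P.KN ≤
    ENNReal.ofReal (∑ j ∈ Finset.range P.N, (P.ψ1 j - P.ψ0 j) - 2 * π) := by
  set Wd : ℕ → Set ℍ := fun j => {z | P.L j (P.W z) ≤ 0 ∧
    Complex.arg (P.g j * P.W z) ∈ Set.Icc (P.φ1 j) (P.φ1 j + P.δ)}
  have hsub : P.KN ⊆ {z | P.W z ∈ ({0} : Set ℂ)} ∪ ⋃ j ∈ Finset.range P.N, Wd j := by
    intro z hz
    by_cases h0 : P.W z = 0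
    · left; exact h0
    · right
      obtain ⟨k, hk, φ, hφ, hw⟩ := P.exists_wedge (P.W z) h0
      simp only [Set.mem_iUnion, Finset.mem_range]
      refine ⟨k, hk, hz k, ?_⟩
      have h := P.arg_wedge k (norm_pos_iff.2 h0) hφ
      rw [← hw] at h
      rw [h]
      exact ⟨by linarith [hφ.1], by linarith [hφ.2]⟩
  have e : ∑ j ∈ Finset.range P.N, (P.ψ1 j - P.ψ0 j) - 2 * π =
      ∑ j ∈ Finset.range P.N, (P.ψ1 j - P.ψ0 j - P.δ) := by
    rw [Finset.sum_sub_distrib (fun j : ℕ => P.ψ1 j - P.ψ0 j), Finset.sum_const, Finset.card_range, nsmul_eq_mul, P.N_δ]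
  rw [e, ENNReal.ofReal_sum_of_nonneg fun (j : ℕ) _ => (P.wedge_bound j).1]
  calc hypAreaMeasure P.KN ≤ _ := measure_mono hsub
    _ ≤ _ := measure_union_le _ _
    _ ≤ 0 + ∑ j ∈ Finset.range P.N, hypAreaMeasure (Wd j) := by
      refine add_le_add (le_of_eq ?_) (measure_biUnion_finset_le _ _)
      rw [P.hW.nu_apply (measurableSet_singleton 0), nu_zero]
    _ ≤ _ := by
      rw [zero_add]
      exact Finset.sum_le_sum fun j _ => (P.wedge_bound j).2

lemma L_cont (j : ℤ) : Continuous (P.L j) := by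
  unfold L
  exact (Complex.continuous_re.comp (by fun_prop)).sub TT_cont

lemma KN_closed : IsClosed P.KN := by
  have : P.KN = ⋂ j, {z | P.L j (P.W z) ≤ 0} := by ext; simp [KN]
  rw [this]
  exact isClosed_iInter fun j => isClosed_le ((P.L_cont j).comp P.hW.cont) continuous_const

lemma R_meas (t : ℝ) (j : ℤ) : MeasurableSet (P.R t j) := by
  have h := (fermiInv_cont.comp (P.SW_frame j).cont).measurable
  exact (h.fst measurableSet_Ioo).inter (h.snd measurableSet_Ioo)

lemma S_meas (t : ℝ) (j : ℤ) : MeasurableSet (P.S t j) := by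
  have h := (P.VW_frame j).cont.measurable
  have h1 : MeasurableSet {z : ℍ | 0 < ‖P.VW j z‖} := measurableSet_lt measurable_const h.norm
  have h2 : MeasurableSet {z : ℍ | ‖P.VW j z‖ ≤ Real.sinh t} := measurableSet_le h.norm measurable_const
  have h3 : MeasurableSet {z : ℍ | Complex.arg (P.VW j z) ∈ Set.Ioo (-P.ψ1 (j - 1)) (-P.ψ0 j)} :=
    (Complex.measurable_arg.comp h) measurableSet_Ioo
  exact h1.inter (h2.inter h3)

lemma R_area (t : ℝ) (j : ℤ) : hypAreaMeasure (P.R t j) =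
    ENNReal.ofReal (dist (P.p j) (P.p (j + 1))) * ENNReal.ofReal (Real.sinh t) := by
  rw [← pos_sub]
  exact (P.SW_frame j).rect_area _ _ _

lemma S_area {t : ℝ} (ht : 0 ≤ t) (j : ℤ) :
    ENNReal.ofReal ((P.ψ1 (j - 1) - P.ψ0 j) * (Real.cosh t - 1)) ≤ hypAreaMeasure (P.S t j) := by
  have hp := Real.pi_pos
  have h := (P.VW_frame j).sector_area ht (χ1 := -P.ψ1 (j - 1)) (χ2 := -P.ψ0 j)
    (by have : P.ψ1 (j - 1) ≤ π / 2 := Real.arcsin_le_pi_div_two _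
        linarith)
    (by have : -(π / 2) ≤ P.ψ0 j := Real.neg_pi_div_two_le_arcsin _
        linarith)
  have e : -P.ψ0 j - -P.ψ1 (j - 1) = P.ψ1 (j - 1) - P.ψ0 j := by ring
  rw [e] at h
  exact h

lemma sqrt_le_cosh {s t : ℝ} (h : s ^ 2 ≤ Real.sinh t ^ 2) : √(1 + s ^ 2) ≤ Real.cosh t := by
  rw [Real.sqrt_le_left (Real.cosh_pos t).le]
  have := Real.cosh_sq t
  linarith

lemma dist_le_of_cosh {x y : ℍ} {t : ℝ} (ht : 0 ≤ t) (h : Real.cosh (dist x y) ≤ Real.cosh t) :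
    dist x y ≤ t := by
  rw [Real.cosh_le_cosh, abs_of_nonneg dist_nonneg, abs_of_nonneg ht] at h
  exact h

lemma R_near {t : ℝ} (ht : 0 ≤ t) {j : ℤ} {z : ℍ} (hz : z ∈ P.R t j) :
    ∃ x ∈ P.side j, dist z x ≤ t := by
  obtain ⟨q, hq0, hq1⟩ := P.R_foot_pt hz
  have hzp : P.pos j z ∈ Set.Ioo (P.pos j (P.p j)) (P.pos j (P.p (j + 1))) := hz.1
  rw [← hq1] at hzp
  refine ⟨q, ⟨hq0, hzp.1.le, hzp.2.le⟩, dist_le_of_cosh ht ?_⟩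
  rw [(P.SW_frame j).cosh_axis hq0]
  have : (fermiInv (P.SW j z)).1 - (fermiInv (P.SW j q)).1 = 0 := by
    have : P.pos j z - P.pos j q = 0 := by rw [hq1]; ring
    exact this
  rw [this, Real.cosh_zero, mul_one]
  refine sqrt_le_cosh ?_
  have h1 : -Real.sinh t < (P.SW j z).im := hz.2.1
  have h2 : (P.SW j z).im < 0 := hz.2.2
  nlinarith

lemma S_near {t : ℝ} (ht : 0 ≤ t) {j : ℤ} {z : ℍ} (hz : z ∈ P.S t j) : dist z (P.p j) ≤ t := by
  apply dist_le_of_cosh ht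
  rw [(P.VW_frame j).dist_eq, VW_p, mink]
  have h4 : TT 0 = 1 := by simp [TT]
  rw [h4]
  simp only [Complex.zero_re, Complex.zero_im, mul_zero, add_zero, mul_one, sub_zero]
  have h1 := hz.2.1
  have : TT (P.VW j z) = √(1 + ‖P.VW j z‖ ^ 2) := by
    rw [TT, Complex.sq_norm, Complex.normSq_apply]
    congr 1; ring
  rw [this]
  exact sqrt_le_cosh (pow_le_pow_left₀ (norm_nonneg _) h1 2)

lemma SW_per (j : ℤ) : P.SW (j + P.N) = P.SW j := by
  funext z; unfold SW; rw [g_per]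

lemma pos_per (j : ℤ) : P.pos (j + P.N) = P.pos j := by
  funext z; unfold pos; rw [SW_per]

lemma side_per (j : ℤ) : P.side (j + P.N) = P.side j := by
  unfold side
  rw [SW_per, pos_per, p_per, show j + (P.N : ℤ) + 1 = (j + 1) + P.N by ring, p_per]

lemma to_range (j : ℤ) : ∃ (k : ℕ) (n : ℤ), k < P.N ∧ j = k + n * P.N := by
  have hN : (0:ℤ) < P.N := by exact_mod_cast P.N_pos'
  obtain ⟨k, hk⟩ := Int.eq_ofNat_of_zero_le (Int.emod_nonneg j hN.ne')
  have hk2 := Int.emod_lt_of_pos j hN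
  have hk3 := Int.emod_add_mul_ediv j P.N
  refine ⟨k, j / P.N, by omega, ?_⟩
  rw [← hk]; linarith

lemma descent {t : ℝ} {z : ℍ} (hC : ∃ j, t < dist z (P.p j)) (hE : ∃ j, ∃ x ∈ P.side j, dist z x ≤ t) :
    ∃ j : ℕ, j < P.N ∧ (∃ x ∈ P.side j, dist z x ≤ t) ∧ ¬ dist z (P.p j) ≤ t := by
  obtain ⟨k, hk⟩ := hC
  obtain ⟨j0, hj0⟩ := hE
  by_contra hc
  push Not at hc
  have hc' : ∀ j : ℤ, (∃ x ∈ P.side j, dist z x ≤ t) → dist z (P.p j) ≤ t := by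
    intro j hj
    obtain ⟨i, n, hi, rfl⟩ := P.to_range j
    rw [P.per_mul P.side_per] at hj
    rw [P.per_mul P.p_per]
    exact hc i hi hj
  have hall : ∀ n : ℕ, ∃ x ∈ P.side (j0 - n), dist z x ≤ t := by
    intro n
    induction n with
    | zero => simpa using hj0
    | succ n ih =>
      refine ⟨P.p (j0 - n), ?_, hc' _ ih⟩
      have := P.p_succ_mem_side (j0 - (n + 1 : ℕ))
      convert this using 2
      push_cast; ring
  have hN := P.N_pos'
  have h1 : 0 ≤ j0 - (k + (-|k - j0|) * P.N) := by
    have h2 : |k - j0| * 1 ≤ |k - j0| * (P.N : ℤ) :=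
      mul_le_mul_of_nonneg_left (by omega) (abs_nonneg _)
    have := le_abs_self (k - j0)
    linarith
  obtain ⟨n, hn⟩ := Int.eq_ofNat_of_zero_le h1
  have h3 := hc' _ (hall n)
  have h4 : j0 - (n : ℤ) = k + (-|k - j0|) * P.N := by linarith
  rw [h4, P.per_mul P.p_per] at h3
  linarith

lemma ang_mem {j : ℕ} (hj : j < P.N) {φ : ℝ} (h0 : P.δ * j ≤ φ) (h1 : φ < P.δ * (j + 1)) :
    φ ∈ Set.Ico 0 (2 * π) := by
  have hδ := P.δ_pos
  have h2 : ((j : ℝ) + 1) ≤ P.N := by exact_mod_cast hj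
  have := P.N_δ
  constructor
  · have : 0 ≤ P.δ * (j : ℝ) := by positivity
    linarith
  · nlinarith

lemma R_disj {t : ℝ} {i j : ℕ} (hi : i < P.N) (hj : j < P.N) (hij : i ≠ j) :
    Disjoint (P.R t i) (P.R t j) := by
  rw [Set.disjoint_left]
  intro z h1 h2
  obtain ⟨φ, hφ, hf⟩ := P.R_foot h1
  obtain ⟨φ', hφ', hf'⟩ := P.R_foot h2
  have := hf.unique hf' (P.ang_mem hi (by exact_mod_cast hφ.1.le) (by exact_mod_cast hφ.2))
    (P.ang_mem hj (by exact_mod_cast hφ'.1.le) (by exact_mod_cast hφ'.2))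
  subst this
  have hδ := P.δ_pos
  have a1 : (i : ℝ) < j + 1 := by
    have := hφ.1.trans hφ'.2
    push_cast at this
    exact lt_of_mul_lt_mul_left this hδ.le
  have a2 : (j : ℝ) < i + 1 := by
    have := hφ'.1.trans hφ.2
    push_cast at this
    exact lt_of_mul_lt_mul_left this hδ.le
  have a1' : i < j + 1 := by exact_mod_cast a1
  have a2' : j < i + 1 := by exact_mod_cast a2
  omega

lemma S_disj {t : ℝ} {i j : ℕ} (hi : i < P.N) (hj : j < P.N) (hij : i ≠ j) :
    Disjoint (P.S t i) (P.S t j) := by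
  rw [Set.disjoint_left]
  intro z h1 h2
  have hδ := P.δ_pos
  have := (P.S_foot h1).unique (P.S_foot h2) (P.ang_mem hi (by push_cast; rfl) (by push_cast; nlinarith))
    (P.ang_mem hj (by push_cast; rfl) (by push_cast; nlinarith))
  have h3 := mul_left_cancel₀ hδ.ne' this
  exact hij (by exact_mod_cast h3)

lemma RS_disj {t : ℝ} {i j : ℕ} (hi : i < P.N) (hj : j < P.N) :
    Disjoint (P.R t i) (P.S t j) := by
  rw [Set.disjoint_left]
  intro z h1 h2
  have hδ := P.δ_pos
  obtain ⟨φ, hφ, hf⟩ := P.R_foot h1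
  have := hf.unique (P.S_foot h2) (P.ang_mem hi (by exact_mod_cast hφ.1.le) (by exact_mod_cast hφ.2))
    (P.ang_mem hj (by push_cast; rfl) (by push_cast; nlinarith))
  subst this
  have a1 := lt_of_mul_lt_mul_left hφ.1 hδ.le
  have a2 := lt_of_mul_lt_mul_left hφ.2 hδ.le
  push_cast at a1 a2
  have a1' : i < j := by exact_mod_cast a1
  have a2' : j < i + 1 := by exact_mod_cast a2
  omega

/-- length of the polygon -/
def len : ℝ := ∑ j ∈ Finset.range P.N, dist (P.p j) (P.p ((j : ℤ) + 1))

/-- The key inequality for polygons. -/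
theorem core {t Bd : ℝ} (ht : 0 ≤ t) (hBd : 0 ≤ Bd) (hC : ∀ c, ∃ j, t < dist c (P.p j)) (Bad : Set ℍ)
    (hB : ∀ c ∈ P.KN, (∀ j, ∀ x ∈ P.side j, t < dist c x) → c ∈ Bad)
    (hBa : hypAreaMeasure Bad ≤ ENNReal.ofReal Bd) :
    (2 * π + (hypAreaMeasure P.KN).toReal) * Real.cosh t - 2 * π - Bd ≤ P.len * Real.sinh t := by
  have hsh : 0 ≤ Real.sinh t := Real.sinh_nonneg_iff.2 ht
  have hch : 0 ≤ Real.cosh t - 1 := by linarith [Real.one_le_cosh t]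
  set rg := Finset.range P.N
  set UR := ⋃ j ∈ rg, P.R t (j : ℕ)
  set US := ⋃ j ∈ rg, P.S t (j : ℕ)
  have hURm : MeasurableSet UR := Finset.measurableSet_biUnion _ fun j _ => P.R_meas t j
  have hUSm : MeasurableSet US := Finset.measurableSet_biUnion _ fun j _ => P.S_meas t j
  have hUR : hypAreaMeasure UR = ENNReal.ofReal (P.len * Real.sinh t) := by
    rw [measure_biUnion_finset (fun i hi j hj hij => P.R_disj (Finset.mem_range.1 hi)
      (Finset.mem_range.1 hj) hij) fun j _ => P.R_meas t j, len, Finset.sum_mul,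
      ENNReal.ofReal_sum_of_nonneg fun j _ => mul_nonneg dist_nonneg hsh]
    refine Finset.sum_congr rfl fun j _ => ?_
    rw [R_area, ENNReal.ofReal_mul dist_nonneg]
  have hUS : ENNReal.ofReal ((∑ j ∈ rg, (P.ψ1 j - P.ψ0 j)) * (Real.cosh t - 1)) ≤ hypAreaMeasure US := by
    rw [measure_biUnion_finset (fun i hi j hj hij => P.S_disj (Finset.mem_range.1 hi)
      (Finset.mem_range.1 hj) hij) fun j _ => P.S_meas t j, Finset.sum_sub_distrib,
      ← sum_range_shift P.N P.ψ1 P.ψ1_per, ← Finset.sum_sub_distrib, Finset.sum_mul]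
    exact (ofReal_sum_le _ _).trans (Finset.sum_le_sum fun j _ => P.S_area ht j)
  set U := (P.KN \ Bad) ∪ (UR ∪ US)
  have hU : hypAreaMeasure U = hypAreaMeasure (P.KN \ Bad) + (hypAreaMeasure UR + hypAreaMeasure US) := by
    rw [measure_union _ (hURm.union hUSm), measure_union _ hUSm]
    · simp only [UR, US, Set.disjoint_iUnion_left, Set.disjoint_iUnion_right]
      intro i hi j hj
      exact P.RS_disj (Finset.mem_range.1 hj) (Finset.mem_range.1 hi)
    · rw [Set.disjoint_left]
      rintro z ⟨hz, -⟩ (h | h)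
      · simp only [UR, Set.mem_iUnion] at h
        obtain ⟨j, -, h⟩ := h
        exact P.R_disj_KN h hz
      · simp only [US, Set.mem_iUnion] at h
        obtain ⟨j, -, h⟩ := h
        exact P.S_disj_KN h hz
  set Nb : ℕ → Set ℍ := fun j => {c | (∃ x ∈ P.side j, dist c x ≤ t) ∧ ¬ dist c (P.p j) ≤ t}
  have hsub : U ⊆ ⋃ j ∈ rg, Nb j := by
    intro z hz
    have hE : ∃ j, ∃ x ∈ P.side j, dist z x ≤ t := by
      rcases hz with ⟨hz, hzB⟩ | hz | hz
      · by_contra hc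
        push Not at hc
        exact hzB (hB z hz hc)
      · simp only [UR, Set.mem_iUnion] at hz
        obtain ⟨j, -, h⟩ := hz
        exact ⟨j, P.R_near ht h⟩
      · simp only [US, Set.mem_iUnion] at hz
        obtain ⟨j, -, h⟩ := hz
        exact ⟨j, P.p j, P.p_mem_side j, P.S_near ht h⟩
    obtain ⟨j, hj, h⟩ := P.descent (hC z) hE
    simp only [Set.mem_iUnion]
    exact ⟨j, Finset.mem_range.2 hj, h⟩
  have hUle : hypAreaMeasure U ≤ ENNReal.ofReal (2 * P.len * Real.sinh t) := by
    refine (measure_mono hsub).trans ((measure_biUnion_finset_le _ _).trans ?_)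
    have : 2 * P.len * Real.sinh t = ∑ j ∈ rg, 2 * dist (P.p j) (P.p ((j : ℤ) + 1)) * Real.sinh t := by
      rw [len, Finset.mul_sum, Finset.sum_mul]
    rw [this, ENNReal.ofReal_sum_of_nonneg fun j _ => by positivity]
    refine Finset.sum_le_sum fun j _ => ?_
    rw [← pos_sub]
    exact (P.SW_frame j).nbhd_area (P.pos_lt j).le ht (P.SW_p_im j) rfl (P.side j) fun x hx => hx
  have hKA := P.KN_area
  set ε := ∑ j ∈ rg, (P.ψ1 j - P.ψ0 j) with hε
  set m := (hypAreaMeasure P.KN).toReal with hm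
  have hfin : hypAreaMeasure P.KN ≠ ⊤ := ne_top_of_le_ne_top ENNReal.ofReal_ne_top hKA
  have hε0 : 0 ≤ ε - 2 * π := by
    have e : ε - 2 * π = ∑ j ∈ rg, (P.ψ1 j - P.ψ0 j - P.δ) := by
      rw [Finset.sum_sub_distrib (fun j : ℕ => P.ψ1 j - P.ψ0 j), Finset.sum_const, Finset.card_range, nsmul_eq_mul, P.N_δ]
    rw [e]
    exact Finset.sum_nonneg fun j _ => (P.wedge_bound j).1
  have hmε : m ≤ ε - 2 * π := ENNReal.toReal_le_of_le_ofReal hε0 hKA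
  have hm0 : 0 ≤ m := ENNReal.toReal_nonneg
  have hlen : 0 ≤ P.len := Finset.sum_nonneg fun j _ => dist_nonneg
  have hpi := Real.pi_pos
  have h1 : hypAreaMeasure P.KN ≤ hypAreaMeasure (P.KN \ Bad) + ENNReal.ofReal Bd := by
    refine (measure_le_inter_add_sdiff _ _ Bad).trans ?_
    rw [add_comm]
    exact add_le_add le_rfl ((measure_mono Set.inter_subset_right).trans hBa)
  have h2 : ENNReal.ofReal m + (ENNReal.ofReal (P.len * Real.sinh t) +
      ENNReal.ofReal (ε * (Real.cosh t - 1))) ≤ ENNReal.ofReal (2 * P.len * Real.sinh t) + ENNReal.ofReal Bd := by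
    rw [hm, ENNReal.ofReal_toReal hfin]
    calc _ ≤ (hypAreaMeasure (P.KN \ Bad) + ENNReal.ofReal Bd) + (hypAreaMeasure UR + hypAreaMeasure US) :=
          add_le_add h1 (add_le_add hUR.ge hUS)
      _ = hypAreaMeasure U + ENNReal.ofReal Bd := by rw [hU]; ring
      _ ≤ _ := add_le_add hUle le_rfl
  rw [← ENNReal.ofReal_add (by positivity) (mul_nonneg (by linarith) hch),
    ← ENNReal.ofReal_add hm0 (add_nonneg (by positivity) (mul_nonneg (by linarith) hch)),
    ← ENNReal.ofReal_add (by positivity) hBd,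
    ENNReal.ofReal_le_ofReal_iff (by positivity)] at h2
  nlinarith

end GPoly

end

noncomputable section

lemma norm_sq_TT (w : ℂ) : ‖w‖ ^ 2 = TT w ^ 2 - 1 := by
  rw [TT_sq, Complex.sq_norm, Complex.normSq_apply]; ring

lemma norm_lt_TT (w : ℂ) : ‖w‖ < TT w := by
  have := norm_sq_TT w
  have := TT_pos w
  nlinarith [norm_nonneg w]

lemma cosh_ge (x : ℝ) : 1 + x ^ 2 / 2 ≤ Real.cosh x := by
  have h1 : Real.cosh x = 1 + 2 * Real.sinh (x / 2) ^ 2 := by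
    have := Real.cosh_two_mul (x / 2)
    rw [mul_div_cancel₀ x two_ne_zero] at this
    rw [this, Real.cosh_sq]; ring
  have h3 : (x / 2) ^ 2 ≤ Real.sinh (x / 2) ^ 2 := by
    rcases le_total 0 (x / 2) with h | h
    · have := Real.self_le_sinh_iff.2 h
      nlinarith
    · have := Real.sinh_le_self_iff.2 h
      nlinarith
  rw [h1]; nlinarith

lemma mink_le (v w : ℂ) : mink v w - 1 ≤ ‖v - w‖ ^ 2 / 2 := by
  rw [Complex.sq_norm, Complex.normSq_apply, Complex.sub_re, Complex.sub_im, mink]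
  nlinarith [TT_sq v, TT_sq w, sq_nonneg (TT v - TT w)]

lemma IsFrame.dist_le {W : ℍ → ℂ} (hW : IsFrame W) (x y : ℍ) : dist x y ≤ ‖W x - W y‖ := by
  have h1 := cosh_ge (dist x y)
  rw [hW.dist_eq] at h1
  have h2 := mink_le (W x) (W y)
  exact abs_le_of_sq_le_sq (by linarith) (norm_nonneg _) |>.trans' (le_abs_self _)

/-- inverse of a frame -/
def IsFrame.inv {W : ℍ → ℂ} (hW : IsFrame W) : ℂ → ℍ := Function.surjInv hW.surj

lemma IsFrame.W_inv {W : ℍ → ℂ} (hW : IsFrame W) (w : ℂ) : W (hW.inv w) = w := Function.surjInv_eq _ _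

lemma IsFrame.inv_W {W : ℍ → ℂ} (hW : IsFrame W) (z : ℍ) : hW.inv (W z) = z := hW.inj (hW.W_inv _)

lemma IsFrame.inv_lip {W : ℍ → ℂ} (hW : IsFrame W) : LipschitzWith 1 hW.inv := by
  refine LipschitzWith.of_dist_le_mul fun x y => ?_
  have := hW.dist_le (hW.inv x) (hW.inv y)
  rw [hW.W_inv, hW.W_inv] at this
  simpa [dist_eq_norm] using this

lemma IsFrame.dist_add {W : ℍ → ℂ} (hW : IsFrame W) {x y z : ℍ} {α β : ℝ} (ha : 0 ≤ α) (hb : 0 ≤ β)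
    (h1 : W z = α * W x + β * W y) (h2 : TT (W z) = α * TT (W x) + β * TT (W y)) :
    dist x z + dist z y = dist x y := by
  have e1 : (W z).re = α * (W x).re + β * (W y).re := by
    rw [h1, Complex.add_re, Complex.re_ofReal_mul, Complex.re_ofReal_mul]
  have e2 : (W z).im = α * (W x).im + β * (W y).im := by
    rw [h1, Complex.add_im, Complex.im_ofReal_mul, Complex.im_ofReal_mul]
  have hxy := hW.dist_eq x y
  have hxz := hW.dist_eq x z
  have hzy := hW.dist_eq z y
  have hx := mink_self (W x)
  have hy := mink_self (W y)
  have hz := mink_self (W z)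
  set d := dist x y
  have k1 : Real.cosh (dist x z) = α + β * Real.cosh d := by
    rw [hxz, hxy]
    simp only [mink, h2, e1, e2] at *
    linear_combination α * hx
  have k2 : Real.cosh (dist z y) = α * Real.cosh d + β := by
    rw [hzy, hxy]
    simp only [mink, h2, e1, e2] at *
    linear_combination β * hy
  have k3 : α ^ 2 + β ^ 2 + 2 * α * β * Real.cosh d = 1 := by
    rw [hxy]
    simp only [mink, h2, e1, e2] at *
    linear_combination hz - α ^ 2 * hx - β ^ 2 * hy
  have hd : 0 ≤ Real.sinh d := Real.sinh_nonneg_iff.2 dist_nonneg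
  have hcs := Real.cosh_sq d
  have s1 : Real.sinh (dist x z) = β * Real.sinh d := by
    refine (sq_eq_sq₀ (Real.sinh_nonneg_iff.2 dist_nonneg) (by positivity)).1 ?_
    have := Real.cosh_sq (dist x z)
    rw [k1] at this
    linear_combination -this + k3 + β ^ 2 * hcs
  have s2 : Real.sinh (dist z y) = α * Real.sinh d := by
    refine (sq_eq_sq₀ (Real.sinh_nonneg_iff.2 dist_nonneg) (by positivity)).1 ?_
    have := Real.cosh_sq (dist z y)
    rw [k2] at this
    linear_combination -this + k3 + α ^ 2 * hcs
  have k4 : Real.cosh (dist x z + dist z y) = Real.cosh d := by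
    rw [Real.cosh_add, k1, k2, s1, s2]
    linear_combination Real.cosh d * k3 - α * β * hcs
  have h5 : |dist x z + dist z y| = |d| :=
    le_antisymm (Real.cosh_le_cosh.1 k4.le) (Real.cosh_le_cosh.1 k4.ge)
  rwa [abs_of_nonneg (by positivity), abs_of_nonneg dist_nonneg] at h5

/-- Klein coordinate -/
def kl (w : ℂ) : ℂ := (TT w)⁻¹ • w

/-- inverse of the Klein coordinate -/
def lk (k : ℂ) : ℂ := (√(1 - ‖k‖ ^ 2))⁻¹ • k

lemma norm_kl (w : ℂ) : ‖kl w‖ = ‖w‖ / TT w := by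
  rw [kl, norm_smul, norm_inv, Real.norm_of_nonneg (TT_pos w).le]; ring

lemma norm_kl_lt (w : ℂ) : ‖kl w‖ < 1 := by
  rw [norm_kl, div_lt_one (TT_pos w)]; exact norm_lt_TT w

lemma one_sub_kl (w : ℂ) : √(1 - ‖kl w‖ ^ 2) = (TT w)⁻¹ := by
  have h := TT_pos w
  rw [norm_kl, div_pow, norm_sq_TT, show 1 - (TT w ^ 2 - 1) / TT w ^ 2 = ((TT w)⁻¹) ^ 2 by field_simp; ring,
    Real.sqrt_sq (by positivity)]

lemma lk_kl (w : ℂ) : lk (kl w) = w := by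
  have h := TT_pos w
  rw [lk, one_sub_kl, inv_inv, kl, smul_smul, mul_inv_cancel₀ h.ne', one_smul]

lemma TT_lk {k : ℂ} (hk : ‖k‖ < 1) : TT (lk k) = (√(1 - ‖k‖ ^ 2))⁻¹ := by
  have h1 : 0 < 1 - ‖k‖ ^ 2 := by nlinarith [norm_nonneg k]
  have hs : 0 < √(1 - ‖k‖ ^ 2) := Real.sqrt_pos.2 h1
  have h2 := norm_sq_TT (lk k)
  rw [lk, norm_smul, Real.norm_of_nonneg (by positivity), mul_pow, inv_pow, Real.sq_sqrt h1.le] at h2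
  refine (sq_eq_sq₀ (TT_pos _).le (by positivity)).1 ?_
  rw [inv_pow, Real.sq_sqrt h1.le, lk]
  have : (1 - ‖k‖ ^ 2)⁻¹ * ‖k‖ ^ 2 = (1 - ‖k‖ ^ 2)⁻¹ - 1 := by field_simp; ring
  linarith

lemma kl_lk {k : ℂ} (hk : ‖k‖ < 1) : kl (lk k) = k := by
  have h1 : 0 < 1 - ‖k‖ ^ 2 := by nlinarith [norm_nonneg k]
  have hs : 0 < √(1 - ‖k‖ ^ 2) := Real.sqrt_pos.2 h1
  rw [kl, TT_lk hk, inv_inv, lk, smul_smul, mul_inv_cancel₀ hs.ne', one_smul]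

lemma kl_cont : Continuous kl := by
  unfold kl
  exact (TT_cont.inv₀ fun w => (TT_pos w).ne').smul continuous_id

lemma lk_diff : DifferentiableOn ℝ lk (ball 0 1) := by
  intro k hk
  rw [mem_ball_zero_iff] at hk
  have h1 : 0 < 1 - ‖k‖ ^ 2 := by nlinarith [norm_nonneg k]
  have hs : 0 < √(1 - ‖k‖ ^ 2) := Real.sqrt_pos.2 h1
  refine DifferentiableAt.differentiableWithinAt ?_
  unfold lk
  have h2 : DifferentiableAt ℝ (fun k : ℂ => 1 - ‖k‖ ^ 2) k :=
    (differentiableAt_const _).sub (differentiableAt_id.norm_sq ℝ)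
  exact ((h2.sqrt h1.ne').inv hs.ne').smul differentiableAt_id

/-- The gauge of a convex body in hyperboloid coordinates. -/
structure IsGauge (W : ℍ → ℂ) (K : Set ℍ) (G : ℂ → ℝ) : Prop where
  add_le : ∀ v w, G (v + w) ≤ G v + G w
  smul : ∀ (c : ℝ) v, 0 ≤ c → G (c * v) = c * G v
  nonneg : ∀ v, 0 ≤ G v
  mem : ∀ z, z ∈ K ↔ G (W z) ≤ TT (W z)
  mem_int : ∀ z, z ∈ interior K ↔ G (W z) < TT (W z)
  lip : ∃ M : NNReal, LipschitzWith M G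
  lt : ∀ w, w ≠ 0 → ‖w‖ < G w
  null : volume {w | G w = TT w} = 0

theorem exists_gauge {W : ℍ → ℂ} (hW : IsFrame W) {K : Set ℍ} (hKcomp : IsCompact K)
    (hKconv : HypConvex K) {o : ℍ} (ho : o ∈ interior K) (hWo : W o = 0) :
    ∃ G, IsGauge W K G := by
  set f : ℍ → ℂ := fun z => kl (W z)
  have hf : Continuous f := kl_cont.comp hW.cont
  have hfi : Function.Injective f := by
    intro x y h
    apply hW.inj
    rw [← lk_kl (W x), ← lk_kl (W y)]
    exact congrArg lk h
  set F : ℂ → ℍ := fun k => hW.inv (lk k)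
  have hF : ContinuousOn F (ball 0 1) := hW.inv_lip.continuous.comp_continuousOn lk_diff.continuousOn
  have hfF : ∀ k, ‖k‖ < 1 → f (F k) = k := by
    intro k hk
    show kl (W (hW.inv (lk k))) = k
    rw [hW.W_inv, kl_lk hk]
  have hFf : ∀ z, F (f z) = z := by
    intro z
    show hW.inv (lk (kl (W z))) = z
    rw [lk_kl, hW.inv_W]
  set C := f '' K with hC
  have hmem : ∀ z, f z ∈ C ↔ z ∈ K := fun z => hfi.mem_set_image
  have hCc : IsCompact C := hKcomp.image hf
  have hCb : ∀ k ∈ C, ‖k‖ < 1 := by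
    rintro _ ⟨z, -, rfl⟩
    exact norm_kl_lt _
  have hIntr : ∀ z, f z ∈ interior C ↔ z ∈ interior K := by
    intro z
    constructor
    · intro h
      have h1 : IsOpen (f ⁻¹' interior C) := isOpen_interior.preimage hf
      exact interior_maximal (fun x hx => (hmem x).1 (interior_subset hx)) h1 h
    · intro h
      have h1 := hF.isOpen_inter_preimage isOpen_ball (isOpen_interior (s := K))
      refine interior_maximal ?_ h1 ?_
      · rintro k ⟨hk, hk2⟩
        rw [mem_ball_zero_iff] at hk
        exact ⟨F k, interior_subset hk2, hfF k hk⟩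
      · refine ⟨mem_ball_zero_iff.2 (norm_kl_lt _), ?_⟩
        show F (f z) ∈ interior K
        rw [hFf]; exact h
  have hCconv : Convex ℝ C := by
    rintro _ ⟨x, hx, rfl⟩ _ ⟨y, hy, rfl⟩ a b ha hb hab
    set k := a • f x + b • f y with hk
    have hkn : ‖k‖ < 1 := by
      have := (convex_ball (0:ℂ) 1) (mem_ball_zero_iff.2 (norm_kl_lt (W x)))
        (mem_ball_zero_iff.2 (norm_kl_lt (W y))) ha hb hab
      exact mem_ball_zero_iff.1 this
    refine ⟨F k, ?_, hfF k hkn⟩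
    have hfk := hfF k hkn
    set z := F k
    have hTx := TT_pos (W x)
    have hTy := TT_pos (W y)
    have hTz := TT_pos (W z)
    refine hKconv x hx y hy z (hW.dist_add (α := TT (W z) * a / TT (W x)) (β := TT (W z) * b / TT (W y))
      (by positivity) (by positivity) ?_ ?_)
    · have e : W z = TT (W z) • f z := by
        show W z = TT (W z) • ((TT (W z))⁻¹ • W z)
        rw [smul_smul, mul_inv_cancel₀ hTz.ne', one_smul]
      rw [hfk, hk] at e
      refine e.trans ?_
      show TT (W z) • (a • ((TT (W x))⁻¹ • W x) + b • ((TT (W y))⁻¹ • W y)) = _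
      simp only [Complex.real_smul, Complex.ofReal_div, Complex.ofReal_mul, Complex.ofReal_inv]
      ring
    · field_simp
      linarith
  have hf0 : f o = 0 := by show kl (W o) = 0; rw [hWo, kl, smul_zero]
  have h0 : C ∈ nhds (0:ℂ) := by
    rw [← hf0]
    exact mem_interior_iff_mem_nhds.1 ((hIntr o).2 ho)
  have hab : Absorbent ℝ C := absorbent_nhds_zero h0
  have hcl : closure C = C := hCc.isClosed.closure_eq
  have hsm : ∀ (c : ℝ) v, 0 ≤ c → gauge C (c * v) = c * gauge C v := by
    intro c v hc
    rw [← Complex.real_smul, gauge_smul_of_nonneg hc, smul_eq_mul]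
  have hgf : ∀ z, gauge C (f z) = (TT (W z))⁻¹ * gauge C (W z) := by
    intro z
    rw [← hsm _ _ (inv_nonneg.2 (TT_pos _).le), ← Complex.real_smul]
    rfl
  refine ⟨gauge C, gauge_add_le hCconv hab, hsm, gauge_nonneg, ?_, ?_, hCconv.lipschitz_gauge h0, ?_, ?_⟩
  · intro z
    have h1 := gauge_le_one_iff_mem_closure hCconv h0 (x := f z)
    rw [hcl, hmem, hgf, inv_mul_le_one₀ (TT_pos _)] at h1
    exact h1.symm
  · intro z
    rw [← hIntr, ← gauge_lt_one_iff_mem_interior hCconv h0, hgf, inv_mul_lt_one₀ (TT_pos _)]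
  · intro w hw
    have hn : 0 < ‖w‖ := norm_pos_iff.2 hw
    have h1 : ¬ gauge C ((‖w‖⁻¹ : ℝ) * w) ≤ 1 := by
      rw [gauge_le_one_iff_mem_closure hCconv h0, hcl]
      intro h
      have := hCb _ h
      rw [norm_mul, Complex.norm_real, norm_inv, norm_norm, inv_mul_cancel₀ hn.ne'] at this
      exact lt_irrefl _ this
    rw [hsm _ _ (inv_nonneg.2 hn.le)] at h1
    push Not at h1
    rwa [lt_inv_mul_iff₀ hn, mul_one] at h1
  · have hfr := hCconv.addHaar_frontier (volume : Measure ℂ)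
    have hd : DifferentiableOn ℝ lk (frontier C) := lk_diff.mono fun k hk =>
      mem_ball_zero_iff.2 (hCb k (hCc.isClosed.frontier_subset hk))
    refine measure_mono_null ?_ (addHaar_image_eq_zero_of_differentiableOn_of_addHaar_eq_zero volume hd hfr)
    intro w hw
    have hw' : gauge C w = TT w := hw
    refine ⟨kl w, ?_, lk_kl w⟩
    have h1 : gauge C (kl w) = 1 := by
      have := hgf (hW.inv w)
      rw [hW.W_inv, hw', inv_mul_cancel₀ (TT_pos w).ne'] at this
      rw [← this]
      show _ = gauge C (kl (W (hW.inv w)))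
      rw [hW.W_inv]
    rw [frontier]
    exact ⟨(gauge_le_one_iff_mem_closure hCconv h0).1 h1.le, fun h =>
      ((gauge_lt_one_iff_mem_interior hCconv h0).2 h).ne h1⟩

end

noncomputable section

namespace GPoly

variable (P : GPoly)

lemma exists_comb (w : ℂ) : ∃ (k : ℕ) (φ a b : ℝ), k < P.N ∧ φ ∈ Set.Ico 0 P.δ ∧ 0 ≤ a ∧ 0 ≤ b ∧
    w = a * P.ee k + b * P.ee ((k : ℤ) + 1) ∧
    w = ‖w‖ * Complex.exp (((P.δ * k + φ : ℝ) : ℂ) * Complex.I) ∧ (a + b) * Real.cos (P.δ / 2) ≤ ‖w‖ := by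
  by_cases hw0 : w = 0
  · refine ⟨0, 0, 0, 0, P.N_pos', ⟨le_rfl, P.δ_pos⟩, le_rfl, le_rfl, ?_, ?_, ?_⟩ <;> simp [hw0]
  obtain ⟨k, hk, φ, hφ, hw⟩ := P.exists_wedge w hw0
  have hs := P.sin_pos
  have hδ := P.δ_pos
  have hδ2 := P.δ_lt
  have h1 : 0 ≤ Real.sin (P.δ - φ) :=
    Real.sin_nonneg_of_nonneg_of_le_pi (by linarith [hφ.2]) (by linarith [hφ.1])
  have h2 : 0 ≤ Real.sin φ := Real.sin_nonneg_of_nonneg_of_le_pi hφ.1 (by linarith [hφ.2])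
  refine ⟨k, φ, ‖w‖ * (Real.sin (P.δ - φ) / Real.sin P.δ), ‖w‖ * (Real.sin φ / Real.sin P.δ), hk, hφ,
    by positivity, by positivity, ?_, ?_, ?_⟩
  · have e : Complex.exp ((φ : ℂ) * Complex.I) = ((Real.sin (P.δ - φ) / Real.sin P.δ : ℝ) : ℂ) +
        ((Real.sin φ / Real.sin P.δ : ℝ) : ℂ) * (⟨Real.cos P.δ, Real.sin P.δ⟩ : ℂ) := by
      rw [cexp_eq]
      apply Complex.ext
      · rw [Complex.add_re, Complex.re_ofReal_mul, Complex.ofReal_re]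
        simp only
        rw [Real.sin_sub]; field_simp; ring
      · rw [Complex.add_im, Complex.im_ofReal_mul, Complex.ofReal_im]
        simp only
        field_simp; ring
    rw [ee_succ]
    refine hw.trans ?_
    rw [e, Complex.ofReal_mul, Complex.ofReal_mul]
    ring
  · refine hw.trans ?_
    rw [ee, ← Complex.exp_add, ← add_mul]
    push_cast
    rw [add_comm (φ : ℂ)]
  · set x := P.δ / 2 with hx
    have hδx : P.δ = 2 * x := by rw [hx]; ring
    have hsx : 0 < Real.sin x := Real.sin_pos_of_pos_of_lt_pi (by linarith) (by linarith)
    have hcx : 0 < Real.cos x := Real.cos_pos_of_mem_Ioo ⟨by linarith, by linarith⟩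
    have key : (Real.sin (P.δ - φ) / Real.sin P.δ + Real.sin φ / Real.sin P.δ) * Real.cos x =
        Real.cos (x - φ) := by
      rw [hδx, Real.sin_sub, Real.sin_two_mul, Real.cos_two_mul, Real.cos_sub]
      field_simp
      have := Real.sin_sq_add_cos_sq x
      linear_combination (-2 * Real.sin φ) * this
    rw [← mul_add, mul_assoc, key]
    nlinarith [Real.cos_le_one (x - φ), norm_nonneg w]

lemma L_wedge (k : ℤ) {w : ℂ} {a b : ℝ} (h : w = a * P.ee k + b * P.ee (k + 1)) :
    P.L k w = a * P.u k + b * P.u (k + 1) - TT w := by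
  rw [L]
  congr 1
  rw [h, mul_add, mul_left_comm, mul_left_comm (P.g k), g_ee, g_ee_succ, Complex.add_re,
    Complex.re_ofReal_mul, Complex.re_ofReal_mul]

lemma L_le_wedge (j k : ℤ) {w : ℂ} {a b : ℝ} (ha : 0 ≤ a) (hb : 0 ≤ b)
    (h : w = a * P.ee k + b * P.ee (k + 1)) : P.L j w ≤ P.L k w := by
  rw [P.L_wedge k h, L]
  have : (P.g j * w).re = a * (P.g j * P.ee k).re + b * (P.g j * P.ee (k + 1)).re := by
    rw [h, mul_add, mul_left_comm, mul_left_comm (P.g j), Complex.add_re,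
    Complex.re_ofReal_mul, Complex.re_ofReal_mul]
  rw [this]
  nlinarith [P.g_ee_re j k, P.g_ee_re j (k + 1)]

lemma frontier_side {z : ℍ} (hz : z ∈ frontier P.KN) : ∃ j, z ∈ P.side j := by
  have hzK : z ∈ P.KN := P.KN_closed.frontier_subset hz
  obtain ⟨k, φ, a, b, hk, -, ha, hb, hw, -, -⟩ := P.exists_comb (P.W z)
  have hLk : P.L k (P.W z) = 0 := by
    by_contra hne
    have hlt : ∀ j, P.L j (P.W z) < 0 := fun j =>
      (P.L_le_wedge j k ha hb hw).trans_lt (lt_of_le_of_ne (hzK k) hne)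
    have hopen : IsOpen (⋂ j ∈ Finset.range P.N, {y : ℍ | P.L (j : ℕ) (P.W y) < 0}) :=
      isOpen_biInter_finset fun j _ => isOpen_lt ((P.L_cont j).comp P.hW.cont) continuous_const
    have hsub : (⋂ j ∈ Finset.range P.N, {y : ℍ | P.L (j : ℕ) (P.W y) < 0}) ⊆ P.KN := by
      intro y hy j
      obtain ⟨i, n, hi, rfl⟩ := P.to_range j
      rw [P.per_mul (f := fun j => P.L j (P.W y)) (fun j => P.L_per j _)]
      simp only [Set.mem_iInter] at hy
      have : P.L (i : ℕ) (P.W y) < 0 := hy i (Finset.mem_range.2 hi)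
      exact this.le
    have hin : z ∈ interior P.KN := by
      refine interior_maximal hsub hopen ?_
      simp only [Set.mem_iInter]
      exact fun j _ => hlt j
    exact hz.2 hin
  have him : (P.SW k z).im = 0 := by rw [SW_im, hLk]; simp
  refine ⟨k, him, ?_⟩
  obtain ⟨a1, a2, a3⟩ := P.axis_spec (P.SW_p_im k)
  obtain ⟨b1, b2, b3⟩ := P.axis_spec (P.SW_p_succ_im k)
  obtain ⟨c1, c2, c3⟩ := P.axis_spec him
  have hlt := P.pos_lt k
  have s1 := P.sh_pos k
  have s2 := P.sh_pos (k + 1)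
  have hD := P.D_pos k
  have hg : 0 < ‖P.g k‖ := by have := P.one_lt_norm_g k; linarith
  have w1 : P.W z = ((a / P.sh k : ℝ) : ℂ) * P.W (P.p k) + ((b / P.sh (k + 1) : ℝ) : ℂ) * P.W (P.p (k + 1)) := by
    rw [W_p, W_p]
    have e1 : (P.sh k : ℂ) ≠ 0 := Complex.ofReal_ne_zero.2 s1.ne'
    have e2 : (P.sh (k + 1) : ℂ) ≠ 0 := Complex.ofReal_ne_zero.2 s2.ne'
    push_cast
    field_simp
    exact hw
  have w2 : TT (P.W z) = a / P.sh k * TT (P.W (P.p k)) + b / P.sh (k + 1) * TT (P.W (P.p (k + 1))) := by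
    rw [TT_p, TT_p, ch_eq, ch_eq]
    rw [P.L_wedge k hw] at hLk
    field_simp
    linarith
  have hα : 0 ≤ a / P.sh k := by positivity
  have hβ : 0 ≤ b / P.sh (k + 1) := by positivity
  set α := a / P.sh k
  set β := b / P.sh (k + 1)
  have w3 : (P.g k * P.W z).im = α * (P.g k * P.W (P.p k)).im + β * (P.g k * P.W (P.p (k + 1))).im := by
    conv_lhs => rw [w1]
    rw [mul_add, mul_left_comm, mul_left_comm (P.g k), Complex.add_im, Complex.im_ofReal_mul,
      Complex.im_ofReal_mul]
  set x := P.pos k (P.p k)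
  set y := P.pos k (P.p (k + 1))
  set s := P.pos k z
  have i1 : Real.sinh s = α * Real.sinh x + β * Real.sinh y := by
    rw [c1, a1, b1, w3]; ring
  have i2 : Real.cosh s = α * Real.cosh x + β * Real.cosh y := by
    rw [c2, a2, b2, w2]; ring
  have hS : 0 < Real.sinh (y - x) := Real.sinh_pos_iff.2 (by linarith)
  constructor
  · have : 0 ≤ Real.sinh (s - x) := by
      have e : Real.sinh (s - x) = β * Real.sinh (y - x) := by
        rw [Real.sinh_sub, Real.sinh_sub, i1, i2]; ring
      rw [e]; positivity
    linarith [Real.sinh_nonneg_iff.1 this]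
  · have : 0 ≤ Real.sinh (y - s) := by
      have e : Real.sinh (y - s) = α * Real.sinh (y - x) := by
        rw [Real.sinh_sub, Real.sinh_sub, i1, i2]; ring
      rw [e]; positivity
    linarith [Real.sinh_nonneg_iff.1 this]

end GPoly

/-- unit vector in the direction `φ` -/
def ce (φ : ℝ) : ℂ := Complex.exp ((φ : ℂ) * Complex.I)

lemma norm_ce (φ : ℝ) : ‖ce φ‖ = 1 := Complex.norm_exp_ofReal_mul_I _
lemma ce_ne (φ : ℝ) : ce φ ≠ 0 := Complex.exp_ne_zero _
lemma ce_eq (φ : ℝ) : ce φ = ⟨Real.cos φ, Real.sin φ⟩ := cexp_eq φ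

lemma ce_lip : LipschitzWith 1 ce := by
  refine LipschitzWith.of_dist_le_mul fun x y => ?_
  rw [dist_eq_norm, dist_eq_norm, NNReal.coe_one, one_mul]
  refine abs_le_of_sq_le_sq ?_ (norm_nonneg _) |>.trans' (le_abs_self _)
  rw [Complex.sq_norm, Complex.normSq_apply, ce_eq, ce_eq, Complex.sub_re, Complex.sub_im,
    Real.norm_eq_abs, sq_abs]
  have h1 := Real.one_sub_sq_div_two_le_cos (x := x - y)
  rw [Real.cos_sub] at h1
  nlinarith [Real.sin_sq_add_cos_sq x, Real.sin_sq_add_cos_sq y]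

lemma sin_cases {N : ℕ} (hN : 3 ≤ N) (m : ℤ) : ¬ (0 < Real.sin (2 * π / N * m) ∧
    Real.sin (2 * π / N * (m - 1)) < 0) := by
  rintro ⟨h1, h2⟩
  have hN0 : (0:ℤ) < N := by omega
  have hNr : (0:ℝ) < N := by exact_mod_cast hN0
  have hpi := Real.pi_pos
  obtain ⟨k, hk⟩ := Int.eq_ofNat_of_zero_le (Int.emod_nonneg m hN0.ne')
  have hk2 := Int.emod_lt_of_pos m hN0
  have hk3 := Int.emod_add_mul_ediv m N
  set q := m / (N : ℤ)
  have hm : m = k + N * q := by rw [← hk]; linarith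
  have e1 : 2 * π / N * (m : ℝ) = 2 * π / N * k + q * (2 * π) := by
    rw [hm]; push_cast; field_simp
  have e2 : 2 * π / N * ((m : ℝ) - 1) = 2 * π / N * (k - 1) + q * (2 * π) := by
    rw [hm]; push_cast; field_simp; ring
  rw [e1, Real.sin_add_int_mul_two_pi] at h1
  rw [e2, Real.sin_add_int_mul_two_pi] at h2
  have hkN : (k : ℝ) < N := by
    have : k < N := by omega
    exact_mod_cast this
  have hδ : 0 < 2 * π / N := by positivity
  have hNδ : 2 * π / N * N = 2 * π := by field_simp
  rcases Nat.eq_zero_or_pos k with h | h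
  · subst h; simp at h1
  · have hk1 : (1:ℝ) ≤ k := by exact_mod_cast h
    have h3 : π < 2 * π / N * (k - 1) := by
      by_contra hc
      push Not at hc
      have := Real.sin_nonneg_of_nonneg_of_le_pi (mul_nonneg hδ.le (by linarith)) hc
      linarith
    have h4 : 2 * π / N * k < 2 * π := by
      have := mul_lt_mul_of_pos_left hkN hδ
      rw [hNδ] at this
      exact this
    have h5 : Real.sin (2 * π / N * k) = Real.sin (2 * π / N * k - 2 * π) := by rw [Real.sin_sub_two_pi]
    have h6 := Real.sin_nonpos_of_nonpos_of_neg_pi_le (x := 2 * π / N * k - 2 * π) (by linarith)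
      (by nlinarith)
    linarith

namespace IsGauge

variable {W : ℍ → ℂ} {K : Set ℍ} {G : ℂ → ℝ}

lemma one_lt (hG : IsGauge W K G) (φ : ℝ) : 1 < G (ce φ) := by
  have := hG.lt (ce φ) (ce_ne φ)
  rwa [norm_ce] at this

lemma conv (hG : IsGauge W K G) {x y v : ℂ} {a b : ℝ} (h : v = a * x + b * y) (hab : ¬ (0 < a ∧ 0 < b)) :
    a * G x + b * G y ≤ G v := by
  have hx := hG.nonneg x
  have hy := hG.nonneg y
  rcases le_or_gt a 0 with ha | ha
  · rcases le_or_gt b 0 with hb | hb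
    · have := hG.nonneg v
      nlinarith
    · have e : (b : ℂ) * y = v + ((-a : ℝ) : ℂ) * x := by rw [h]; push_cast; ring
      have h1 := hG.add_le v (((-a : ℝ) : ℂ) * x)
      rw [← e, hG.smul _ _ hb.le, hG.smul _ _ (by linarith)] at h1
      linarith
  · have hb : b ≤ 0 := by
      by_contra hc
      push Not at hc
      exact hab ⟨ha, hc⟩
    have e : (a : ℂ) * x = v + ((-b : ℝ) : ℂ) * y := by rw [h]; push_cast; ring
    have h1 := hG.add_le v (((-b : ℝ) : ℂ) * y)
    rw [← e, hG.smul _ _ ha.le, hG.smul _ _ (by linarith)] at h1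
    linarith

/-- The inscribed polygon with `N` vertices. -/
def poly (hG : IsGauge W K G) (hW : IsFrame W) (N : ℕ) (hN : 3 ≤ N) : GPoly where
  W := W
  hW := hW
  N := N
  hN := hN
  u := fun j => G (ce (2 * π / N * j))
  per := by
    intro j
    have hNr : (N : ℝ) ≠ 0 := by
      have : N ≠ 0 := by omega
      exact_mod_cast this
    have : 2 * π / N * ((j + N : ℤ) : ℝ) = 2 * π / N * j + 2 * π := by push_cast; field_simp
    simp only [this, ce_eq, Real.cos_add_two_pi, Real.sin_add_two_pi]
  one_lt := fun j => hG.one_lt _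
  conv := by
    intro j k
    have hN3 : (3:ℝ) ≤ N := by exact_mod_cast hN
    have hpi := Real.pi_pos
    have hδ : 0 < 2 * π / N := by positivity
    have hδ2 : 2 * π / N < π := by
      rw [div_lt_iff₀ (by linarith)]; nlinarith
    have hs := Real.sin_pos_of_pos_of_lt_pi hδ hδ2
    have hc := sin_cases hN (k - j)
    push_cast at hc ⊢
    set d := 2 * π / N
    set m : ℝ := (k : ℝ) - j
    set a := -Real.sin (d * (m - 1)) / Real.sin d
    set b := Real.sin (d * m) / Real.sin d
    have hab : ¬ (0 < a ∧ 0 < b) := by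
      rintro ⟨h1, h2⟩
      refine hc ⟨?_, ?_⟩
      · have : Real.sin (d * m) = b * Real.sin d := by simp only [b]; field_simp
        rw [this]; positivity
      · have : Real.sin (d * (m - 1)) = -(a * Real.sin d) := by simp only [a]; field_simp
        rw [this]; nlinarith [mul_pos h1 hs]
    have hk : (d * k : ℝ) = d * j + d * m := by simp only [m]; ring
    have hm1 : d * (m - 1) = d * m - d := by ring
    have hj1 : d * ((j : ℝ) + 1) = d * j + d := by ring
    have e : ce (d * k) = a * ce (d * j) + b * ce (d * ((j : ℝ) + 1)) := by
      rw [hk, hj1]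
      simp only [a, b, hm1, ce_eq]
      have hcs := Real.sin_sq_add_cos_sq d
      apply Complex.ext
      · rw [Complex.add_re, Complex.re_ofReal_mul, Complex.re_ofReal_mul]
        simp only [Real.sin_sub, Real.cos_add]
        field_simp
        ring
      · rw [Complex.add_im, Complex.im_ofReal_mul, Complex.im_ofReal_mul]
        simp only [Real.sin_sub, Real.sin_add]
        field_simp
        ring
    have key := hG.conv e hab
    refine le_trans (le_of_eq ?_) key
    simp only [a, b, hm1, Real.sin_sub]
    field_simp
    ring

/-- hyperboloid coordinate of the boundary point in direction `φ` -/
def bw (G : ℂ → ℝ) (φ : ℝ) : ℂ := ((1 / √(G (ce φ) ^ 2 - 1) : ℝ) : ℂ) * ce φ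

lemma bw_lip (hG : IsGauge W K G) : ∃ L : NNReal, LipschitzWith L (bw G) := by
  obtain ⟨M, hM⟩ := hG.lip
  obtain ⟨x0, hx0, hmin⟩ := (isCompact_sphere (0:ℂ) 1).exists_isMinOn
    ⟨ce 0, by simp [norm_ce]⟩ hM.continuous.continuousOn
  rw [mem_sphere_zero_iff_norm] at hx0
  have hx0' : x0 ≠ 0 := by intro h; rw [h] at hx0; simp at hx0
  have hu0 : 1 < G x0 := by have := hG.lt x0 hx0'; rwa [hx0] at this
  have hmin' : ∀ φ, G x0 ≤ G (ce φ) := fun φ => hmin (mem_sphere_zero_iff_norm.2 (norm_ce φ))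
  have hG0 : G 0 = 0 := by
    have := hG.smul 0 0 le_rfl
    simpa using this
  have hmax : ∀ φ, G (ce φ) ≤ M := by
    intro φ
    have := hM.dist_le_mul (ce φ) 0
    rw [hG0, Real.dist_eq, sub_zero, dist_zero_right, norm_ce, mul_one] at this
    exact (le_abs_self _).trans this
  set c := √(G x0 ^ 2 - 1) with hc
  have hcp : 0 < c := Real.sqrt_pos.2 (by nlinarith)
  have hsq : ∀ φ, c ≤ √(G (ce φ) ^ 2 - 1) := fun φ =>
    Real.sqrt_le_sqrt (by nlinarith [hmin' φ])
  have hul : ∀ x y, |G (ce x) - G (ce y)| ≤ M * |x - y| := by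
    intro x y
    have h1 := hM.dist_le_mul (ce x) (ce y)
    have h2 := ce_lip.dist_le_mul x y
    rw [NNReal.coe_one, one_mul] at h2
    rw [Real.dist_eq] at h1 h2
    exact h1.trans (mul_le_mul_of_nonneg_left h2 M.2)
  have key : ∀ x y, dist (bw G x) (bw G y) ≤ (M * (2 * M) / (2 * c ^ 3) + 1 / c) * dist x y := by
    intro x y
    rw [dist_eq_norm, Real.dist_eq]
    have hA := hsq x
    have hB := hsq y
    have sA : √(G (ce x) ^ 2 - 1) ^ 2 = G (ce x) ^ 2 - 1 := Real.sq_sqrt (by nlinarith [hG.one_lt x])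
    have sB : √(G (ce y) ^ 2 - 1) ^ 2 = G (ce y) ^ 2 - 1 := Real.sq_sqrt (by nlinarith [hG.one_lt y])
    have e : bw G x - bw G y = ((1 / √(G (ce x) ^ 2 - 1) - 1 / √(G (ce y) ^ 2 - 1) : ℝ) : ℂ) * ce x +
        ((1 / √(G (ce y) ^ 2 - 1) : ℝ) : ℂ) * (ce x - ce y) := by
      unfold bw; push_cast; ring
    set A := √(G (ce x) ^ 2 - 1)
    set B := √(G (ce y) ^ 2 - 1)
    have hAp : 0 < A := by linarith
    have hBp : 0 < B := by linarith
    have h1 : |1 / A - 1 / B| ≤ M * (2 * M) / (2 * c ^ 3) * |x - y| := by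
      have e1 : 1 / A - 1 / B = (G (ce y) - G (ce x)) * (G (ce y) + G (ce x)) / (A * B * (A + B)) := by
        have : (G (ce y) - G (ce x)) * (G (ce y) + G (ce x)) = B ^ 2 - A ^ 2 := by rw [sA, sB]; ring
        rw [this]; field_simp; ring
      have hden : 2 * c ^ 3 ≤ A * B * (A + B) := by
        have : c * c ≤ A * B := mul_le_mul hA hB hcp.le hAp.le
        have : c * c * (c + c) ≤ A * B * (A + B) := mul_le_mul this (by linarith) (by linarith) (by positivity)
        nlinarith
      have hGx := hG.nonneg (ce x)
      have hGy := hG.nonneg (ce y)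
      rw [e1, abs_div, abs_mul, abs_of_pos (by positivity : 0 < A * B * (A + B)),
        abs_of_nonneg (by linarith : 0 ≤ G (ce y) + G (ce x)), abs_sub_comm]
      have h2 : |G (ce x) - G (ce y)| * (G (ce y) + G (ce x)) ≤ M * |x - y| * (2 * M) :=
        mul_le_mul (hul x y) (by linarith [hmax x, hmax y]) (by linarith)
          (mul_nonneg M.2 (abs_nonneg _))
      calc _ ≤ M * |x - y| * (2 * M) / (2 * c ^ 3) := by
            refine div_le_div₀ ?_ h2 (by positivity) hden
            have := M.2
            positivity
        _ = _ := by ring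
    rw [e]
    refine (norm_add_le _ _).trans ?_
    rw [norm_mul, norm_mul, norm_ce, Complex.norm_real, Complex.norm_real, mul_one, Real.norm_eq_abs,
      Real.norm_of_nonneg (by positivity), add_mul]
    refine add_le_add h1 ?_
    have h2 := ce_lip.dist_le_mul x y
    rw [NNReal.coe_one, one_mul, dist_eq_norm, Real.dist_eq] at h2
    exact mul_le_mul (one_div_le_one_div_of_le hcp hB) h2 (norm_nonneg _) (by positivity)
  have hnn : 0 ≤ M * (2 * M) / (2 * c ^ 3) + 1 / c := by have := M.2; positivity
  exact ⟨⟨_, hnn⟩, LipschitzWith.of_dist_le_mul key⟩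

end IsGauge

end

noncomputable section

namespace IsGauge

variable {W : ℍ → ℂ} {K : Set ℍ} {G : ℂ → ℝ}

lemma G_zero (hG : IsGauge W K G) : G 0 = 0 := by
  have := hG.smul 0 0 le_rfl
  simpa using this

lemma rad_pos (hG : IsGauge W K G) (φ : ℝ) : 0 < √(G (ce φ) ^ 2 - 1) :=
  Real.sqrt_pos.2 (by nlinarith [hG.one_lt φ])

lemma norm_bw (hG : IsGauge W K G) (φ : ℝ) : ‖bw G φ‖ = 1 / √(G (ce φ) ^ 2 - 1) := by
  have := hG.rad_pos φ
  rw [bw, norm_mul, norm_ce, Complex.norm_real, mul_one, Real.norm_of_nonneg (by positivity)]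

lemma TT_bw (hG : IsGauge W K G) (φ : ℝ) : G (bw G φ) = TT (bw G φ) := by
  have h := hG.rad_pos φ
  have h1 := hG.one_lt φ
  have h2 := norm_sq_TT (bw G φ)
  have e : G (bw G φ) = G (ce φ) / √(G (ce φ) ^ 2 - 1) := by
    rw [bw, hG.smul _ _ (by positivity)]; ring
  rw [e]
  refine (sq_eq_sq₀ (by positivity) (TT_pos _).le).1 ?_
  rw [hG.norm_bw] at h2
  have h3 : √(G (ce φ) ^ 2 - 1) ^ 2 = G (ce φ) ^ 2 - 1 := Real.sq_sqrt (by nlinarith)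
  have h4 : G (ce φ) ^ 2 - 1 ≠ 0 := by nlinarith
  rw [div_pow, h3] at h2 ⊢
  field_simp at h2 ⊢
  linarith

lemma bw_of_eq (hG : IsGauge W K G) {r φ : ℝ} (hr : 0 ≤ r) (h : G (r * ce φ) = TT (r * ce φ)) :
    (r : ℂ) * ce φ = bw G φ := by
  have h1 := hG.one_lt φ
  have h0 := hG.rad_pos φ
  have h2 := norm_sq_TT (r * ce φ)
  rw [← h, hG.smul _ _ hr, norm_mul, norm_ce, Complex.norm_real, mul_one, Real.norm_of_nonneg hr] at h2
  have h3 : √(G (ce φ) ^ 2 - 1) ^ 2 = G (ce φ) ^ 2 - 1 := Real.sq_sqrt (by nlinarith)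
  have : r = 1 / √(G (ce φ) ^ 2 - 1) := by
    refine (sq_eq_sq₀ hr (by positivity)).1 ?_
    have h4 : G (ce φ) ^ 2 - 1 ≠ 0 := by nlinarith
    rw [div_pow, h3]
    field_simp
    linarith
  rw [bw, ← this]

/-- boundary parametrization -/
def bd (hW : IsFrame W) (G : ℂ → ℝ) (φ : ℝ) : ℍ := hW.inv (bw G φ)

lemma W_bd (hW : IsFrame W) (φ : ℝ) : W (bd hW G φ) = bw G φ := hW.W_inv _

lemma bd_lip (hG : IsGauge W K G) (hW : IsFrame W) : ∃ L : NNReal, LipschitzWith L (bd hW G) := by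
  obtain ⟨L, hL⟩ := hG.bw_lip
  exact ⟨1 * L, hW.inv_lip.comp hL⟩

lemma poly_p (hG : IsGauge W K G) (hW : IsFrame W) {N : ℕ} (hN : 3 ≤ N) (j : ℤ) :
    (hG.poly hW N hN).p j = bd hW G (2 * π / N * j) := by
  apply hW.inj
  rw [W_bd hW]
  exact (hG.poly hW N hN).W_p j

lemma mem_frontier (hG : IsGauge W K G) (hK : IsClosed K) (z : ℍ) :
    z ∈ frontier K ↔ G (W z) = TT (W z) := by
  rw [hK.frontier_eq, Set.mem_sdiff, hG.mem, hG.mem_int]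
  constructor
  · rintro ⟨h1, h2⟩
    linarith
  · intro h
    exact ⟨h.le, by linarith⟩

lemma frontier_bd (hG : IsGauge W K G) (hW : IsFrame W) (hK : IsClosed K) {N : ℕ} (hN : 3 ≤ N) {z : ℍ}
    (hz : z ∈ frontier K) : ∃ k : ℕ, k < N ∧ ∃ φ ∈ Set.Ico 0 (2 * π / N),
      z = bd hW G (2 * π / N * k + φ) := by
  rw [hG.mem_frontier hK] at hz
  obtain ⟨k, φ, a, b, hk, hφ, -, -, -, hw, -⟩ := (hG.poly hW N hN).exists_comb (W z)
  refine ⟨k, hk, φ, hφ, ?_⟩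
  apply hW.inj
  rw [W_bd hW]
  have hw' : W z = ‖W z‖ * ce (2 * π / N * k + φ) := hw
  rw [hw'] at hz
  exact hw'.trans (hG.bw_of_eq (norm_nonneg _) hz)

lemma bd_mem (hG : IsGauge W K G) (hW : IsFrame W) (hK : IsClosed K) (φ : ℝ) :
    bd hW G φ ∈ frontier K := by
  rw [hG.mem_frontier hK, W_bd hW, hG.TT_bw]

lemma KN_sub (hG : IsGauge W K G) (hW : IsFrame W) {N : ℕ} (hN : 3 ≤ N) :
    (hG.poly hW N hN).KN ⊆ K := by
  intro z hz
  rw [hG.mem]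
  obtain ⟨k, φ, a, b, hk, hφ, ha, hb, hw, -, -⟩ := (hG.poly hW N hN).exists_comb (W z)
  have h1 := hz k
  rw [GPoly.L_wedge _ (k : ℤ) (w := (hG.poly hW N hN).W z) hw] at h1
  have h2 := hG.add_le (a * (hG.poly hW N hN).ee k) (b * (hG.poly hW N hN).ee ((k : ℤ) + 1))
  rw [← hw, hG.smul _ _ ha, hG.smul _ _ hb] at h2
  have e1 : (hG.poly hW N hN).u k = G ((hG.poly hW N hN).ee k) := rfl
  have e2 : (hG.poly hW N hN).u (k + 1) = G ((hG.poly hW N hN).ee (k + 1)) := rfl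
  have e3 : TT ((hG.poly hW N hN).W z) = TT (W z) := rfl
  rw [e1, e2, e3] at h1
  linarith

lemma bd_inj (hG : IsGauge W K G) (hW : IsFrame W) : Set.InjOn (bd hW G) (Set.Ico 0 (2 * π)) := by
  intro x hx y hy h
  have h1 := congrArg W h
  rw [W_bd hW, W_bd hW] at h1
  have hx0 := hG.rad_pos x
  have hy0 := hG.rad_pos y
  exact exp_unique (by positivity) (by positivity) hx hy h1

lemma arc_le (hG : IsGauge W K G) (hW : IsFrame W) {a b : ℝ} (hab : a ≤ b) :
    ENNReal.ofReal (dist (bd hW G a) (bd hW G b)) ≤ μH[1] (bd hW G '' Set.Ico a b) := by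
  obtain ⟨L, hL⟩ := hG.bd_lip hW
  have hc := hL.continuous
  rcases hab.eq_or_lt with rfl | hlt
  · simp
  set f : ℍ → ℝ := fun x => dist (bd hW G a) x
  have hf : LipschitzWith 1 f := LipschitzWith.dist_right _
  have hpre : IsPreconnected (f '' (bd hW G '' Set.Ico a b)) :=
    (isPreconnected_Ico.image _ hc.continuousOn).image _ hf.continuous.continuousOn
  set d := dist (bd hW G a) (bd hW G b) with hd
  have hsub : Set.Ico 0 d ⊆ f '' (bd hW G '' Set.Ico a b) := by
    intro x hx
    have h0 : (0:ℝ) ∈ f '' (bd hW G '' Set.Ico a b) :=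
      ⟨bd hW G a, ⟨a, ⟨le_rfl, hlt⟩, rfl⟩, dist_self _⟩
    have hcl : d ∈ closure ((fun y => f (bd hW G y)) '' Set.Ico a b) := by
      have hcc : Continuous (fun y => f (bd hW G y)) := hf.continuous.comp hc
      have := image_closure_subset_closure_image hcc (s := Set.Ico a b)
      rw [closure_Ico hlt.ne] at this
      exact this ⟨b, ⟨hlt.le, le_rfl⟩, rfl⟩
    obtain ⟨y, hy1, hy2⟩ := mem_closure_iff.1 hcl (Set.Ioi x) isOpen_Ioi hx.2
    obtain ⟨s, hs, rfl⟩ := hy2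
    exact hpre.ordConnected.out h0 ⟨_, ⟨s, hs, rfl⟩, rfl⟩ ⟨hx.1, le_of_lt hy1⟩
  calc ENNReal.ofReal d = volume (Set.Ico 0 d) := by rw [Real.volume_Ico, sub_zero]
    _ = μH[1] (Set.Ico 0 d) := by rw [MeasureTheory.hausdorffMeasure_real]
    _ ≤ μH[1] (f '' (bd hW G '' Set.Ico a b)) := measure_mono hsub
    _ ≤ ((1 : NNReal) : ENNReal) ^ (1:ℝ) * μH[1] (bd hW G '' Set.Ico a b) :=
        hf.hausdorffMeasure_image_le zero_le_one _
    _ = _ := by simp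

lemma perim_finite (hG : IsGauge W K G) (hW : IsFrame W) (hK : IsClosed K) : μH[1] (frontier K) < ⊤ := by
  obtain ⟨L, hL⟩ := hG.bd_lip hW
  have hsub : frontier K ⊆ bd hW G '' Set.Icc 0 (2 * π) := by
    intro z hz
    obtain ⟨k, hk, φ, hφ, rfl⟩ := hG.frontier_bd hW hK (le_refl 3) hz
    have := (hG.poly hW 3 le_rfl).ang_mem (j := k) hk (φ := 2 * π / (3 : ℕ) * k + φ)
      (by show 2 * π / (3 : ℕ) * (k : ℝ) ≤ _; linarith [hφ.1])
      (by show _ < 2 * π / (3 : ℕ) * ((k : ℝ) + 1); linarith [hφ.2])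
    exact ⟨_, ⟨this.1, this.2.le⟩, rfl⟩
  calc μH[1] (frontier K) ≤ μH[1] (bd hW G '' Set.Icc 0 (2 * π)) := measure_mono hsub
    _ ≤ (L : ENNReal) ^ (1:ℝ) * μH[1] (Set.Icc 0 (2 * π)) := hL.hausdorffMeasure_image_le zero_le_one _
    _ < ⊤ := by
      rw [MeasureTheory.hausdorffMeasure_real, Real.volume_Icc]
      exact ENNReal.mul_lt_top (by simp) ENNReal.ofReal_lt_top

lemma len_le (hG : IsGauge W K G) (hW : IsFrame W) (hK : IsClosed K) {N : ℕ} (hN : 3 ≤ N) :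
    (hG.poly hW N hN).len ≤ hypPerim K := by
  obtain ⟨L, hL⟩ := hG.bd_lip hW
  have hNr : (0:ℝ) < N := by
    have : 0 < N := by omega
    exact_mod_cast this
  have hpi := Real.pi_pos
  have hδ : 0 < 2 * π / N := by positivity
  have hNδ : 2 * π / N * N = 2 * π := by field_simp
  set d := 2 * π / N with hd
  set A : ℕ → Set ℝ := fun j => Set.Ico (d * j) (d * (j + 1)) with hA
  have hAsub : ∀ j, j < N → A j ⊆ Set.Ico 0 (2 * π) := by
    intro j hj x hx
    have h1 : (j : ℝ) + 1 ≤ N := by exact_mod_cast hj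
    refine ⟨le_trans (by positivity) hx.1, hx.2.trans_le ?_⟩
    have := mul_le_mul_of_nonneg_left h1 hδ.le
    rwa [hNδ] at this
  have hdisj : (↑(Finset.range N) : Set ℕ).PairwiseDisjoint (fun j => bd hW G '' A j) := by
    intro i hi j hj hij
    rw [Finset.mem_coe, Finset.mem_range] at hi hj
    rw [Function.onFun, Set.disjoint_left]
    rintro _ ⟨x, hx, rfl⟩ ⟨y, hy, hxy⟩
    have hxy' := hG.bd_inj hW (hAsub _ hj hy) (hAsub _ hi hx) hxy
    subst hxy'
    apply hij
    have h1 : (i : ℝ) < j + 1 := lt_of_mul_lt_mul_left (hx.1.trans_lt hy.2) hδ.le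
    have h2 : (j : ℝ) < i + 1 := lt_of_mul_lt_mul_left (hy.1.trans_lt hx.2) hδ.le
    have h1' : i < j + 1 := by exact_mod_cast h1
    have h2' : j < i + 1 := by exact_mod_cast h2
    omega
  have hmeas : ∀ j ∈ Finset.range N, MeasurableSet (bd hW G '' A j) := by
    intro j hj
    rw [Finset.mem_range] at hj
    exact measurableSet_Ico.image_of_continuousOn_injOn hL.continuous.continuousOn
      ((hG.bd_inj hW).mono (hAsub j hj))
  have hlen : ENNReal.ofReal (hG.poly hW N hN).len ≤ μH[1] (frontier K) := by
    calc ENNReal.ofReal (hG.poly hW N hN).len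
        ≤ ∑ j ∈ Finset.range N, ENNReal.ofReal (dist ((hG.poly hW N hN).p j) ((hG.poly hW N hN).p ((j : ℤ) + 1))) :=
          GPoly.ofReal_sum_le _ _
      _ ≤ ∑ j ∈ Finset.range N, μH[1] (bd hW G '' A j) := by
          refine Finset.sum_le_sum fun j _ => ?_
          rw [hG.poly_p hW hN, hG.poly_p hW hN]
          have := hG.arc_le hW (a := d * j) (b := d * (j + 1)) (by nlinarith)
          push_cast
          exact this
      _ = μH[1] (⋃ j ∈ Finset.range N, bd hW G '' A j) := (measure_biUnion_finset hdisj hmeas).symm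
      _ ≤ μH[1] (frontier K) := by
          refine measure_mono ?_
          refine Set.iUnion₂_subset fun j _ => ?_
          rintro _ ⟨x, -, rfl⟩
          exact hG.bd_mem hW hK x
  have := (ENNReal.ofReal_le_iff_le_toReal (hG.perim_finite hW hK).ne).1 hlen
  exact this

end IsGauge

end

noncomputable section

lemma inter_frontier_nonempty {X : Type*} [TopologicalSpace X] {s A : Set X} (hs : IsPreconnected s)
    (h1 : (s ∩ A).Nonempty) (h2 : (s ∩ Aᶜ).Nonempty) : (s ∩ frontier A).Nonempty := by
  by_contra hne
  rw [Set.not_nonempty_iff_eq_empty] at hne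
  have hn : ∀ x ∈ s, x ∉ frontier A := fun x hx hf => by
    have : x ∈ s ∩ frontier A := ⟨hx, hf⟩
    rw [hne] at this
    exact this
  have hIntr : ∀ x ∈ s, x ∈ closure A → x ∈ interior A := by
    intro x hx hc
    by_contra hi
    exact hn x hx ⟨hc, hi⟩
  obtain ⟨x, hx, hxA⟩ := h1
  obtain ⟨y, hy, hyA⟩ := h2
  obtain ⟨z, -, hz1, hz2⟩ := hs (interior A) (closure A)ᶜ isOpen_interior isClosed_closure.isOpen_compl
    (fun x hx => by
      by_cases hc : x ∈ closure A
      · exact Or.inl (hIntr x hx hc)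
      · exact Or.inr hc)
    ⟨x, hx, hIntr x hx (subset_closure hxA)⟩
    ⟨y, hy, fun hc => hyA (interior_subset (hIntr y hy hc))⟩
  exact hz2 (subset_closure (interior_subset hz1))

lemma TT_zero : TT 0 = 1 := by simp [TT]

lemma IsFrame.cosh_center {V : ℍ → ℂ} (hV : IsFrame V) {c : ℍ} (hc : V c = 0) (z : ℍ) :
    Real.cosh (dist c z) = TT (V z) := by
  rw [hV.dist_eq, hc, mink, TT_zero]; simp

lemma IsFrame.sinh_center {V : ℍ → ℂ} (hV : IsFrame V) {c : ℍ} (hc : V c = 0) (z : ℍ) :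
    Real.sinh (dist c z) = ‖V z‖ := by
  refine (sq_eq_sq₀ (Real.sinh_nonneg_iff.2 dist_nonneg) (norm_nonneg _)).1 ?_
  rw [norm_sq_TT, Real.sinh_sq, hV.cosh_center hc]

lemma closedBall_preconnected (c : ℍ) (t : ℝ) : IsPreconnected (closedBall c t) := by
  obtain ⟨V, hV, hc⟩ := exists_frame c
  have : closedBall c t = hV.inv '' closedBall 0 (Real.sinh t) := by
    ext z
    have key : ∀ z, dist z c ≤ t ↔ ‖V z‖ ≤ Real.sinh t := by
      intro z
      rw [← hV.sinh_center hc, Real.sinh_le_sinh, dist_comm]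
    constructor
    · intro hz
      exact ⟨V z, mem_closedBall_zero_iff.2 ((key z).1 hz), hV.inv_W z⟩
    · rintro ⟨w, hw, rfl⟩
      rw [mem_closedBall_zero_iff] at hw
      exact (key _).2 (by rw [hV.W_inv]; exact hw)
  rw [this]
  exact (convex_closedBall (0:ℂ) (Real.sinh t)).isPreconnected.image _ hV.inv_lip.continuous.continuousOn

/-- extension of a geodesic -/
lemma exists_extend (c' c : ℍ) {t : ℝ} (ht : 0 ≤ t) : ∃ x, dist c x = t ∧ dist c' x = dist c' c + t := by
  obtain ⟨V, hV, hc⟩ := exists_frame c'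
  obtain ⟨e, he, hw⟩ : ∃ e : ℂ, ‖e‖ = 1 ∧ V c = ((Real.sinh (dist c' c) : ℝ) : ℂ) * e := by
    rw [hV.sinh_center hc]
    refine ⟨ce (Complex.arg (V c)), norm_ce _, polar_form _⟩
  set s := dist c' c with hs
  have hs0 : 0 ≤ s := dist_nonneg
  have hn : e.re ^ 2 + e.im ^ 2 = 1 := by
    have := Complex.sq_norm e
    rw [he, Complex.normSq_apply] at this
    linarith
  have hT : ∀ a : ℝ, TT ((Real.sinh a : ℝ) * e) = Real.cosh a := by
    intro a
    refine TT_eq_of_sq (Real.cosh_pos a).le ?_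
    rw [Complex.re_ofReal_mul, Complex.im_ofReal_mul, Real.cosh_sq]
    linear_combination (-Real.sinh a ^ 2) * hn
  refine ⟨hV.inv ((Real.sinh (s + t) : ℝ) * e), ?_, ?_⟩
  · have h1 := hV.dist_eq c (hV.inv ((Real.sinh (s + t) : ℝ) * e))
    rw [hV.W_inv, hw, mink, hT, hT, Complex.re_ofReal_mul, Complex.im_ofReal_mul, Complex.re_ofReal_mul,
      Complex.im_ofReal_mul] at h1
    have h2 : Real.cosh t = Real.cosh (s + t) * Real.cosh s - Real.sinh (s + t) * Real.sinh s := by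
      rw [← Real.cosh_sub]; congr 1; ring
    have h3 : Real.cosh (dist c (hV.inv ((Real.sinh (s + t) : ℝ) * e))) = Real.cosh t := by
      rw [h1, h2]
      linear_combination (-Real.sinh s * Real.sinh (s + t)) * hn
    have h5 := le_antisymm (Real.cosh_le_cosh.1 h3.le) (Real.cosh_le_cosh.1 h3.ge)
    rwa [abs_of_nonneg dist_nonneg, abs_of_nonneg ht] at h5
  · have h1 := hV.sinh_center hc (hV.inv ((Real.sinh (s + t) : ℝ) * e))
    rw [hV.W_inv, norm_mul, he, mul_one, Complex.norm_real,
      Real.norm_of_nonneg (Real.sinh_nonneg_iff.2 (by linarith))] at h1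
    exact Real.sinh_injective h1

lemma ball_sub_le {K : Set ℍ} {c c' : ℍ} {t R : ℝ} (ht : 0 ≤ t) (h1 : closedBall c t ⊆ K)
    (h2 : K ⊆ closedBall c' R) : dist c' c + t ≤ R := by
  obtain ⟨x, hx1, hx2⟩ := exists_extend c' c ht
  rw [← hx2, dist_comm]
  exact h2 (h1 (by rw [mem_closedBall, dist_comm, hx1]))

/-- A ray from `c` through `x` meets the frontier beyond `x`. -/
lemma exists_frontier_far {K : Set ℍ} (hK : IsCompact K) (c : ℍ) {x : ℍ} (hx : x ∈ K) :
    ∃ y ∈ frontier K, dist c x ≤ dist c y := by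
  obtain ⟨V, hV, hc⟩ := exists_frame c
  obtain ⟨B, hB⟩ := hK.isBounded.subset_closedBall c
  obtain ⟨e, he, hw⟩ : ∃ e : ℂ, ‖e‖ = 1 ∧ V x = ((Real.sinh (dist c x) : ℝ) : ℂ) * e := by
    rw [hV.sinh_center hc]
    refine ⟨ce (Complex.arg (V x)), norm_ce _, polar_form _⟩
  set s := dist c x with hs
  have hs0 : 0 ≤ s := dist_nonneg
  have hd : ∀ a, 0 ≤ a → dist c (hV.inv ((Real.sinh a : ℝ) * e)) = a := by
    intro a ha
    have h1 := hV.sinh_center hc (hV.inv ((Real.sinh a : ℝ) * e))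
    rw [hV.W_inv, norm_mul, he, mul_one, Complex.norm_real,
      Real.norm_of_nonneg (Real.sinh_nonneg_iff.2 ha)] at h1
    exact Real.sinh_injective h1
  have hcont : Continuous (fun a : ℝ => hV.inv ((Real.sinh a : ℝ) * e)) :=
    hV.inv_lip.continuous.comp
      ((Complex.continuous_ofReal.comp Real.continuous_sinh).mul continuous_const)
  obtain ⟨_, ⟨a, ha, rfl⟩, hy⟩ := inter_frontier_nonempty (A := K)
    (isPreconnected_Ici (a := s) |>.image _ hcont.continuousOn)
    ⟨x, ⟨s, Set.mem_Ici.2 le_rfl, by show hV.inv _ = x; rw [← hw, hV.inv_W]⟩, hx⟩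
    ⟨_, ⟨max s (B + 1), Set.mem_Ici.2 (le_max_left _ _), rfl⟩, fun h => by
      have h1 := hB h
      rw [mem_closedBall, dist_comm, hd _ (hs0.trans (le_max_left _ _))] at h1
      linarith [le_max_right s (B + 1)]⟩
  refine ⟨_, hy, ?_⟩
  show s ≤ dist c (hV.inv ((Real.sinh a : ℝ) * e))
  rw [hd a (hs0.trans ha)]
  exact ha

lemma area_lt_top {K : Set ℍ} (hK : IsCompact K) : hypAreaMeasure K < ⊤ := by
  obtain ⟨B, hB⟩ := hK.isBounded.subset_closedBall (UpperHalfPlane.I)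
  calc hypAreaMeasure K ≤ hypAreaMeasure (closedBall UpperHalfPlane.I (max B 0)) :=
        measure_mono (hB.trans (closedBall_subset_closedBall (le_max_left _ _)))
    _ ≤ _ := ball_area_le _ (le_max_right _ _)
    _ < ⊤ := ENNReal.mul_lt_top ENNReal.ofReal_lt_top ENNReal.ofReal_lt_top

lemma GPoly.ball_sub (P : GPoly) {c : ℍ} {t : ℝ} (ht : 0 ≤ t) (hc : c ∈ P.KN)
    (h : ∀ j, ∀ x ∈ P.side j, t < dist c x) : closedBall c t ⊆ P.KN := by
  intro z hz
  by_contra hzK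
  obtain ⟨y, hy1, hy2⟩ := inter_frontier_nonempty (closedBall_preconnected c t)
    ⟨c, mem_closedBall_self ht, hc⟩ ⟨z, hz, hzK⟩
  obtain ⟨j, hj⟩ := P.frontier_side hy2
  have := h j y hj
  rw [mem_closedBall, dist_comm] at hy1
  linarith

lemma circ_bdd {K : Set ℍ} (hK : K.Nonempty) : BddBelow {R : ℝ | ∃ c : ℍ, K ⊆ Metric.closedBall c R} := by
  obtain ⟨x, hx⟩ := hK
  refine ⟨0, ?_⟩
  rintro R ⟨c, hc⟩
  exact dist_nonneg.trans (mem_closedBall.1 (hc hx))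

namespace IsGauge

variable {W : ℍ → ℂ} {K : Set ℍ} {G : ℂ → ℝ}

lemma sub_KN (hG : IsGauge W K G) (hW : IsFrame W) {N : ℕ} (hN : 3 ≤ N) {M : NNReal}
    (hM : LipschitzWith M G) {ρ : ℝ} (hρ0 : 0 ≤ ρ)
    (hρ : ρ * (1 + M * (2 * π / N)) ≤ Real.cos (2 * π / N / 2)) :
    {z | G (W z) ≤ ρ * TT (W z)} ⊆ (hG.poly hW N hN).KN := by
  intro z hz
  have hz' : G (W z) ≤ ρ * TT (W z) := hz
  set P := hG.poly hW N hN with hP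
  obtain ⟨k, φ, a, b, hk, hφ, ha, hb, hw, hw2, hab⟩ := P.exists_comb (W z)
  intro j
  refine (P.L_le_wedge j k ha hb hw).trans ?_
  rw [P.L_wedge k (w := W z) hw]
  show a * G (ce (2 * π / N * ((k : ℤ) : ℝ))) + b * G (ce (2 * π / N * (((k : ℤ) + 1 : ℤ) : ℝ))) - TT (W z) ≤ 0
  have hδ : P.δ = 2 * π / N := rfl
  rw [hδ] at hφ hw2 hab
  set d := 2 * π / N with hd
  have hd2 := P.δ_lt
  have hd1 := P.δ_pos
  rw [hδ] at hd1 hd2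
  have hcos : 0 < Real.cos (d / 2) := Real.cos_pos_of_mem_Ioo ⟨by linarith, by linarith⟩
  have hw3 : W z = ‖W z‖ * ce (d * k + φ) := hw2
  set U := G (ce (d * k + φ)) with hU
  have hU1 : 1 < U := hG.one_lt _
  have hGw : G (W z) = ‖W z‖ * U := by
    conv_lhs => rw [hw3]
    rw [hG.smul _ _ (norm_nonneg _)]
  have hlip : ∀ x, |x - (d * k + φ)| ≤ d → G (ce x) ≤ U * (1 + M * d) := by
    intro x hx
    have h1 := hM.dist_le_mul (ce x) (ce (d * k + φ))
    have h2 := ce_lip.dist_le_mul x (d * k + φ)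
    rw [NNReal.coe_one, one_mul, Real.dist_eq] at h2
    rw [Real.dist_eq] at h1
    have h3 : |G (ce x) - U| ≤ M * d := h1.trans (mul_le_mul_of_nonneg_left (h2.trans hx) M.2)
    have h4 := (le_abs_self _).trans h3
    have h5 : 0 ≤ M * d := mul_nonneg M.2 hd1.le
    nlinarith
  have hu1 := hlip (d * ((k : ℤ) : ℝ)) (by
    push_cast
    rw [abs_le]; constructor <;> linarith [hφ.1, hφ.2])
  have hu2 := hlip (d * (((k : ℤ) + 1 : ℤ) : ℝ)) (by
    push_cast
    rw [abs_le]; constructor <;> nlinarith [hφ.1, hφ.2])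
  have hMd : 0 ≤ M * d := mul_nonneg M.2 hd1.le
  have hT := TT_pos (W z)
  have e1 : a * G (ce (d * ((k : ℤ) : ℝ))) + b * G (ce (d * (((k : ℤ) + 1 : ℤ) : ℝ))) ≤
      (a + b) * (U * (1 + M * d)) := by
    have := mul_le_mul_of_nonneg_left hu1 ha
    have := mul_le_mul_of_nonneg_left hu2 hb
    linarith
  have hpos : 0 ≤ U * (1 + M * d) := by positivity
  have e2 : (a + b) * (U * (1 + M * d)) * Real.cos (d / 2) ≤ TT (W z) * Real.cos (d / 2) := by
    calc (a + b) * (U * (1 + M * d)) * Real.cos (d / 2)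
        = (a + b) * Real.cos (d / 2) * (U * (1 + M * d)) := by ring
      _ ≤ ‖W z‖ * (U * (1 + M * d)) := mul_le_mul_of_nonneg_right hab hpos
      _ = G (W z) * (1 + M * d) := by rw [hGw]; ring
      _ ≤ ρ * TT (W z) * (1 + M * d) := mul_le_mul_of_nonneg_right hz' (by linarith)
      _ = TT (W z) * (ρ * (1 + M * d)) := by ring
      _ ≤ _ := mul_le_mul_of_nonneg_left hρ hT.le
  have e3 := le_of_mul_le_mul_right e2 hcos
  linarith

lemma area_lim (hG : IsGauge W K G) (hW : IsFrame W) (hK : IsCompact K) {ε : ℝ} (hε : 0 < ε) :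
    ∀ᶠ N : ℕ in Filter.atTop, ∀ hN : 3 ≤ N,
      hypArea K - ε ≤ (hypAreaMeasure (hG.poly hW N hN).KN).toReal := by
  obtain ⟨M, hM⟩ := hG.lip
  have hGc := hM.continuous
  set ρ : ℕ → ℝ := fun n => 1 - 1 / ((n : ℝ) + 2) with hρ
  have hρm : Monotone ρ := by
    intro m n hmn
    have : (m : ℝ) ≤ n := by exact_mod_cast hmn
    show 1 - 1 / ((m : ℝ) + 2) ≤ 1 - 1 / ((n : ℝ) + 2)
    have := one_div_le_one_div_of_le (by positivity : (0:ℝ) < (m : ℝ) + 2) (by linarith : (m : ℝ) + 2 ≤ n + 2)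
    linarith
  have hρ1 : ∀ n, ρ n < 1 := by
    intro n
    have : (0:ℝ) < 1 / ((n : ℝ) + 2) := by positivity
    show 1 - 1 / ((n : ℝ) + 2) < 1
    linarith
  have hρ0 : ∀ n, 0 ≤ ρ n := by
    intro n
    have : 1 / ((n : ℝ) + 2) ≤ 1 := by
      rw [div_le_one (by positivity)]
      have : (0:ℝ) ≤ n := by positivity
      linarith
    show 0 ≤ 1 - 1 / ((n : ℝ) + 2)
    linarith
  set S : ℕ → Set ℍ := fun n => {z | G (W z) ≤ ρ n * TT (W z)} with hS
  have hSm : Monotone S := by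
    intro m n hmn z hz
    have hz' : G (W z) ≤ ρ m * TT (W z) := hz
    exact hz'.trans (mul_le_mul_of_nonneg_right (hρm hmn) (TT_pos _).le)
  have hKsub : K ⊆ (⋃ n, S n) ∪ {z | W z ∈ {w | G w = TT w}} := by
    intro z hz
    rw [hG.mem] at hz
    rcases hz.eq_or_lt with h | h
    · exact Or.inr h
    · left
      have hT := TT_pos (W z)
      have hq : 0 < 1 - G (W z) / TT (W z) := by rw [sub_pos, div_lt_one hT]; exact h
      obtain ⟨n, hn⟩ := exists_nat_one_div_lt hq
      refine Set.mem_iUnion.2 ⟨n, ?_⟩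
      show G (W z) ≤ (1 - 1 / ((n : ℝ) + 2)) * TT (W z)
      have h2 : 1 / ((n : ℝ) + 2) ≤ 1 / ((n : ℝ) + 1) :=
        one_div_le_one_div_of_le (by positivity) (by linarith)
      have h3 : G (W z) / TT (W z) ≤ 1 - 1 / ((n : ℝ) + 2) := by linarith
      rwa [div_le_iff₀ hT] at h3
  have hnull : hypAreaMeasure {z | W z ∈ {w | G w = TT w}} = 0 := by
    rw [hW.nu_apply (isClosed_eq hGc TT_cont).measurableSet]
    unfold nu
    exact withDensity_absolutelyContinuous _ _ hG.null
  have hle : hypAreaMeasure K ≤ hypAreaMeasure (⋃ n, S n) := by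
    refine (measure_mono hKsub).trans ((measure_union_le _ _).trans ?_)
    rw [hnull, add_zero]
  have hKt := area_lt_top hK
  by_cases hsmall : hypArea K < ε
  · exact Filter.Eventually.of_forall fun N hN => by
      have := ENNReal.toReal_nonneg (a := hypAreaMeasure (hG.poly hW N hN).KN)
      linarith
  push Not at hsmall
  have hlt : ENNReal.ofReal (hypArea K - ε) < hypAreaMeasure (⋃ n, S n) := by
    refine lt_of_lt_of_le ?_ hle
    rw [ENNReal.ofReal_lt_iff_lt_toReal (by linarith) hKt.ne]
    show hypArea K - ε < hypArea K
    linarith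
  obtain ⟨n, hn⟩ := (Filter.Tendsto.eventually_const_lt hlt
    (tendsto_measure_iUnion_atTop (μ := hypAreaMeasure) hSm)).exists
  have htend : Filter.Tendsto (fun N : ℕ => 2 * π / (N : ℝ)) Filter.atTop (nhds 0) :=
    tendsto_const_div_atTop_nhds_zero_nat _
  have hcontf : Continuous (fun x : ℝ => Real.cos (x / 2) - ρ n * (1 + M * x)) := by fun_prop
  have ht2 := (hcontf.tendsto 0).comp htend
  have hpos : (0:ℝ) < (fun x : ℝ => Real.cos (x / 2) - ρ n * (1 + M * x)) 0 := by
    simp only [zero_div, Real.cos_zero, mul_zero, add_zero, mul_one]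
    linarith [hρ1 n]
  filter_upwards [Filter.Tendsto.eventually_const_lt hpos ht2] with N hNN hN
  have hNN' : 0 < Real.cos (2 * π / N / 2) - ρ n * (1 + M * (2 * π / N)) := hNN
  have hsub := hG.sub_KN hW hN hM (hρ0 n) (by linarith)
  have hKNt : hypAreaMeasure (hG.poly hW N hN).KN < ⊤ := (measure_mono (hG.KN_sub hW hN)).trans_lt hKt
  rw [← ENNReal.ofReal_le_iff_le_toReal hKNt.ne]
  exact hn.le.trans (measure_mono hsub)

lemma circ_lim (hG : IsGauge W K G) (hW : IsFrame W) (hK : IsCompact K) {t : ℝ}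
    (ht : t < hypCircumradius K) :
    ∀ᶠ N : ℕ in Filter.atTop, ∀ hN : 3 ≤ N, ∀ c, ∃ j, t < dist c ((hG.poly hW N hN).p j) := by
  obtain ⟨L, hL⟩ := hG.bd_lip hW
  set ε := (hypCircumradius K - t) / 2 with hε
  have hε0 : 0 < ε := by rw [hε]; linarith
  have htend : Filter.Tendsto (fun N : ℕ => (L : ℝ) * (2 * π / (N : ℝ))) Filter.atTop (nhds 0) := by
    have := (tendsto_const_div_atTop_nhds_zero_nat (2 * π)).const_mul (L : ℝ)
    rwa [mul_zero] at this
  filter_upwards [htend.eventually_lt_const hε0] with N hNN hN c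
  by_contra hcon
  push Not at hcon
  have hfr : ∀ y ∈ frontier K, dist c y ≤ t + ε := by
    intro y hy
    obtain ⟨k, hk, φ, hφ, rfl⟩ := hG.frontier_bd hW hK.isClosed hN hy
    have h1 := hcon k
    rw [hG.poly_p hW hN] at h1
    have h2 := hL.dist_le_mul (2 * π / N * ((k : ℤ) : ℝ)) (2 * π / N * k + φ)
    rw [Real.dist_eq] at h2
    have h3 : |2 * π / N * ((k : ℤ) : ℝ) - (2 * π / N * k + φ)| ≤ 2 * π / N := by
      push_cast
      rw [abs_le]; constructor <;> linarith [hφ.1, hφ.2]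
    have h4 := mul_le_mul_of_nonneg_left h3 L.2
    have h5 := dist_triangle c (bd hW G (2 * π / N * ((k : ℤ) : ℝ))) (bd hW G (2 * π / N * k + φ))
    have h6 : (L : ℝ) * |2 * π / N * ((k : ℤ) : ℝ) - (2 * π / N * k + φ)| ≤ L * (2 * π / N) := h4
    linarith
  have hsub : K ⊆ closedBall c (t + ε) := by
    intro x hx
    obtain ⟨y, hy, hxy⟩ := exists_frontier_far hK c hx
    rw [mem_closedBall, dist_comm]
    exact hxy.trans (hfr y hy)
  have hne : K.Nonempty := ⟨_, hK.isClosed.frontier_subset (hG.bd_mem hW hK.isClosed 0)⟩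
  have : hypCircumradius K ≤ t + ε := csInf_le (circ_bdd hne) ⟨c, hsub⟩
  linarith

lemma main_t (hG : IsGauge W K G) (hW : IsFrame W) (hK : IsCompact K) {t Bd : ℝ} (ht0 : 0 ≤ t)
    (ht : t < hypCircumradius K) (hBd : 0 ≤ Bd) (Bad : Set ℍ)
    (hB : ∀ c, closedBall c t ⊆ K → c ∈ Bad) (hBa : hypAreaMeasure Bad ≤ ENNReal.ofReal Bd) :
    (2 * π + hypArea K) * Real.cosh t - 2 * π - Bd ≤ hypPerim K * Real.sinh t := by
  have key : ∀ ε > 0, (2 * π + (hypArea K - ε)) * Real.cosh t - 2 * π - Bd ≤ hypPerim K * Real.sinh t := by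
    intro ε hε
    obtain ⟨N, h1, h2, hN⟩ := ((hG.area_lim hW hK hε).and
      ((hG.circ_lim hW hK ht).and (Filter.eventually_ge_atTop 3))).exists
    have h3 := (hG.poly hW N hN).core ht0 hBd (h2 hN) Bad
      (fun c hc hc2 => hB c (((hG.poly hW N hN).ball_sub ht0 hc hc2).trans (hG.KN_sub hW hN))) hBa
    have h4 := hG.len_le hW hK.isClosed hN
    have h5 := mul_le_mul_of_nonneg_right h4 (Real.sinh_nonneg_iff.2 ht0)
    have h6 := mul_le_mul_of_nonneg_right (h1 hN) (Real.cosh_pos t).le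
    linarith
  refine le_of_forall_pos_le_add fun ε hε => ?_
  have hc := Real.cosh_pos t
  have := key (ε / Real.cosh t) (by positivity)
  have e : ε / Real.cosh t * Real.cosh t = ε := by field_simp
  nlinarith

end IsGauge

end

noncomputable section

lemma quad_of_ineq {F P t : ℝ} (hF : 0 < F) (hP : 0 ≤ P) (ht : 0 ≤ t)
    (h : F * Real.cosh t - 2 * π ≤ P * Real.sinh t) :
    ((F ^ 2 - P ^ 2) * Real.sinh t - 2 * π * P) ^ 2 + F ^ 2 * (F ^ 2 - P ^ 2) * 0 ≤
      F ^ 2 * (4 * π ^ 2 + P ^ 2 - F ^ 2) ∨ F ^ 2 - P ^ 2 < 0 := by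
  rcases lt_or_ge (F ^ 2 - P ^ 2) 0 with ha | ha
  · exact Or.inr ha
  left
  have hs : 0 ≤ Real.sinh t := Real.sinh_nonneg_iff.2 ht
  have hc := Real.cosh_pos t
  have hpi := Real.pi_pos
  have h1 : (F * Real.cosh t) ^ 2 ≤ (2 * π + P * Real.sinh t) ^ 2 := by
    apply pow_le_pow_left₀ (by positivity); linarith
  rw [mul_pow, Real.cosh_sq] at h1
  set x := Real.sinh t
  have h2 : (F ^ 2 - P ^ 2) * x ^ 2 - 4 * π * P * x + (F ^ 2 - 4 * π ^ 2) ≤ 0 := by nlinarith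
  have h3 := mul_le_mul_of_nonneg_left h2 ha
  nlinarith

lemma final_algebra {F P x y : ℝ} (hF : 0 < F)
    (hx : ((F ^ 2 - P ^ 2) * x - 2 * π * P) ^ 2 ≤ F ^ 2 * (4 * π ^ 2 + P ^ 2 - F ^ 2))
    (hy : ((F ^ 2 - P ^ 2) * y - 2 * π * P) ^ 2 ≤ F ^ 2 * (4 * π ^ 2 + P ^ 2 - F ^ 2)) :
    (x - y) ^ 2 * (F ^ 2 - P ^ 2) ^ 2 / (4 * F ^ 2) ≤ 4 * π ^ 2 + P ^ 2 - F ^ 2 := by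
  rw [div_le_iff₀ (by positivity)]
  have e : (x - y) ^ 2 * (F ^ 2 - P ^ 2) ^ 2 =
      (((F ^ 2 - P ^ 2) * x - 2 * π * P) - ((F ^ 2 - P ^ 2) * y - 2 * π * P)) ^ 2 := by ring
  rw [e]
  nlinarith [sq_nonneg (((F ^ 2 - P ^ 2) * x - 2 * π * P) + ((F ^ 2 - P ^ 2) * y - 2 * π * P))]

lemma radii_ineq {K : Set ℍ} (hKcomp : IsCompact K) (hKconv : HypConvex K) (hKint : (interior K).Nonempty) :
    0 ≤ hypInradius K ∧ 0 ≤ hypCircumradius K ∧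
    (2 * π + hypArea K) * Real.cosh (hypCircumradius K) - 2 * π ≤
      hypPerim K * Real.sinh (hypCircumradius K) ∧
    (2 * π + hypArea K) * Real.cosh (hypInradius K) - 2 * π ≤
      hypPerim K * Real.sinh (hypInradius K) := by
  obtain ⟨o, ho⟩ := hKint
  obtain ⟨W, hW, hWo⟩ := exists_frame o
  obtain ⟨G, hG⟩ := exists_gauge hW hKcomp hKconv ho hWo
  have hKne : K.Nonempty := ⟨o, interior_subset ho⟩
  set R := hypCircumradius K with hR
  set r := hypInradius K with hr
  have hRne : {R : ℝ | ∃ c : ℍ, K ⊆ Metric.closedBall c R}.Nonempty := by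
    obtain ⟨B, hB⟩ := hKcomp.isBounded.subset_closedBall o
    exact ⟨B, o, hB⟩
  obtain ⟨ε, hε, hball⟩ := Metric.isOpen_iff.1 isOpen_interior o ho
  have hmem : ε / 2 ∈ {r : ℝ | ∃ c : ℍ, Metric.closedBall c r ⊆ K} :=
    ⟨o, ((closedBall_subset_ball (by linarith)).trans hball).trans interior_subset⟩
  have hle : ∀ s ∈ {r : ℝ | ∃ c : ℍ, Metric.closedBall c r ⊆ K}, s ≤ R := by
    rintro s ⟨c, hc⟩
    refine le_csInf hRne ?_
    rintro R' ⟨c', hc'⟩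
    rcases le_or_gt 0 s with h | h
    · have := ball_sub_le h hc hc'
      linarith [dist_nonneg (x := c') (y := c)]
    · have := mem_closedBall.1 (hc' (interior_subset ho))
      linarith [dist_nonneg (x := o) (y := c')]
  have hbdd : BddAbove {r : ℝ | ∃ c : ℍ, Metric.closedBall c r ⊆ K} := ⟨R, hle⟩
  have hr0 : ε / 2 ≤ r := le_csSup hbdd hmem
  have hrR : r ≤ R := csSup_le ⟨_, hmem⟩ hle
  have hR0 : 0 < R := by linarith
  have ineqR : (2 * π + hypArea K) * Real.cosh R - 2 * π ≤ hypPerim K * Real.sinh R := by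
    have hcl : IsClosed {t : ℝ | (2 * π + hypArea K) * Real.cosh t - 2 * π -
        (2 * (2 * (R - t))) * (2 * Real.sinh (2 * (R - t))) ≤ hypPerim K * Real.sinh t} := by
      refine isClosed_le ?_ ?_
      · have := Real.continuous_sinh
        have := Real.continuous_cosh
        fun_prop
      · have := Real.continuous_sinh
        fun_prop
    have hsub : Set.Ico 0 R ⊆ {t : ℝ | (2 * π + hypArea K) * Real.cosh t - 2 * π -
        (2 * (2 * (R - t))) * (2 * Real.sinh (2 * (R - t))) ≤ hypPerim K * Real.sinh t} := by
      rintro t ⟨ht0, htR⟩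
      obtain ⟨R', ⟨c', hc'⟩, hR'⟩ := exists_lt_of_csInf_lt hRne
        (show sInf {R : ℝ | ∃ c : ℍ, K ⊆ Metric.closedBall c R} < R + (R - t) by
          change R < _; linarith)
      have hd : 0 ≤ 2 * (R - t) := by linarith
      have hs : 0 ≤ Real.sinh (2 * (R - t)) := Real.sinh_nonneg_iff.2 hd
      refine hG.main_t hW hKcomp ht0 htR (by positivity) (closedBall c' (2 * (R - t))) ?_ ?_
      · intro c hc
        have := ball_sub_le ht0 hc hc'
        rw [mem_closedBall, dist_comm]
        linarith
      · rw [ENNReal.ofReal_mul (by positivity)]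
        exact ball_area_le c' hd
    have h1 := hcl.closure_subset_iff.2 hsub
    rw [closure_Ico hR0.ne] at h1
    have h2 := h1 (Set.right_mem_Icc.2 hR0.le)
    simpa using h2
  refine ⟨by linarith, hR0.le, ineqR, ?_⟩
  rcases hrR.eq_or_lt with he | hlt
  · rw [he]; exact ineqR
  · have hcl : IsClosed {t : ℝ | (2 * π + hypArea K) * Real.cosh t - 2 * π - 0 ≤ hypPerim K * Real.sinh t} := by
      refine isClosed_le ?_ ?_
      · have := Real.continuous_cosh
        fun_prop
      · have := Real.continuous_sinh
        fun_prop
    have hsub : Set.Ioo r R ⊆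
        {t : ℝ | (2 * π + hypArea K) * Real.cosh t - 2 * π - 0 ≤ hypPerim K * Real.sinh t} := by
      rintro t ⟨hrt, htR⟩
      refine hG.main_t hW hKcomp (by linarith) htR le_rfl ∅ ?_ (by simp)
      intro c hc
      have : t ≤ r := le_csSup hbdd ⟨c, hc⟩
      linarith
    have h1 := hcl.closure_subset_iff.2 hsub
    rw [closure_Ioo hlt.ne] at h1
    have h2 := h1 (Set.left_mem_Icc.2 hlt.le)
    simpa using h2

end

/-- Conditional Bonnesen-type inequality for the hyperbolic plane `H²`. -/
theorem bonnesen_inequality_hyperbolic (K : Set ℍ)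
    (hKcomp : IsCompact K) (hKconv : HypConvex K) (hKint : (interior K).Nonempty)
    (h : (2 * π + hypArea K) ^ 2 - hypPerim K ^ 2 ≥ 0) :
    hypPerim K ^ 2 - hypArea K * (4 * π + hypArea K) ≥
      (Real.sinh (hypCircumradius K) - Real.sinh (hypInradius K)) ^ 2 *
        ((2 * π + hypArea K) ^ 2 - hypPerim K ^ 2) ^ 2 /
        (4 * (2 * π + hypArea K) ^ 2) := by
  obtain ⟨hr, hR, h1, h2⟩ := radii_ineq hKcomp hKconv hKint
  have hA : 0 ≤ hypArea K := ENNReal.toReal_nonneg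
  have hP : 0 ≤ hypPerim K := ENNReal.toReal_nonneg
  have hpi := Real.pi_pos
  have hF : 0 < 2 * π + hypArea K := by linarith
  have q1 := (quad_of_ineq hF hP hR h1).resolve_right (by linarith)
  have q2 := (quad_of_ineq hF hP hr h2).resolve_right (by linarith)
  rw [mul_zero, add_zero] at q1 q2
  have := final_algebra hF q1 q2
  have e : hypPerim K ^ 2 - hypArea K * (4 * π + hypArea K) =
    4 * π ^ 2 + hypPerim K ^ 2 - (2 * π + hypArea K) ^ 2 := by ring
  rw [e]
  exact this
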